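/- arXiv:1603.05523 — 3 statements merged into one kernel-verified Lean document; each statement's English description precedes it below -/
import Mathlib

section
/- Let d and m be positive integers, let ε > 0, and let n' be a positive integer with the ball-approximation property for (d, ε). Set n = (m·[(n' − 1)d + 1] − 1)(d + 1) + 1. Let T_1, T_2, …, T_n be subsets of ℝ^d such that for each i there exists c_i ∈ ℝ^d with B_1(c_i) ⊆ conv(T_i). Then one can choose points t_1 ∈ T_1, …, t_n ∈ T_n and a partition of {t_1, …, t_n} into m sets A_1, …, A_m such that there exists p ∈ ℝ^d with B_{1/(1+ε)}(p) ⊆ ⋂_{i=1}^m conv(A_i). -/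
open Pointwise

/-- A positive integer `n` has the ball-approximation property for `(d, ε)` if there is a
finite set `V ⊆ B_1(0)` with `|V| ≤ n` such that `B_1(0) ⊆ (1 + ε)·conv(V)`. -/
def BallApproxProp (d n : ℕ) (ε : ℝ) : Prop :=
  ∃ V : Finset (EuclideanSpace ℝ (Fin d)),
    (V : Set (EuclideanSpace ℝ (Fin d))) ⊆ Metric.closedBall 0 1 ∧ V.card ≤ n ∧
    Metric.closedBall (0 : EuclideanSpace ℝ (Fin d)) 1 ⊆
      (1 + ε) • convexHull ℝ (V : Set (EuclideanSpace ℝ (Fin d)))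

lemma inner_nonneg_of_norm_le_norm_add_smul {E : Type*} [NormedAddCommGroup E]
    [InnerProductSpace ℝ E] {u x : E} {c : ℝ} (hc : 0 < c)
    (h : ∀ τ, 0 < τ → τ ≤ c → ‖u‖ ≤ ‖u + τ • x‖) : 0 ≤ inner ℝ u x := by
  by_contra! hneg
  set γ := inner ℝ u x with hγ
  have hx : 0 < ‖x‖ ^ 2 + 1 := by positivity
  set τ := min c (-γ / (‖x‖ ^ 2 + 1)) with hτ
  have hτ0 : 0 < τ := lt_min hc (div_pos (by linarith) hx)
  have hτ1 : τ * (‖x‖ ^ 2 + 1) ≤ -γ := by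
    rw [← le_div_iff₀ hx]
    exact min_le_right _ _
  have h1 := pow_le_pow_left₀ (norm_nonneg _) (h τ hτ0 (min_le_left _ _)) 2
  rw [norm_add_sq_real, norm_smul, inner_smul_right, Real.norm_of_nonneg hτ0.le, ← hγ] at h1
  have h2 : 0 ≤ τ * (2 * γ + τ * ‖x‖ ^ 2) := by nlinarith
  have h3 := nonneg_of_mul_nonneg_right h2 hτ0
  nlinarith

section Colorful

variable {E ι : Type*} [NormedAddCommGroup E] [InnerProductSpace ℝ E] [FiniteDimensional ℝ E]
  [Fintype ι]

lemma exists_nonneg_weights_minimizing_dist (s : ι → E) (J : Finset ι)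
    (hJ : LinearIndepOn ℝ s (J : Set ι)) (b : E) :
    ∃ a : ι → ℝ, (∀ i, 0 ≤ a i) ∧ (∀ i, i ∉ J → a i = 0) ∧
      ∀ a' : ι → ℝ, (∀ i, 0 ≤ a' i) → (∀ i, i ∉ J → a' i = 0) →
        ‖∑ i, a i • s i - b‖ ≤ ‖∑ i, a' i • s i - b‖ := by
  classical
  let L := Fintype.linearCombination ℝ (fun j : J => s j)
  have hL : LinearMap.ker L = ⊥ := LinearMap.ker_eq_bot.2 hJ.fintypeLinearCombination_injective
  have hclosed : IsClosed (L '' Set.Ici 0) :=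
    (LinearMap.isClosedEmbedding_of_injective hL).isClosedMap _ isClosed_Ici
  obtain ⟨_, ⟨a, ha, rfl⟩, hmin⟩ :=
    hclosed.exists_infDist_eq_dist ⟨_, Set.mem_image_of_mem _ Set.self_mem_Ici⟩ b
  have key : ∀ a' : ι → ℝ, (∀ i, i ∉ J → a' i = 0) →
      ∑ i, a' i • s i = L (fun j => a' j) := by
    intro a' h
    rw [Fintype.linearCombination_apply, Finset.sum_coe_sort J (fun i => a' i • s i)]
    refine (Finset.sum_subset (Finset.subset_univ _) fun i _ hi => ?_).symm
    rw [h i hi, zero_smul]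
  refine ⟨fun i => if h : i ∈ J then a ⟨i, h⟩ else 0, fun i => ?_, fun i hi => by simp [hi], ?_⟩
  · dsimp only
    split_ifs with h
    · exact ha ⟨i, h⟩
    · rfl
  · intro a' h0 h1
    rw [key _ h1, key _ (fun i hi => by simp [hi])]
    have : (fun j : J => if h : (j : ι) ∈ J then a ⟨j, h⟩ else 0) = a := by
      ext j; simp
    rw [this, ← dist_eq_norm, ← dist_eq_norm, dist_comm, ← hmin, dist_comm]
    exact Metric.infDist_le_dist_of_mem ⟨_, fun j => h0 j, rfl⟩

/-- The conic version of the colorful Carathéodory theorem. -/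
theorem exists_colorful_conic_combination (hcard : Module.finrank ℝ E ≤ Fintype.card ι)
    (S : ι → Finset E) (b : E) (hb : ∀ i, b ∈ convexHull ℝ (S i : Set E)) :
    ∃ s : ι → E, (∀ i, s i ∈ S i) ∧ ∃ a : ι → ℝ, (∀ i, 0 ≤ a i) ∧ ∑ i, a i • s i = b := by
  classical
  have H := fun q : (ι → E) × Finset ι => exists_nonneg_weights_minimizing_dist q.1 q.2 (b := b)
  choose! a ha0 haJ hamin using H
  have hne : ∀ i, ∃ x, x ∈ S i := fun i => by
    have := convexHull_nonempty_iff.1 ⟨b, hb i⟩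
    exact this
  choose s₀ hs₀ using hne
  obtain ⟨⟨s, J⟩, hq, hmin'⟩ := Finset.exists_min_image
    ((Fintype.piFinset S ×ˢ (Finset.univ : Finset (Finset ι))).filter
      fun q => LinearIndepOn ℝ q.1 (q.2 : Set ι))
    (fun q => ‖∑ i, a q i • q.1 i - b‖) ⟨(s₀, ∅), by simp [hs₀]⟩
  simp only [Finset.mem_filter, Finset.mem_product, Fintype.mem_piFinset, Finset.mem_univ,
    and_true] at hq hmin'
  obtain ⟨hs, hJ⟩ := hq
  set α := a (s, J) with hα
  have hα0 : ∀ i, 0 ≤ α i := ha0 (s, J) hJ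
  have hαJ : ∀ i, i ∉ J → α i = 0 := haJ (s, J) hJ
  set u := ∑ i, α i • s i - b with hu
  have hmin : ∀ (s' : ι → E) (J' : Finset ι) (a' : ι → ℝ), (∀ i, s' i ∈ S i) →
      LinearIndepOn ℝ s' (J' : Set ι) → (∀ i, 0 ≤ a' i) → (∀ i, i ∉ J' → a' i = 0) →
      ‖u‖ ≤ ‖∑ i, a' i • s' i - b‖ := fun s' J' a' h1 h2 h3 h4 =>
    (hmin' (s', J') ⟨h1, h2⟩).trans (hamin (s', J') h2 a' h3 h4)
  by_cases hu0 : u = 0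
  · exact ⟨s, hs, α, hα0, sub_eq_zero.1 hu0⟩
  exfalso
  have horth : ∀ j, α j ≠ 0 → inner ℝ u (s j) = 0 := by
    intro j hj
    have hjpos : 0 < α j := lt_of_le_of_ne (hα0 j) hj.symm
    have hshift : ∀ τ : ℝ, -α j ≤ τ → ‖u‖ ≤ ‖u + τ • s j‖ := by
      intro τ hτ
      have h := hmin s J (fun i => α i + if i = j then τ else 0) hs hJ
        (fun i => by
          split_ifs with h
          · subst h; linarith
          · simpa using hα0 i)
        (fun i hi => by
          have : i ≠ j := by rintro rfl; exact hj (hαJ _ hi)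
          simp [this, hαJ i hi])
      simpa [add_smul, Finset.sum_add_distrib, ite_smul, hu, sub_add_eq_add_sub] using h
    have h1 := inner_nonneg_of_norm_le_norm_add_smul (x := s j) one_pos
      fun τ h0 _ => hshift τ (by linarith)
    have h2 := inner_nonneg_of_norm_le_norm_add_smul (u := u) (x := -s j) hjpos
      fun τ h0 h1 => by simpa using hshift (-τ) (by linarith)
    rw [inner_neg_right] at h2
    linarith
  have hz : inner ℝ u (∑ i, α i • s i) = 0 := by
    rw [inner_sum]
    refine Finset.sum_eq_zero fun i _ => ?_
    rw [inner_smul_right]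
    by_cases h : α i = 0
    · simp [h]
    · simp [horth i h]
  have hub : inner ℝ u b < 0 := by
    have : b = ∑ i, α i • s i - u := by simp [hu]
    rw [this, inner_sub_right, hz, real_inner_self_eq_norm_sq]
    have := norm_pos_iff.2 hu0
    nlinarith
  have hex : ∃ i, α i = 0 := by
    by_contra! hall
    have hJu : J = Finset.univ := Finset.eq_univ_of_forall fun i => by
      by_contra hi
      exact hall i (hαJ i hi)
    have hli : LinearIndependent ℝ s := by
      rw [hJu, Finset.coe_univ] at hJ
      exact linearIndepOn_univ_iff.1 hJ
    have hspan := hli.span_eq_top_of_card_eq_finrank'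
      (le_antisymm hli.fintype_card_le_finrank hcard)
    have hle : Submodule.span ℝ (Set.range s) ≤ (ℝ ∙ u)ᗮ := by
      rw [Submodule.span_le]
      rintro _ ⟨i, rfl⟩
      exact Submodule.mem_orthogonal_singleton_iff_inner_right.2 (horth i (hall i))
    rw [hspan] at hle
    exact hu0 (inner_self_eq_zero.1 (Submodule.mem_orthogonal_singleton_iff_inner_right.1
      (hle (Submodule.mem_top (x := u)))))
  obtain ⟨i, hi⟩ := hex
  have hx : ∃ x ∈ S i, inner ℝ u x < 0 := by
    by_contra! hcon
    have : convexHull ℝ (S i : Set E) ⊆ {x | 0 ≤ inner ℝ u x} :=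
      convexHull_min hcon (convex_halfSpace_ge (innerₛₗ ℝ u).isLinear 0)
    exact absurd (this (hb i)) (not_le.2 hub)
  obtain ⟨x, hxS, hx⟩ := hx
  let J' := J.filter fun j => α j ≠ 0
  have hiJ' : i ∉ J' := by simp [J', hi]
  have hli : LinearIndepOn ℝ (Function.update s i x) ((insert i J' : Finset ι) : Set ι) := by
    rw [Finset.coe_insert, linearIndepOn_insert (by simpa using hiJ')]
    have heq : Set.EqOn s (Function.update s i x) J' := fun j hj => by
      have : j ≠ i := by rintro rfl; exact hiJ' hj
      simp [this]
    refine ⟨(hJ.mono fun j hj => (Finset.mem_filter.1 hj).1).congr heq, fun hmem => ?_⟩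
    rw [← heq.image_eq, Function.update_self] at hmem
    have hle : Submodule.span ℝ (s '' J') ≤ (ℝ ∙ u)ᗮ := by
      rw [Submodule.span_le]
      rintro _ ⟨j, hj, rfl⟩
      exact Submodule.mem_orthogonal_singleton_iff_inner_right.2
        (horth j (Finset.mem_filter.1 hj).2)
    exact hx.ne (Submodule.mem_orthogonal_singleton_iff_inner_right.1 (hle hmem))
  refine hx.not_ge (inner_nonneg_of_norm_le_norm_add_smul one_pos fun τ h0 _ => ?_)
  have h := hmin (Function.update s i x) (insert i J') (Function.update α i τ)
    (fun j => by
      rcases eq_or_ne j i with rfl | h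
      · simpa using hxS
      · simpa [h] using hs j)
    hli
    (fun j => by
      rcases eq_or_ne j i with rfl | h
      · simpa using h0.le
      · simpa [h] using hα0 j)
    (fun j hj => by
      simp only [J', Finset.mem_insert, Finset.mem_filter, not_or, not_and, not_not] at hj
      rw [Function.update_of_ne hj.1]
      by_contra h
      exact h (hj.2 (by_contra fun hjJ => h (hαJ j hjJ))))
  have hsum : ∑ j, Function.update α i τ j • Function.update s i x j
      = ∑ j, α j • s j + τ • x := by
    have : ∀ j, Function.update α i τ j • Function.update s i x j
        = α j • s j + if j = i then τ • x else 0 := fun j => by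
      rcases eq_or_ne j i with rfl | h
      · simp [hi]
      · simp [h]
    simp [this, Finset.sum_add_distrib]
  rwa [hsum, ← sub_add_eq_add_sub] at h

/-- If `v ≠ 0` lies in the convex hull of each of at least `dim E` sets, then some colorful
choice of points has a convex hull that meets the ray `{l • v | 1 ≤ l}`. -/
theorem exists_colorful_smul_mem_convexHull (hcard : Module.finrank ℝ E ≤ Fintype.card ι)
    (S : ι → Set E) {v : E} (hv : v ≠ 0) (hS : ∀ i, v ∈ convexHull ℝ (S i)) :
    ∃ s : ι → E, (∀ i, s i ∈ S i) ∧ ∃ l : ℝ, 1 ≤ l ∧ l • v ∈ convexHull ℝ (Set.range s) := by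
  classical
  have hfin : ∀ i, ∃ F : Finset E, (F : Set E) ⊆ S i ∧ v ∈ convexHull ℝ (F : Set E) := fun i => by
    have := hS i
    rw [convexHull_eq_union_convexHull_finite_subsets] at this
    simpa using this
  choose F hFS hvF using hfin
  have approx : ∀ θ : ℝ, 0 < θ → θ < 1 → ∃ s ∈ Fintype.piFinset F, ∃ l : ℝ, θ < l ∧
      l • v ∈ convexHull ℝ (Set.range s) := by
    intro θ h0 h1
    obtain ⟨s, hs, a, ha, hsum⟩ := exists_colorful_conic_combination hcard
      (fun i => (F i).image fun x => -(θ • v) + x) (-(θ • v) + v) (fun i => by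
        have : -(θ • v) + v ∈ -(θ • v) +ᵥ convexHull ℝ (F i : Set E) :=
          Set.vadd_mem_vadd_set (hvF i)
        rw [← convexHull_vadd] at this
        rw [Finset.coe_image]
        exact this)
    simp only [Finset.mem_image] at hs
    choose t ht hts using hs
    set A := ∑ i, a i with hA
    have hsum' : ∑ i, a i • t i = (1 - θ + θ * A) • v := by
      simp_rw [← hts, smul_add, Finset.sum_add_distrib, ← Finset.sum_smul, ← hA] at hsum
      rw [neg_add_eq_sub, smul_neg, neg_add_eq_sub, sub_eq_iff_eq_add] at hsum
      rw [hsum]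
      module
    have hA0 : 0 < A := by
      refine lt_of_le_of_ne (Finset.sum_nonneg fun i _ => ha i) fun h => ?_
      have hall := (Finset.sum_eq_zero_iff_of_nonneg fun i _ => ha i).1 h.symm
      have h0 : ∑ i, a i • t i = 0 := Finset.sum_eq_zero fun i hi => by rw [hall i hi, zero_smul]
      rw [h0, ← h, mul_zero, add_zero, eq_comm, smul_eq_zero] at hsum'
      rcases hsum' with h' | h'
      · linarith
      · exact hv h'
    refine ⟨t, Fintype.mem_piFinset.2 ht, (1 - θ + θ * A) / A, ?_, ?_⟩
    · rw [lt_div_iff₀ hA0]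
      linarith
    · have := Finset.centerMass_mem_convexHull (R := ℝ) Finset.univ (w := a) (z := t)
        (s := Set.range t) (fun i _ => ha i) hA0 (fun i _ => ⟨i, rfl⟩)
      rw [Finset.centerMass, hsum', smul_smul, ← hA] at this
      rwa [div_eq_inv_mul]
  by_contra! hcon
  have hbound : ∀ s ∈ Fintype.piFinset F, ∃ θ : ℝ, θ < 1 ∧
      ∀ l : ℝ, l • v ∈ convexHull ℝ (Set.range s) → l ≤ θ := by
    intro s hs
    have hK : IsCompact (convexHull ℝ (Set.range s)) :=
      (Set.finite_range s).isCompact_convexHull ℝ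
    have hL : IsCompact ((fun l : ℝ => l • v) ⁻¹' convexHull ℝ (Set.range s)) :=
      (isClosedEmbedding_smul_left hv).isCompact_preimage hK
    rcases Set.eq_empty_or_nonempty ((fun l : ℝ => l • v) ⁻¹' convexHull ℝ (Set.range s))
      with he | hne
    · exact ⟨0, one_pos, fun l hl => absurd (show l ∈ (∅ : Set ℝ) from he ▸ hl) (by simp)⟩
    · obtain ⟨θ, hθ, hub⟩ := hL.exists_isGreatest hne
      refine ⟨θ, ?_, fun l hl => hub hl⟩
      by_contra! h1
      exact hcon s (fun i => hFS i (Fintype.mem_piFinset.1 hs i)) θ h1 hθ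
  choose! θ hθ1 hθ using hbound
  obtain ⟨s₁, hs₁, -⟩ := approx (1 / 2) (by norm_num) (by norm_num)
  obtain ⟨s₂, hs₂, hmax⟩ := Finset.exists_max_image (Fintype.piFinset F) θ ⟨s₁, hs₁⟩
  obtain ⟨s, hs, l, hl, hmem⟩ := approx (max (θ s₂) (1 / 2)) (by positivity)
    (max_lt (hθ1 _ hs₂) (by norm_num))
  have h1 := hθ s hs l hmem
  have h2 := hmax s hs
  have h3 := le_max_left (θ s₂) (1 / 2)
  linarith

end Colorful

/-- Tverberg's theorem, in terms of weights. -/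
theorem exists_tverberg_partition {ι κ : Type*} [Fintype ι] [Fintype κ] [Nonempty κ]
    [DecidableEq κ] {d : ℕ} (hcard : Fintype.card ι = (Fintype.card κ - 1) * (d + 1) + 1)
    (x : ι → EuclideanSpace ℝ (Fin d)) :
    ∃ (f : ι → κ) (w : ι → ℝ) (p : EuclideanSpace ℝ (Fin d)), (∀ i, 0 ≤ w i) ∧
      ∀ k, ∑ i with f i = k, w i = 1 ∧ ∑ i with f i = k, w i • x i = p := by
  classical
  obtain ⟨k₀⟩ := ‹Nonempty κ›
  let W : κ → κ → ℝ := fun k l => (if k = l then 1 else 0) - (if k = k₀ then 1 else 0)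
  let y : ι → Option (Fin d) → ℝ := fun i o => o.elim 1 (x i)
  let P : ι → κ → EuclideanSpace ℝ (Option ({k : κ // k ≠ k₀} × Option (Fin d))) := fun i k =>
    WithLp.toLp 2 fun q => q.elim 1 fun lo => W k lo.1 * y i lo.2
  let b : EuclideanSpace ℝ (Option ({k : κ // k ≠ k₀} × Option (Fin d))) :=
    WithLp.toLp 2 fun q => q.elim 1 fun _ => 0
  have hκ : (Fintype.card κ : ℝ) ≠ 0 := by
    exact_mod_cast (Fintype.card_pos_iff.2 ⟨k₀⟩).ne'
  obtain ⟨s, hs, a, ha, hsum⟩ := exists_colorful_conic_combination (ι := ι)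
    (by simp [hcard]) (fun i => Finset.univ.image (P i)) b fun i => by
      have hb : b = ∑ k, (Fintype.card κ : ℝ)⁻¹ • P i k := by
        ext q
        rcases q with _ | ⟨l, o⟩
        · simp [b, P, hκ]
        · simp [b, P, W, ← Finset.mul_sum, ← Finset.sum_mul]
      rw [hb]
      exact (convex_convexHull ℝ _).sum_mem (fun _ _ => by positivity) (by simp [hκ])
        fun k _ => subset_convexHull ℝ _ (by simp)
  simp only [Finset.mem_image, Finset.mem_univ, true_and] at hs
  choose f hf using hs
  have hA : ∑ i, a i = 1 := by
    have := congrArg (fun z => z.ofLp none) hsum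
    simpa [← hf, P, b] using this
  have hclass : ∀ k o, ∑ i with f i = k, a i * y i o = ∑ i with f i = k₀, a i * y i o := by
    intro k o
    by_cases hk : k = k₀
    · rw [hk]
    have := congrArg (fun z => z.ofLp (some (⟨k, hk⟩, o))) hsum
    simp only [← hf, P, b, W, WithLp.ofLp_sum, WithLp.ofLp_smul, Finset.sum_apply, Pi.smul_apply,
      smul_eq_mul, Option.elim_some, sub_mul, mul_sub, Finset.sum_sub_distrib, ite_mul, one_mul,
      zero_mul, mul_ite, mul_zero] at this
    rw [Finset.sum_filter, Finset.sum_filter]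
    exact sub_eq_zero.1 this
  have hone : ∀ k, (Fintype.card κ : ℝ) * ∑ i with f i = k, a i = 1 := by
    have h0 : ∀ k, ∑ i with f i = k, a i = ∑ i with f i = k₀, a i := fun k => by
      simpa [y] using hclass k none
    intro k
    rw [← hA, ← Finset.sum_fiberwise Finset.univ f a]
    simp [h0]
  refine ⟨f, fun i => Fintype.card κ * a i,
    ∑ i with f i = k₀, ((Fintype.card κ : ℝ) * a i) • x i, fun i => by
      have := ha i; positivity, fun k => ⟨by rw [← Finset.mul_sum, hone], ?_⟩⟩
  ext c
  have := hclass k (some c)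
  simp only [y, Option.elim_some] at this
  simp [mul_assoc, ← Finset.mul_sum, this]

section Steinitz

variable {d n' : ℕ} {ε : ℝ}

/-- The colorful quantitative Steinitz theorem for balls. -/
theorem BallApproxProp.exists_colorful_closedBall_subset (hd : 0 < d) (hε : 0 < ε)
    (hprop : BallApproxProp d n' ε)
    (S : Option (Fin (n' - 1) × Fin d) → Set (EuclideanSpace ℝ (Fin d)))
    (hS : ∀ j, Metric.closedBall 0 1 ⊆ convexHull ℝ (S j)) :
    ∃ s : Option (Fin (n' - 1) × Fin d) → EuclideanSpace ℝ (Fin d), (∀ j, s j ∈ S j) ∧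
      Metric.closedBall 0 (1 / (1 + ε)) ⊆ convexHull ℝ (Set.range s) := by
  classical
  obtain ⟨V, hV1, hVcard, hVball⟩ := hprop
  have hε1 : 0 < 1 + ε := by linarith
  have hsupport : ∀ z : EuclideanSpace ℝ (Fin d), ∃ v ∈ V, ‖z‖ ≤ (1 + ε) * inner ℝ z v := by
    intro z
    have hz : ‖z‖⁻¹ • z ∈ Metric.closedBall (0 : EuclideanSpace ℝ (Fin d)) 1 := by
      rw [mem_closedBall_zero_iff, norm_smul, norm_inv, norm_norm]
      exact inv_mul_le_one
    obtain ⟨y, hy, hyz⟩ := hVball hz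
    by_contra! hcon
    have hsub : convexHull ℝ (V : Set (EuclideanSpace ℝ (Fin d))) ⊆
        {v | inner ℝ z v < ‖z‖ / (1 + ε)} :=
      convexHull_min (fun v hv => by
        rw [Set.mem_ofPred_eq, lt_div_iff₀ hε1, mul_comm]
        exact hcon v hv) (convex_halfSpace_lt (innerₛₗ ℝ z).isLinear _)
    have h1 : inner ℝ z y < ‖z‖ / (1 + ε) := hsub hy
    have h2 : (1 + ε) * inner ℝ z y = ‖z‖ := by
      rw [← inner_smul_right]
      simp only at hyz
      rw [hyz, inner_smul_right, real_inner_self_eq_norm_sq]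
      by_cases h : ‖z‖ = 0
      · simp [h]
      · field_simp
    rw [lt_div_iff₀ hε1] at h1
    linarith
  have : Nonempty (Fin d) := ⟨⟨0, hd⟩⟩
  obtain ⟨e, he⟩ := exists_norm_eq (EuclideanSpace ℝ (Fin d)) (zero_le_one (α := ℝ))
  obtain ⟨v₁, hv₁, hv₁e⟩ := hsupport e
  have hv₁0 : v₁ ≠ 0 := by
    rintro rfl
    rw [he, inner_zero_right] at hv₁e
    linarith
  have hv₁n : 0 < ‖v₁‖ := norm_pos_iff.2 hv₁0
  obtain ⟨s₁, hs₁, hs₁n⟩ : ∃ s₁ ∈ S none, 1 ≤ ‖s₁‖ := by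
    obtain ⟨y, hy, hle⟩ := (convexOn_norm convex_univ).exists_ge_of_mem_convexHull
      (Set.subset_univ (S none)) (hS none (show e ∈ _ by simp [he]))
    exact ⟨y, hy, he ▸ hle⟩
  have hs₁0 : 0 < ‖s₁‖ := by linarith
  obtain ⟨ρ, hρ⟩ : ∃ ρ : EuclideanSpace ℝ (Fin d) ≃ₗᵢ[ℝ] EuclideanSpace ℝ (Fin d),
      ρ v₁ = (‖v₁‖ / ‖s₁‖) • s₁ :=
    ⟨_, Submodule.reflection_sub (by
      rw [norm_smul, norm_div, norm_norm, norm_norm, div_mul_cancel₀ _ hs₁0.ne'])⟩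
  obtain ⟨g, hgV, hVg⟩ : ∃ g : Fin (n' - 1) → EuclideanSpace ℝ (Fin d),
      (∀ k, g k ∈ V) ∧ ∀ v ∈ V, v = v₁ ∨ ∃ k, g k = v := by
    obtain ⟨emb⟩ : Nonempty ((V.erase v₁ : Finset _) ↪ Fin (n' - 1)) :=
      Function.Embedding.nonempty_of_card_le (by
        rw [Fintype.card_coe, Finset.card_erase_of_mem hv₁, Fintype.card_fin]
        omega)
    refine ⟨Function.extend emb Subtype.val fun _ => v₁, fun k => ?_, fun v hv => ?_⟩
    · by_cases h : ∃ a, emb a = k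
      · obtain ⟨a, rfl⟩ := h
        rw [emb.injective.extend_apply]
        exact Finset.mem_of_mem_erase a.2
      · rwa [Function.extend_apply' _ _ _ h]
    · rw [or_iff_not_imp_left]
      intro hne
      exact ⟨emb ⟨v, Finset.mem_erase.2 ⟨hne, hv⟩⟩, emb.injective.extend_apply _ _ _⟩
  have hSne : ∀ j, (S j).Nonempty := fun j =>
    convexHull_nonempty_iff.1 ⟨0, hS j (Metric.mem_closedBall_self zero_le_one)⟩
  have hray : ∀ k, ∃ s : Fin d → EuclideanSpace ℝ (Fin d), (∀ i, s i ∈ S (some (k, i))) ∧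
      (g k ≠ 0 → ∃ l : ℝ, 1 ≤ l ∧ l • ρ (g k) ∈ convexHull ℝ (Set.range s)) := by
    intro k
    by_cases hk : g k = 0
    · choose s hs using fun i => hSne (some (k, i))
      exact ⟨s, hs, fun h => absurd hk h⟩
    · obtain ⟨s, hs, hl⟩ := exists_colorful_smul_mem_convexHull (ι := Fin d) (by simp)
        (fun i => S (some (k, i))) (v := ρ (g k)) (by simpa using hk) fun i => hS _ (by
          have := hV1 (hgV k)
          simpa using this)
      exact ⟨s, hs, fun _ => hl⟩
  choose s hs hsl using hray
  let σ : Option (Fin (n' - 1) × Fin d) → EuclideanSpace ℝ (Fin d) :=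
    fun j => j.elim s₁ fun q => s q.1 q.2
  have hσ : ∀ v ∈ V, v ≠ 0 → ∃ l : ℝ, 1 ≤ l ∧ l • ρ v ∈ convexHull ℝ (Set.range σ) := by
    intro v hv hv0
    rcases hVg v hv with rfl | ⟨k, rfl⟩
    · refine ⟨‖s₁‖ / ‖v‖, ?_, ?_⟩
      · rw [one_le_div₀ hv₁n]
        have : ‖v‖ ≤ 1 := by simpa using hV1 hv
        linarith
      · rw [hρ, smul_smul, div_mul_div_cancel₀ hv₁n.ne', div_self hs₁0.ne', one_smul]
        exact subset_convexHull ℝ _ ⟨none, rfl⟩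
    · obtain ⟨l, hl, hmem⟩ := hsl k hv0
      refine ⟨l, hl, convexHull_mono ?_ hmem⟩
      rintro _ ⟨i, rfl⟩
      exact ⟨some (k, i), rfl⟩
  refine ⟨σ, fun j => ?_, fun x hx => ?_⟩
  · rcases j with _ | ⟨k, i⟩
    · exact hs₁
    · exact hs k i
  · by_contra hxK
    obtain ⟨φ, c, hφ, hφx⟩ := geometric_hahn_banach_closed_point (convex_convexHull ℝ _)
      ((Set.finite_range σ).isClosed_convexHull ℝ) hxK
    let z := (InnerProductSpace.toDual ℝ (EuclideanSpace ℝ (Fin d))).symm φ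
    have hz : ∀ y, φ y = inner ℝ z y := fun y => by simp [z]
    obtain ⟨v, hv, hle⟩ := hsupport (ρ.symm z)
    rw [LinearIsometryEquiv.norm_map, ← ρ.inner_map_map, ρ.apply_symm_apply] at hle
    have hxn : ‖x‖ ≤ 1 / (1 + ε) := by simpa using hx
    have h1 : inner ℝ z x ≤ ‖z‖ / (1 + ε) :=
      calc inner ℝ z x ≤ ‖z‖ * ‖x‖ := real_inner_le_norm _ _
        _ ≤ ‖z‖ * (1 / (1 + ε)) := by gcongr
        _ = ‖z‖ / (1 + ε) := by ring
    have h2 : ‖z‖ / (1 + ε) ≤ inner ℝ z (ρ v) := by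
      rw [div_le_iff₀ hε1]
      linarith
    have hz0 : z ≠ 0 := by
      intro hz0
      have hlt := (hφ (σ none) (subset_convexHull ℝ _ ⟨none, rfl⟩)).trans hφx
      rw [hz, hz, hz0, inner_zero_left, inner_zero_left] at hlt
      exact lt_irrefl _ hlt
    have hpos : 0 < ‖z‖ / (1 + ε) := div_pos (norm_pos_iff.2 hz0) hε1
    have hv0 : v ≠ 0 := by
      rintro rfl
      rw [map_zero, inner_zero_right] at h2
      linarith
    obtain ⟨l, hl, hmem⟩ := hσ v hv hv0
    have h3 := (hφ _ hmem).trans hφx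
    rw [hz, hz, inner_smul_right] at h3
    nlinarith

theorem BallApproxProp.exists_colorful_closedBall_subset_of_center (hd : 0 < d) (hε : 0 < ε)
    (hprop : BallApproxProp d n' ε) (p : EuclideanSpace ℝ (Fin d))
    (S : Option (Fin (n' - 1) × Fin d) → Set (EuclideanSpace ℝ (Fin d)))
    (hS : ∀ j, Metric.closedBall p 1 ⊆ convexHull ℝ (S j)) :
    ∃ s : Option (Fin (n' - 1) × Fin d) → EuclideanSpace ℝ (Fin d), (∀ j, s j ∈ S j) ∧
      Metric.closedBall p (1 / (1 + ε)) ⊆ convexHull ℝ (Set.range s) := by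
  obtain ⟨s, hs, hball⟩ := hprop.exists_colorful_closedBall_subset hd hε (fun j => -p +ᵥ S j)
    fun j x hx => by
      rw [convexHull_vadd, Set.mem_vadd_set_iff_neg_vadd_mem, neg_neg]
      exact hS j (by simpa using hx)
  refine ⟨fun j => p + s j, fun j => ?_, fun x hx => ?_⟩
  · have := hs j
    rwa [Set.mem_vadd_set_iff_neg_vadd_mem, neg_neg] at this
  · have h : -p +ᵥ x ∈ convexHull ℝ (Set.range s) := hball (by
      simpa [vadd_eq_add, neg_add_eq_sub, dist_eq_norm] using hx)
    have hrange : Set.range (fun j => p + s j) = p +ᵥ Set.range s := by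
      rw [← Set.image_vadd, ← Set.range_comp]
      rfl
    rwa [hrange, convexHull_vadd, Set.mem_vadd_set_iff_neg_vadd_mem]

end Steinitz

lemma closedBall_subset_convexHull_sum_smul {E ι : Type*} [NormedAddCommGroup E]
    [NormedSpace ℝ E] {I : Finset ι} {w : ι → ℝ} {r : ℝ} (hw1 : ∑ i ∈ I, w i = 1)
    {c : ι → E} {T : ι → Set E}
    (hT : ∀ i ∈ I, Metric.closedBall (c i) r ⊆ convexHull ℝ (T i)) :
    Metric.closedBall (∑ i ∈ I, w i • c i) r ⊆ convexHull ℝ (∑ i ∈ I, w i • T i) := by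
  intro x hx
  set p := ∑ i ∈ I, w i • c i with hp
  have hx' : x = ∑ i ∈ I, w i • (c i + (x - p)) := by
    simp only [smul_add, Finset.sum_add_distrib, ← Finset.sum_smul, hw1, one_smul]
    rw [← hp, add_sub_cancel]
  rw [convexHull_sum, hx']
  refine Set.finsetSum_mem_finsetSum _ _ _ fun i hi => ?_
  rw [convexHull_smul]
  refine Set.smul_mem_smul_set (hT i hi ?_)
  simpa [dist_eq_norm] using hx

/-- Continuous quantitative Tverberg theorem with near-optimal radius (second part of
Theorem 4.1): with `n = (m·[(n' − 1)d + 1] − 1)(d + 1) + 1` sets `T_i ⊆ ℝ^d` whose convex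
hulls each contain a unit ball, one can choose `t_i ∈ T_i` and partition the chosen points
into `m` parts whose convex hulls have a common ball of radius `1/(1 + ε)`. -/
theorem continuous_quantitative_tverberg_near_optimal
    (d m n' : ℕ) (hd : 0 < d) (hm : 0 < m) (hn' : 0 < n')
    (ε : ℝ) (hε : 0 < ε) (hprop : BallApproxProp d n' ε)
    (T : Fin ((m * ((n' - 1) * d + 1) - 1) * (d + 1) + 1) → Set (EuclideanSpace ℝ (Fin d)))
    (hT : ∀ i, ∃ c : EuclideanSpace ℝ (Fin d),
      Metric.closedBall c 1 ⊆ convexHull ℝ (T i)) :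
    ∃ t : Fin ((m * ((n' - 1) * d + 1) - 1) * (d + 1) + 1) → EuclideanSpace ℝ (Fin d),
      (∀ i, t i ∈ T i) ∧
      ∃ A : Fin m → Set (Fin ((m * ((n' - 1) * d + 1) - 1) * (d + 1) + 1)),
        (∀ j, ∃! k, j ∈ A k) ∧
        ∃ p : EuclideanSpace ℝ (Fin d),
          Metric.closedBall p (1 / (1 + ε)) ⊆ ⋂ k, convexHull ℝ (t '' A k) := by
  classical
  have : Nonempty (Fin m) := ⟨⟨0, hm⟩⟩
  choose c hc using hT
  obtain ⟨f, w, p, hw0, hw⟩ := exists_tverberg_partition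
    (κ := Fin m × Option (Fin (n' - 1) × Fin d)) (by simp) c
  have hgroup := fun k : Fin m => hprop.exists_colorful_closedBall_subset_of_center hd hε p
    (fun j => ∑ i with f i = (k, j), w i • T i) fun j => by
      rw [← (hw (k, j)).2]
      exact closedBall_subset_convexHull_sum_smul (hw (k, j)).1 fun i _ => hc i
  choose s hs hball using hgroup
  have hpts : ∀ q : Fin m × Option (Fin (n' - 1) × Fin d),
      ∃ t : Fin ((m * ((n' - 1) * d + 1) - 1) * (d + 1) + 1) → EuclideanSpace ℝ (Fin d),
        (∀ i, f i = q → t i ∈ T i) ∧ ∑ i with f i = q, w i • t i = s q.1 q.2 := by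
    intro q
    obtain ⟨g, hg, hsum⟩ := (Set.mem_finsetSum _ _ _).1 (hs q.1 q.2)
    have hex : ∀ i, ∃ y, f i = q → y ∈ T i ∧ w i • y = g i := fun i => by
      by_cases hi : f i = q
      · obtain ⟨y, hy, hyg⟩ := hg (i := i) (by simpa using hi)
        exact ⟨y, fun _ => ⟨hy, hyg⟩⟩
      · exact ⟨0, fun h => absurd h hi⟩
    choose t ht using hex
    refine ⟨t, fun i hi => (ht i hi).1, ?_⟩
    rw [← hsum]
    exact Finset.sum_congr rfl fun i hi => (ht i (Finset.mem_filter.1 hi).2).2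
  choose t ht hts using hpts
  refine ⟨fun i => t (f i) i, fun i => ht _ i rfl, fun k => {i | (f i).1 = k},
    fun i => ⟨(f i).1, rfl, fun _ h => h.symm⟩, p, Set.subset_iInter fun k => ?_⟩
  refine (hball k).trans (convexHull_min ?_ (convex_convexHull ℝ _))
  rintro _ ⟨j, rfl⟩
  rw [← hts (k, j)]
  refine (convex_convexHull ℝ _).sum_mem (fun i _ => hw0 i) (hw (k, j)).1 fun i hi => ?_
  have hfi : f i = (k, j) := (Finset.mem_filter.1 hi).2
  exact subset_convexHull ℝ _ ⟨i, by simp [hfi], by simp only [hfi]⟩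
end

section
/- Let m and d be positive integers and set n = ⌈2md + 1⌉_p − 1, where ⌈q⌉_p denotes the smallest prime number greater than or equal to q. For i = 1, …, d+1 and j = 1, …, n, let T_{i,j} ⊆ ℝ^d be sets such that each conv(T_{i,j}) contains a Euclidean ball of radius 1 (the sets T_{i,1}, …, T_{i,n} form the i-th color class). Then there exist points t_{i,j} ∈ T_{i,j} for all i, j, and pairwise disjoint sets A_1, …, A_m, each a subset of {t_{i,j} : 1 ≤ i ≤ d+1, 1 ≤ j ≤ n}, such that for every k and every color i the set A_k contains at most 2d of the points t_{i,1}, …, t_{i,n}, and such that there exists p ∈ ℝ^d with B_r(p) ⊆ ⋂_{k=1}^m conv(A_k) for r = (π/e²)·d^{−2d−2}. -/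
/-- The smallest prime number greater than or equal to `q`. -/
noncomputable def nextPrime (q : ℕ) : ℕ := sInf {p : ℕ | p.Prime ∧ q ≤ p}

section ColorfulCaratheodory

variable {E : Type*} [NormedAddCommGroup E] [InnerProductSpace ℝ E]

/-- The cone generated by a finite linearly independent family is closed. -/
theorem isClosed_nonneg_combinations [FiniteDimensional ℝ E] {ι : Type*} (s : ι → E)
    (J : Finset ι) (hs : LinearIndepOn ℝ s (J : Set ι)) :
    IsClosed {y : E | ∃ μ : ι → ℝ, (∀ i, 0 ≤ μ i) ∧ ∑ i ∈ J, μ i • s i = y} := by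
  classical
  let f : (J → ℝ) →ₗ[ℝ] E := Fintype.linearCombination ℝ (fun i : J => s i)
  have hf : Function.Injective f := LinearIndependent.fintypeLinearCombination_injective hs
  have hcl : IsClosed {ν : J → ℝ | ∀ i, 0 ≤ ν i} := by
    simp only [Set.ofPred_forall]
    exact isClosed_iInter fun i => isClosed_le continuous_const (continuous_apply i)
  convert (LinearMap.isClosedEmbedding_of_injective
    (LinearMap.ker_eq_bot.2 hf)).isClosedMap _ hcl using 1
  ext y
  constructor
  · rintro ⟨μ, hμ, rfl⟩
    refine ⟨fun i => μ i, fun i => hμ i, ?_⟩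
    simp only [f, Fintype.linearCombination_apply]
    exact Finset.sum_coe_sort J (fun i => μ i • s i)
  · rintro ⟨ν, hν, rfl⟩
    refine ⟨fun i => if h : i ∈ J then ν ⟨i, h⟩ else 0, fun i => ?_, ?_⟩
    · dsimp only
      split_ifs
      exacts [hν _, le_rfl]
    · simp only [f, Fintype.linearCombination_apply]
      rw [← Finset.sum_coe_sort J]
      exact Finset.sum_congr rfl fun i _ => by simp

theorem inner_nonpos_of_norm_le_norm_sub {u w : E}
    (h : ∀ ε : ℝ, 0 < ε → ε ≤ 1 → ‖u‖ ≤ ‖u - ε • w‖) : inner ℝ u w ≤ 0 := by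
  by_contra! hpos
  set c : ℝ := inner ℝ u w
  have hw : 0 ≤ ‖w‖ ^ 2 := sq_nonneg _
  set ε : ℝ := min 1 (c / (‖w‖ ^ 2 + 1))
  have hε : 0 < ε := lt_min one_pos (by positivity)
  have hεc : ε * (‖w‖ ^ 2 + 1) ≤ c := by
    rw [← le_div_iff₀ (by positivity)]
    exact min_le_right _ _
  have h1 := h ε hε (min_le_left _ _)
  have h2 : ‖u‖ ^ 2 ≤ ‖u - ε • w‖ ^ 2 := by gcongr
  rw [norm_sub_sq_real, inner_smul_right, norm_smul, mul_pow, Real.norm_eq_abs, sq_abs] at h2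
  change ‖u‖ ^ 2 ≤ ‖u‖ ^ 2 - 2 * (ε * c) + ε ^ 2 * ‖w‖ ^ 2 at h2
  nlinarith

/-- The colorful Carathéodory theorem for cones, with membership of `x` in the cones over the color
classes expressed by duality. -/
theorem exists_colorful_nonneg_combination [FiniteDimensional ℝ E] {ι : Type*} [Fintype ι]
    (hι : Module.finrank ℝ E ≤ Fintype.card ι) {κ : ι → Type*} [∀ i, Finite (κ i)]
    [∀ i, Nonempty (κ i)] (a : ∀ i, κ i → E) (x : E)
    (h : ∀ u, 0 < inner ℝ u x → ∀ i, ∃ c, 0 < inner ℝ u (a i c)) :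
    ∃ g : ∀ i, κ i, ∃ μ : ι → ℝ, (∀ i, 0 ≤ μ i) ∧ ∑ i, μ i • a i (g i) = x := by
  classical
  let C : (∀ i, κ i) → Finset ι → Set E := fun g J =>
    {y | ∃ μ : ι → ℝ, (∀ i, 0 ≤ μ i) ∧ ∑ i ∈ J, μ i • a i (g i) = y}
  let P := {P : (∀ i, κ i) × Finset ι // LinearIndepOn ℝ (fun i => a i (P.1 i)) (P.2 : Set ι)}
  have : Nonempty P := ⟨⟨(fun i => Classical.arbitrary _, ∅), by simp⟩⟩
  obtain ⟨⟨⟨g, J⟩, hli⟩, hmin⟩ :=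
    Finite.exists_min (fun p : P => Metric.infDist x (C p.1.1 p.1.2))
  dsimp only at hli hmin
  obtain ⟨z, ⟨μ, hμ, hz⟩, hdist⟩ := (isClosed_nonneg_combinations _ J hli).exists_infDist_eq_dist
    ⟨0, 0, fun _ => le_rfl, by simp⟩ x
  have hle : ∀ g' (J' : Finset ι), LinearIndepOn ℝ (fun i => a i (g' i)) (J' : Set ι) → ∀ y ∈ C g' J',
      ‖x - z‖ ≤ ‖x - y‖ := fun g' J' hli' y hy => by
    rw [← dist_eq_norm, ← dist_eq_norm, ← hdist]
    exact (hmin ⟨(g', J'), hli'⟩).trans (Metric.infDist_le_dist_of_mem hy)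
  by_cases hxz : x = z
  · refine ⟨g, fun i => if i ∈ J then μ i else 0, fun i => ?_, ?_⟩
    · dsimp only
      split_ifs
      exacts [hμ i, le_rfl]
    · rw [hxz, ← hz]
      simp [ite_smul]
  exfalso
  set u := x - z with hu
  have hu0 : u ≠ 0 := sub_ne_zero.2 hxz
  have hdir : ∀ g' (J' : Finset ι), LinearIndepOn ℝ (fun i => a i (g' i)) (J' : Set ι) → ∀ w,
      (∀ ε : ℝ, 0 < ε → ε ≤ 1 → z + ε • w ∈ C g' J') → inner ℝ u w ≤ 0 :=
    fun g' J' hli' w hw => inner_nonpos_of_norm_le_norm_sub fun ε h0 h1 => by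
      have := hle g' J' hli' _ (hw ε h0 h1)
      rwa [← sub_sub, ← hu] at this
  have hJ : ∀ i ∈ J, inner ℝ u (a i (g i)) ≤ 0 := fun i hi =>
    hdir g J hli _ fun ε h0 _ => ⟨fun j => μ j + if j = i then ε else 0, fun j => by
      have := hμ j
      dsimp only
      split_ifs <;> linarith, by
      simp [add_smul, Finset.sum_add_distrib, ite_smul, hi, hz]⟩
  have hz0 : 0 ≤ inner ℝ u z := by
    have := hdir g J hli (-z) fun ε h0 h1 => ⟨fun j => (1 - ε) * μ j,
      fun j => mul_nonneg (by linarith) (hμ j), by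
        simp only [mul_smul, ← Finset.smul_sum, hz]
        module⟩
    rw [inner_neg_right] at this
    linarith
  have hux : 0 < inner ℝ u x := by
    have : x = u + z := by simp [hu]
    rw [this, inner_add_right, real_inner_self_eq_norm_sq]
    have := norm_pos_iff.2 hu0
    positivity
  have hzero : ∀ i ∈ J, μ i * inner ℝ u (a i (g i)) = 0 := by
    rw [← hz, inner_sum] at hz0
    simp only [inner_smul_right] at hz0
    have hnp : ∀ i ∈ J, μ i * inner ℝ u (a i (g i)) ≤ 0 := fun i hi =>
      mul_nonpos_of_nonneg_of_nonpos (hμ i) (hJ i hi)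
    exact (Finset.sum_eq_zero_iff_of_nonpos hnp).1 (le_antisymm (Finset.sum_nonpos hnp) hz0)
  set J' := J.filter (fun i => μ i ≠ 0) with hJ'
  have horth : ∀ i ∈ J', inner ℝ u (a i (g i)) = 0 := fun i hi => by
    rw [hJ', Finset.mem_filter] at hi
    exact (mul_eq_zero.1 (hzero i hi.1)).resolve_left hi.2
  have hli' : LinearIndepOn ℝ (fun i => a i (g i)) (J' : Set ι) :=
    hli.mono (by rw [hJ']; exact_mod_cast Finset.filter_subset _ J)
  have hspan : Submodule.span ℝ ((fun i => a i (g i)) '' (J' : Set ι)) ≤ (ℝ ∙ u)ᗮ := by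
    rw [Submodule.span_le]
    rintro _ ⟨i, hi, rfl⟩
    exact Submodule.mem_orthogonal_singleton_iff_inner_right.2 (horth i hi)
  obtain ⟨i, hi⟩ : ∃ i, i ∉ J' := by
    by_contra! hall
    have hJu : J' = Finset.univ := Finset.eq_univ_of_forall hall
    have hli2 : LinearIndependent ℝ (fun i => a i (g i)) := by
      rw [hJu, Finset.coe_univ, linearIndepOn_univ_iff] at hli'
      exact hli'
    have htop := hli2.span_eq_top_of_card_eq_finrank'
      (le_antisymm hli2.fintype_card_le_finrank hι)
    rw [hJu, Finset.coe_univ, Set.image_univ, htop] at hspan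
    have := Submodule.mem_orthogonal_singleton_iff_inner_right.1 (hspan (Submodule.mem_top (x := u)))
    exact hu0 (inner_self_eq_zero.1 this)
  obtain ⟨c, hc⟩ := h u hux i
  have hcongr : ∀ j ∈ J', a j (Function.update g i c j) = a j (g j) := fun j hj => by
    rw [Function.update_of_ne]
    rintro rfl
    exact hi hj
  have hli3 : LinearIndepOn ℝ (fun j => a j (Function.update g i c j))
      ((insert i J' : Finset ι) : Set ι) := by
    rw [Finset.coe_insert, linearIndepOn_insert (by simpa using hi)]
    have heq : Set.EqOn (fun j => a j (Function.update g i c j)) (fun j => a j (g j)) J' :=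
      fun j hj => hcongr j hj
    refine ⟨hli'.congr heq.symm, fun hmem => ?_⟩
    rw [heq.image_eq] at hmem
    have := Submodule.mem_orthogonal_singleton_iff_inner_right.1 (hspan hmem)
    simp only [Function.update_self] at this
    exact hc.ne' this
  refine hc.not_ge (hdir _ _ hli3 _ fun ε h0 _ => ⟨fun j => if j = i then ε else μ j, fun j => ?_, ?_⟩)
  · dsimp only
    split_ifs
    exacts [h0.le, hμ j]
  · rw [Finset.sum_insert hi, ← hz, add_comm]
    simp only [Function.update_self, if_true]
    congr 1
    rw [hJ', Finset.sum_filter]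
    refine Finset.sum_congr rfl fun j hj => ?_
    by_cases hj0 : μ j = 0
    · simp [hj0]
    · have hjJ : j ∈ J' := by simp [hJ', hj, hj0]
      have hne : j ≠ i := fun e => hi (e ▸ hjJ)
      simp [hj0, hne]

/-- Colorful Carathéodory for cones with control of the sum of the coefficients. -/
theorem exists_colorful_nonneg_combination_sum_le [FiniteDimensional ℝ E] {ι : Type*} [Fintype ι]
    (hι : Module.finrank ℝ E ≤ Fintype.card ι) {κ : ι → Type*} [∀ i, Finite (κ i)]
    [∀ i, Nonempty (κ i)] (a : ∀ i, κ i → E) (x : E) {b c : ℝ} (hb : 0 < b) (hbc : b < c)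
    (h : ∀ u, 0 < inner ℝ u x → ∀ i, ∃ k, inner ℝ u x ≤ b * inner ℝ u (a i k)) :
    ∃ g : ∀ i, κ i, ∃ μ : ι → ℝ, (∀ i, 0 ≤ μ i) ∧ ∑ i, μ i ≤ c ∧ ∑ i, μ i • a i (g i) = x := by
  have hc : 0 < c := hb.trans hbc
  obtain ⟨g, ν, hν, hsum⟩ := exists_colorful_nonneg_combination hι
    (fun i k => a i k - c⁻¹ • x) (c⁻¹ • x) fun u hu i => by
      rw [inner_smul_right] at hu
      have hux : 0 < inner ℝ u x := pos_of_mul_pos_right hu (inv_nonneg.2 hc.le)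
      obtain ⟨k, hk⟩ := h u hux i
      refine ⟨k, ?_⟩
      rw [inner_sub_right, inner_smul_right, sub_pos, inv_mul_lt_iff₀ hc]
      have : 0 < inner ℝ u (a i k) := by
        by_contra! hneg
        nlinarith
      nlinarith
  set N := ∑ i, ν i with hN
  have hN0 : 0 ≤ N := Finset.sum_nonneg fun i _ => hν i
  have hN1 : (1 + N) ≠ 0 := by positivity
  simp only [smul_sub, Finset.sum_sub_distrib, ← Finset.sum_smul, ← hN] at hsum
  have hsum' : ∑ i, ν i • a i (g i) = ((1 + N) * c⁻¹) • x := by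
    rw [sub_eq_iff_eq_add] at hsum
    rw [hsum, mul_smul, add_smul, one_smul]
  refine ⟨g, fun i => c * (1 + N)⁻¹ * ν i, fun i => ?_, ?_, ?_⟩
  · have := hν i
    positivity
  · rw [← Finset.mul_sum, ← hN, mul_assoc]
    refine mul_le_of_le_one_right hc.le ?_
    rw [inv_mul_le_iff₀ (by positivity)]
    linarith
  · have hassoc : ∀ i, (c * (1 + N)⁻¹ * ν i) • a i (g i) = (c * (1 + N)⁻¹) • ν i • a i (g i) :=
      fun i => mul_smul _ _ _
    simp only [hassoc]
    rw [← Finset.smul_sum, hsum', smul_smul,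
      show c * (1 + N)⁻¹ * ((1 + N) * c⁻¹) = 1 by field_simp, one_smul]

end ColorfulCaratheodory

section Tverberg

theorem tverberg_option {d : ℕ} {Q R : Type*} [Fintype Q] [Fintype R] [DecidableEq R]
    (hQ : Fintype.card R * (d + 1) + 1 ≤ Fintype.card Q) (c : Q → EuclideanSpace ℝ (Fin d)) :
    ∃ (part : Q → Option R) (μ : Q → ℝ) (p : EuclideanSpace ℝ (Fin d)), (∀ q, 0 ≤ μ q) ∧
      ∀ k, ∑ q with part q = k, μ q = 1 ∧ ∑ q with part q = k, μ q • c q = p := by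
  classical
  let b : Q → Option (Fin d) → ℝ := fun q j => j.elim 1 (c q)
  let v : Option R → R → ℝ := fun k l => (if k = some l then 1 else 0) - (if k = none then 1 else 0)
  let a : Q → Option R → EuclideanSpace ℝ (Option (R × Option (Fin d))) := fun q k =>
    WithLp.toLp 2 fun o => o.elim 1 (fun t => v k t.1 * b q t.2)
  let x : EuclideanSpace ℝ (Option (R × Option (Fin d))) :=
    WithLp.toLp 2 fun o => o.elim 1 (fun _ => 0)
  have hv : ∀ l, ∑ k, v k l = 0 := fun l => by
    simp [v, Finset.sum_sub_distrib]
  have hsum : ∀ q, ∑ k, a q k = (Fintype.card (Option R) : ℝ) • x := fun q => by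
    ext o
    rcases o with _ | ⟨l, j⟩
    · simp [a, x, add_comm]
    · simp only [a, x, WithLp.ofLp_sum, Finset.sum_apply, Option.elim_some, PiLp.smul_apply,
        smul_zero]
      rw [← Finset.sum_mul, hv, zero_mul]
  obtain ⟨part, μ, hμ, hx⟩ := exists_colorful_nonneg_combination (ι := Q)
    (κ := fun _ => Option R) (by simpa using hQ) a x fun u hu q => by
      by_contra! hle
      have h1 : ∑ k, inner ℝ u (a q k) ≤ 0 := Finset.sum_nonpos fun k _ => hle k
      rw [← inner_sum, hsum, inner_smul_right] at h1
      have : 0 < (Fintype.card (Option R) : ℝ) * inner ℝ u x := by positivity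
      linarith
  let M : Option R → Option (Fin d) → ℝ := fun k j => ∑ q with part q = k, μ q * b q j
  have hM : ∀ k j, M k j = M none j := fun k j => by
    rcases k with _ | l
    · rfl
    have h1 := congrArg (fun y : EuclideanSpace ℝ (Option (R × Option (Fin d))) => y (some (l, j))) hx
    simp only [a, x, v, WithLp.ofLp_sum, Finset.sum_apply, Option.elim_some, PiLp.smul_apply,
      smul_eq_mul] at h1
    rw [← sub_eq_zero, ← h1]
    simp only [M, Finset.sum_filter, ← Finset.sum_sub_distrib]
    refine Finset.sum_congr rfl fun q _ => ?_
    split_ifs <;> ring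
  set W := M none none with hW
  have hWR : (Fintype.card (Option R) : ℝ) * W = 1 := by
    have h1 := congrArg (fun y : EuclideanSpace ℝ (Option (R × Option (Fin d))) => y none) hx
    simp only [a, x, WithLp.ofLp_sum, Finset.sum_apply, Option.elim_none, PiLp.smul_apply,
      smul_eq_mul, mul_one] at h1
    have h2 : ∑ k, M k none = ∑ q, μ q := by
      simp only [M, b, Option.elim_none, mul_one]
      exact Finset.sum_fiberwise _ _ _
    rw [← h1, ← h2, Finset.sum_congr rfl fun k _ => hM k none]
    simp [hW]
  have hW0 : W ≠ 0 := fun h => by simp [h] at hWR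
  have hWpos : 0 < W := pos_of_mul_pos_right (hWR ▸ one_pos) (Nat.cast_nonneg _)
  refine ⟨part, fun q => W⁻¹ * μ q, WithLp.toLp 2 fun j => W⁻¹ * M none (some j),
    fun q => mul_nonneg (inv_nonneg.2 hWpos.le) (hμ q), fun k => ⟨?_, ?_⟩⟩
  · rw [← Finset.mul_sum]
    have : ∑ q with part q = k, μ q = W := by
      rw [hW, ← hM k none]
      simp [M, b]
    rw [this, inv_mul_cancel₀ hW0]
  · ext j
    simp only [← hM k (some j), M, b, Option.elim_some, WithLp.ofLp_sum, Finset.sum_apply,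
      PiLp.smul_apply, smul_eq_mul, Finset.mul_sum, mul_assoc]

/-- Tverberg's theorem, with the convex combinations made explicit. -/
theorem tverberg {d : ℕ} {Q R : Type*} [Fintype Q] [Fintype R] [Nonempty R] [DecidableEq R]
    (hQ : Fintype.card R * (d + 1) ≤ Fintype.card Q + d) (c : Q → EuclideanSpace ℝ (Fin d)) :
    ∃ (part : Q → R) (μ : Q → ℝ) (p : EuclideanSpace ℝ (Fin d)), (∀ q, 0 ≤ μ q) ∧
      ∀ k, ∑ q with part q = k, μ q = 1 ∧ ∑ q with part q = k, μ q • c q = p := by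
  obtain ⟨r, hr⟩ := Nat.exists_eq_succ_of_ne_zero (Fintype.card_ne_zero (α := R))
  have e : Option (Fin r) ≃ R := Fintype.equivOfCardEq (by simp [hr])
  obtain ⟨part, μ, p, hμ, h⟩ := tverberg_option (R := Fin r) (by
    rw [hr, Nat.succ_mul] at hQ
    rw [Fintype.card_fin]
    omega) c
  refine ⟨fun q => e (part q), μ, p, hμ, fun k => ?_⟩
  simpa only [← Equiv.eq_symm_apply] using h (e.symm k)

end Tverberg

section Slabs

open MeasureTheory

theorem volume_box_inter_slab_le {ι : Type*} [Fintype ι] [DecidableEq ι] (u : ι → ℝ) (i : ι)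
    (hi : u i ≠ 0) (h r : ℝ) :
    volume {v : ι → ℝ | (∀ j, v j ∈ Set.Icc 0 h) ∧ |∑ j, u j * v j| ≤ r} ≤
      ENNReal.ofReal (2 * r / |u i|) * ENNReal.ofReal h ^ (Fintype.card ι - 1) := by
  let A : Matrix ι ι ℝ := (1 : Matrix ι ι ℝ).updateRow i u
  have hdet : A.det = u i := by
    rw [← Matrix.cramer_transpose_apply]
    simp
  have hA : LinearMap.det (Matrix.toLin' A) ≠ 0 := by
    rwa [LinearMap.det_toLin', hdet]
  have hsub : {v : ι → ℝ | (∀ j, v j ∈ Set.Icc 0 h) ∧ |∑ j, u j * v j| ≤ r} ⊆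
      Matrix.toLin' A ⁻¹' Set.pi Set.univ
        (Function.update (fun _ => Set.Icc 0 h) i (Set.Icc (-r) r)) := by
    rintro v ⟨hv, hr⟩ j -
    rw [Matrix.toLin'_apply]
    by_cases hj : j = i
    · subst hj
      simpa [A, Matrix.mulVec, dotProduct, ← abs_le] using hr
    · simpa [A, Matrix.mulVec, dotProduct, hj, Matrix.one_apply] using hv j
  refine (measure_mono hsub).trans ?_
  rw [Measure.addHaar_preimage_linearMap _ hA, LinearMap.det_toLin', hdet, volume_pi_pi,
    ← Finset.mul_prod_erase _ _ (Finset.mem_univ i), Function.update_self,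
    Finset.prod_congr rfl fun j hj => by rw [Function.update_of_ne (Finset.ne_of_mem_erase hj)],
    Finset.prod_const, Finset.card_erase_of_mem (Finset.mem_univ i), Finset.card_univ,
    Real.volume_Icc, Real.volume_Icc, sub_zero, ← mul_assoc, ← ENNReal.ofReal_mul (abs_nonneg _),
    abs_inv]
  refine le_of_eq ?_
  congr 2
  ring

theorem exists_abs_apply_ge {d : ℕ} (u : EuclideanSpace ℝ (Fin d)) (hu : ‖u‖ = 1) :
    ∃ i, 1 / √d ≤ |u i| := by
  by_contra! hlt
  have hd : 0 < d := by
    rcases Nat.eq_zero_or_pos d with rfl | h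
    · simp [Subsingleton.elim u 0] at hu
    · exact h
  have : Nonempty (Fin d) := ⟨⟨0, hd⟩⟩
  have hd' : (0 : ℝ) < d := Nat.cast_pos.2 hd
  have h1 : ∑ i, ‖u i‖ ^ 2 = 1 := by rw [← EuclideanSpace.norm_sq_eq, hu, one_pow]
  have h2 : ∑ i, ‖u i‖ ^ 2 < ∑ _i : Fin d, (1 / √d) ^ 2 :=
    Finset.sum_lt_sum_of_nonempty Finset.univ_nonempty fun i _ =>
      pow_lt_pow_left₀ (hlt i) (abs_nonneg _) two_ne_zero
  rw [h1, div_pow, Real.sq_sqrt hd'.le] at h2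
  simp [hd'.ne'] at h2

/-- Few hyperplanes through the origin leave a point of a cube far from all of them. -/
theorem exists_mem_cube_far_from_hyperplanes {d : ℕ} (hd : 0 < d) {I : Type*} [Fintype I]
    (u : I → EuclideanSpace ℝ (Fin d)) (hu : ∀ i, ‖u i‖ = 1) {h r : ℝ} (hh : 0 < h) (hr : 0 < r)
    (hI : Fintype.card I * (2 * r * √d) < h) :
    ∃ v : EuclideanSpace ℝ (Fin d), (∀ j, v j ∈ Set.Icc 0 h) ∧ ∀ i, r < |inner ℝ (u i) v| := by
  have hd' : (0 : ℝ) < d := Nat.cast_pos.2 hd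
  let Q : Set (Fin d → ℝ) := Set.pi Set.univ fun _ => Set.Icc 0 h
  let B : I → Set (Fin d → ℝ) := fun i =>
    {v | (∀ j, v j ∈ Set.Icc 0 h) ∧ |∑ j, u i j * v j| ≤ r}
  have hB : ∀ i, volume (B i) ≤ ENNReal.ofReal (2 * r * √d) * ENNReal.ofReal h ^ (d - 1) :=
    fun i => by
      obtain ⟨j, hj⟩ := exists_abs_apply_ge (u i) (hu i)
      have hs : 0 < 1 / √(d : ℝ) := by positivity
      have hj0 : u i j ≠ 0 := abs_pos.1 (hs.trans_le hj)
      refine (volume_box_inter_slab_le (fun j => u i j) j hj0 h r).trans ?_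
      rw [Fintype.card_fin]
      gcongr
      calc 2 * r / |u i j| ≤ 2 * r / (1 / √d) := by gcongr
        _ = 2 * r * √d := by rw [div_div_eq_mul_div, div_one]
  have hQ : volume Q = ENNReal.ofReal h * ENNReal.ofReal h ^ (d - 1) := by
    rw [volume_pi_pi, ← pow_succ', Nat.sub_add_cancel hd]
    simp
  have hlt : volume (⋃ i, B i) < volume Q := by
    calc volume (⋃ i, B i) ≤ ∑ i, volume (B i) := measure_iUnion_fintype_le _ _
      _ ≤ ∑ _i : I, ENNReal.ofReal (2 * r * √d) * ENNReal.ofReal h ^ (d - 1) :=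
        Finset.sum_le_sum fun i _ => hB i
      _ = ENNReal.ofReal (Fintype.card I * (2 * r * √d)) * ENNReal.ofReal h ^ (d - 1) := by
        rw [Finset.sum_const, nsmul_eq_mul, Finset.card_univ, ENNReal.ofReal_mul (Nat.cast_nonneg _),
          ENNReal.ofReal_natCast, mul_assoc (Fintype.card I : ENNReal)]
      _ < volume Q := by
        rw [hQ]
        refine ENNReal.mul_lt_mul_left (pow_ne_zero _ ?_) (ENNReal.pow_ne_top ENNReal.ofReal_ne_top)
          ((ENNReal.ofReal_lt_ofReal_iff hh).2 hI)
        simpa using hh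
  obtain ⟨v, hvQ, hvB⟩ := Set.not_subset.1 fun hsub => (measure_mono hsub).not_gt hlt
  refine ⟨WithLp.toLp 2 v, fun j => hvQ j trivial, fun i => ?_⟩
  by_contra! hle
  refine hvB (Set.mem_iUnion.2 ⟨i, fun j => hvQ j trivial, ?_⟩)
  simpa [PiLp.inner_apply, mul_comm] using hle

theorem exists_unit_orthogonal {E : Type*} [NormedAddCommGroup E] [InnerProductSpace ℝ E]
    [FiniteDimensional ℝ E] {J : Type*} [Fintype J] (hJ : Fintype.card J < Module.finrank ℝ E)
    (w : J → E) : ∃ u : E, ‖u‖ = 1 ∧ ∀ j, inner ℝ u (w j) = 0 := by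
  have h1 : (Submodule.span ℝ (Set.range w))ᗮ ≠ ⊥ := fun hbot => by
    have h2 := (Submodule.span ℝ (Set.range w)).finrank_add_finrank_orthogonal
    rw [hbot, finrank_bot, add_zero] at h2
    have h3 : Module.finrank ℝ (Submodule.span ℝ (Set.range w)) ≤ Fintype.card J :=
      finrank_range_le_card w
    omega
  obtain ⟨y, hy, hy0⟩ := Submodule.exists_mem_ne_zero_of_ne_bot h1
  refine ⟨(‖y‖⁻¹ : ℝ) • y, ?_, fun j => ?_⟩
  · rw [norm_smul, norm_inv, norm_norm, inv_mul_cancel₀ (norm_ne_zero_iff.2 hy0)]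
  · rw [real_inner_smul_left, Submodule.inner_left_of_mem_orthogonal
      (Submodule.subset_span (Set.mem_range_self j)) hy, mul_zero]

end Slabs

section Steinitz

theorem mem_convexHull_range_of_sum_le_one {E ι : Type*} [AddCommGroup E] [Module ℝ E] [Fintype ι]
    (p : ι → E) {w z : ι → ℝ} (hw : ∀ i, 0 ≤ w i) (hw1 : ∑ i, w i ≤ 1) (hz : ∀ i, 0 ≤ z i)
    (hzpos : 0 < ∑ i, z i) (hz0 : ∑ i, z i • p i = 0) :
    ∑ i, w i • p i ∈ convexHull ℝ (Set.range p) := by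
  set c := (1 - ∑ i, w i) / ∑ i, z i with hc
  have hc0 : 0 ≤ c := div_nonneg (by linarith) hzpos.le
  have heq : ∑ i, w i • p i = ∑ i, (w i + c * z i) • p i := by
    simp only [add_smul, mul_smul, Finset.sum_add_distrib]
    rw [← Finset.smul_sum, hz0, smul_zero, add_zero]
  rw [heq]
  refine (convex_convexHull ℝ _).sum_mem (fun i _ => ?_) ?_
    fun i _ => subset_convexHull ℝ _ (Set.mem_range_self i)
  · have := hw i
    have := hz i
    positivity
  · rw [Finset.sum_add_distrib, ← Finset.mul_sum, hc, div_mul_cancel₀ _ hzpos.ne']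
    ring

variable {E : Type*} [NormedAddCommGroup E] [InnerProductSpace ℝ E]

theorem exists_inner_ge_of_mem_convexHull {s : Set E} {x : E} (hx : x ∈ convexHull ℝ s) (u : E) :
    ∃ t ∈ s, inner ℝ u x ≤ inner ℝ u t :=
  (((innerₛₗ ℝ u).convexOn convex_univ)).exists_ge_of_mem_convexHull (Set.subset_univ _) hx

/-- A colorful Carathéodory theorem anchored at the origin. -/
theorem exists_colorful_combination_of_mem_convexHull [FiniteDimensional ℝ E] {ι : Type*}
    [Fintype ι] (hι : Module.finrank ℝ E ≤ Fintype.card ι) (S : ι → Set E) {x : E}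
    (hx : ∀ i, x ∈ convexHull ℝ (S i)) {c : ℝ} (hc : 1 < c) :
    ∃ s : ι → E, (∀ i, s i ∈ S i) ∧ ∃ μ : ι → ℝ,
      (∀ i, 0 ≤ μ i) ∧ ∑ i, μ i ≤ c ∧ ∑ i, μ i • s i = x := by
  have hfin : ∀ i, ∃ F : Finset E, (F : Set E) ⊆ S i ∧ x ∈ convexHull ℝ (F : Set E) := fun i => by
    have := hx i
    rw [convexHull_eq_union_convexHull_finite_subsets] at this
    simpa using this
  choose F hFS hF using hfin
  have : ∀ i, Nonempty (F i) := fun i =>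
    (convexHull_nonempty_iff.1 ⟨x, hF i⟩).to_subtype
  obtain ⟨g, μ, hμ, hsum, hx⟩ := exists_colorful_nonneg_combination_sum_le hι
    (fun i (t : F i) => (t : E)) x one_pos hc fun u _ i => by
      obtain ⟨t, ht, hle⟩ := exists_inner_ge_of_mem_convexHull (hF i) u
      exact ⟨⟨t, ht⟩, by simpa using hle⟩
  exact ⟨fun i => g i, fun i => hFS i (g i).2, μ, hμ, hsum, hx⟩

/-- If `v` lies in the cone over `s` at distance more than `r` from its facets, then the ball of
radius `r` around `v` is contained in the cone, with control of the coefficients. -/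
theorem exists_abs_le_sum_smul_eq {d : ℕ} (s u : Fin d → EuclideanSpace ℝ (Fin d)) (β : Fin d → ℝ)
    (hβ : ∀ k, 0 ≤ β k) {r : ℝ} (hr : 0 < r) (hu : ∀ k, ‖u k‖ = 1)
    (hort : ∀ k j, j ≠ k → inner ℝ (u k) (s j) = 0)
    (hfar : ∀ k, r < |inner ℝ (u k) (∑ j, β j • s j)|) {x : EuclideanSpace ℝ (Fin d)}
    (hx : ‖x‖ ≤ r) : ∃ a : Fin d → ℝ, (∀ k, |a k| ≤ β k) ∧ ∑ k, a k • s k = x := by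
  have hinner : ∀ (a : Fin d → ℝ) k, inner ℝ (u k) (∑ j, a j • s j) = a k * inner ℝ (u k) (s k) :=
    fun a k => by
      rw [inner_sum, Finset.sum_eq_single k]
      · rw [inner_smul_right]
      · intro j _ hj
        rw [inner_smul_right, hort k j hj, mul_zero]
      · simp
  simp only [hinner, abs_mul, abs_of_nonneg (hβ _)] at hfar
  have hne : ∀ k, inner ℝ (u k) (s k) ≠ 0 := fun k h0 => by
    have := hfar k
    rw [h0] at this
    simp only [abs_zero, mul_zero] at this
    linarith
  have hli : LinearIndependent ℝ s := by
    refine Fintype.linearIndependent_iff.2 fun a ha k => ?_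
    have := hinner a k
    rw [ha, inner_zero_right, eq_comm] at this
    exact (mul_eq_zero.1 this).resolve_right (hne k)
  have htop := hli.span_eq_top_of_card_eq_finrank' (by simp)
  obtain ⟨a, ha⟩ := (Submodule.mem_span_range_iff_exists_fun ℝ).1 (htop ▸ Submodule.mem_top (x := x))
  refine ⟨a, fun k => ?_, ha⟩
  have h1 : |a k| * |inner ℝ (u k) (s k)| ≤ r := by
    rw [← abs_mul, ← hinner, ha]
    refine (abs_real_inner_le_norm _ _).trans ?_
    rwa [hu, one_mul]
  exact le_of_mul_le_mul_right (h1.trans (hfar k).le) (abs_pos.2 (hne k))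

/-- One point can be picked from each of `d` sets, all of whose convex hulls contain the unit ball,
so that the cone over these points has a point of the unit ball far from its facets. -/
theorem exists_colorful_fat_cone {d : ℕ} (hd : 0 < d) (S : Fin d → Set (EuclideanSpace ℝ (Fin d)))
    (hS : ∀ k, Metric.closedBall 0 1 ⊆ convexHull ℝ (S k)) {r c : ℝ} (hr : 0 < r) (hc : 1 < c)
    (hrd : (d * (d ^ 2) ^ (d - 1) : ℝ) * (2 * r * √d) < 1 / d) :
    ∃ s u : Fin d → EuclideanSpace ℝ (Fin d), (∀ k, s k ∈ S k) ∧ (∀ k, ‖u k‖ = 1) ∧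
      (∀ k j, j ≠ k → inner ℝ (u k) (s j) = 0) ∧ ∃ β : Fin d → ℝ, (∀ k, 0 ≤ β k) ∧
        ∑ k, β k ≤ c ∧ ‖∑ k, β k • s k‖ ≤ 1 ∧ ∀ k, r < |inner ℝ (u k) (∑ j, β j • s j)| := by
  have : Nonempty (Fin d) := ⟨⟨0, hd⟩⟩
  have hd' : (0 : ℝ) < d := Nat.cast_pos.2 hd
  obtain ⟨b, hb1, hbc⟩ := exists_between hc
  have hvert : ∀ k j, ∃ f : Fin d → EuclideanSpace ℝ (Fin d), (∀ l, f l ∈ S k) ∧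
      ∃ ν : Fin d → ℝ, (∀ l, 0 ≤ ν l) ∧ ∑ l, ν l ≤ b ∧
        ∑ l, ν l • f l = EuclideanSpace.single j 1 := fun k j =>
    exists_colorful_combination_of_mem_convexHull (by simp) (fun _ => S k)
      (fun _ => hS k (by simp)) hb1
  choose f hfS ν hν hνb hf using hvert
  have hnormal : ∀ t : Σ k : Fin d, ({j // j ≠ k} → Fin d × Fin d),
      ∃ u : EuclideanSpace ℝ (Fin d), ‖u‖ = 1 ∧
        ∀ j : {j // j ≠ t.1}, inner ℝ u (f j (t.2 j).1 (t.2 j).2) = 0 := fun t =>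
    exists_unit_orthogonal (by simp [hd]) _
  choose u hu hort using hnormal
  obtain ⟨v, hv, hfar⟩ := exists_mem_cube_far_from_hyperplanes hd u hu (one_div_pos.2 hd') hr (by
    convert hrd using 2
    simp [sq])
  have hv0 : ∀ j, 0 ≤ v j := fun j => (hv j).1
  have hv1 : ∑ j, v j ≤ 1 := by
    calc ∑ j, v j ≤ ∑ _j : Fin d, (1 / d : ℝ) := Finset.sum_le_sum fun j _ => (hv j).2
      _ = 1 := by simp [hd'.ne']
  have hvsum : ∀ k, v = ∑ j, ∑ l, (v j * ν k j l) • f k j l := fun k => by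
    simp only [mul_smul, ← Finset.smul_sum, hf]
    ext i
    simp [Pi.single_apply]
  obtain ⟨g, β, hβ, hβc, hβv⟩ := exists_colorful_nonneg_combination_sum_le (ι := Fin d) (by simp)
    (κ := fun _ => Fin d × Fin d) (fun k t => f k t.1 t.2) v (one_pos.trans hb1) hbc fun w hw k => by
      obtain ⟨t, ht⟩ := Finite.exists_max fun t : Fin d × Fin d => inner ℝ w (f k t.1 t.2)
      refine ⟨t, ?_⟩
      set m := inner ℝ w (f k t.1 t.2)
      have hexp : inner ℝ w v = ∑ j, ∑ l, (v j * ν k j l) * inner ℝ w (f k j l) := by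
        conv_lhs => rw [hvsum k]
        simp only [inner_sum, inner_smul_right]
      have hle : inner ℝ w v ≤ (∑ j, v j * ∑ l, ν k j l) * m := by
        simp only [hexp, Finset.mul_sum, Finset.sum_mul]
        exact Finset.sum_le_sum fun j _ => Finset.sum_le_sum fun l _ =>
          mul_le_mul_of_nonneg_left (ht (j, l)) (mul_nonneg (hv0 j) (hν k j l))
      have hW0 : 0 ≤ ∑ j, v j * ∑ l, ν k j l :=
        Finset.sum_nonneg fun j _ => mul_nonneg (hv0 j) (Finset.sum_nonneg fun l _ => hν k j l)
      have hWb : ∑ j, v j * ∑ l, ν k j l ≤ b := by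
        calc ∑ j, v j * ∑ l, ν k j l ≤ ∑ j, v j * b :=
              Finset.sum_le_sum fun j _ => mul_le_mul_of_nonneg_left (hνb k j) (hv0 j)
          _ = (∑ j, v j) * b := by rw [Finset.sum_mul]
          _ ≤ b := mul_le_of_le_one_left (by linarith) hv1
      have hm : 0 < m := by
        by_contra! hneg
        nlinarith
      exact hle.trans (mul_le_mul_of_nonneg_right hWb hm.le)
  refine ⟨fun k => f k (g k).1 (g k).2, fun k => u ⟨k, fun j => g j⟩, fun k => hfS _ _ _,
    fun k => hu _, fun k j hj => hort ⟨k, fun j => g j⟩ ⟨j, hj⟩, β, hβ, hβc, ?_, fun k => ?_⟩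
  · rw [hβv, EuclideanSpace.norm_eq, Real.sqrt_le_one]
    calc ∑ j, ‖v j‖ ^ 2 ≤ ∑ j, v j := Finset.sum_le_sum fun j _ => by
          rw [Real.norm_eq_abs, sq_abs]
          have : v j ≤ 1 := (Finset.single_le_sum (fun i _ => hv0 i) (Finset.mem_univ j)).trans hv1
          nlinarith [hv0 j]
      _ ≤ 1 := hv1
  · rw [hβv]
    exact hfar _

/-- A colorful quantitative Steinitz theorem. -/
theorem colorful_steinitz_of_lt {d : ℕ} (hd : 0 < d)
    (S : Fin d ⊕ Fin d → Set (EuclideanSpace ℝ (Fin d)))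
    (hS : ∀ k, Metric.closedBall 0 1 ⊆ convexHull ℝ (S k)) {r c : ℝ} (hr : 0 < r) (hc : 1 < c)
    (hrd : (d * (d ^ 2) ^ (d - 1) : ℝ) * (2 * r * √d) < 1 / d) :
    ∃ s : Fin d ⊕ Fin d → EuclideanSpace ℝ (Fin d), (∀ k, s k ∈ S k) ∧
      Metric.closedBall 0 (r / (3 * c)) ⊆ convexHull ℝ (Set.range s) := by
  obtain ⟨s, u, hs, hu, hort, β, hβ, hβc, hv1, hfar⟩ :=
    exists_colorful_fat_cone hd (fun k => S (Sum.inl k)) (fun k => hS _) hr hc hrd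
  set v := ∑ k, β k • s k with hv
  obtain ⟨s', hs', μ, hμ, hμc, hμv⟩ := exists_colorful_combination_of_mem_convexHull (x := -v)
    (by simp) (fun k : Fin d => S (Sum.inr k)) (fun k => hS _ (by simpa using hv1)) hc
  refine ⟨Sum.elim s s', ?_, fun x hx => ?_⟩
  · rintro (k | k)
    exacts [hs k, hs' k]
  have hc0 : 0 < 3 * c := by linarith
  obtain ⟨a, haβ, ha⟩ := exists_abs_le_sum_smul_eq s u β hβ hr hu hort hfar (x := (3 * c) • x) (by
    rw [mem_closedBall_zero_iff, le_div_iff₀ hc0] at hx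
    rw [norm_smul, Real.norm_of_nonneg hc0.le]
    linarith)
  have hβpos : 0 < ∑ k, β k := by
    refine (Finset.sum_nonneg fun k _ => hβ k).lt_of_ne' fun h0 => ?_
    have hβ0 : ∀ k, β k = 0 := fun k =>
      (Finset.sum_eq_zero_iff_of_nonneg fun k _ => hβ k).1 h0 k (Finset.mem_univ k)
    have := hfar ⟨0, hd⟩
    simp only [hv, hβ0, zero_smul, Finset.sum_const_zero, inner_zero_right, abs_zero] at this
    linarith
  have hμ0 : 0 ≤ ∑ k, μ k := Finset.sum_nonneg fun k _ => hμ k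
  have key := mem_convexHull_range_of_sum_le_one (Sum.elim s s')
    (w := fun i => (3 * c)⁻¹ * Sum.elim (fun k => a k + β k) μ i) (z := Sum.elim β μ) ?_ ?_ ?_ ?_ ?_
  · convert key using 1
    simp only [mul_smul (3 * c)⁻¹, ← Finset.smul_sum, Fintype.sum_sum_type, Sum.elim_inl, Sum.elim_inr,
      add_smul, Finset.sum_add_distrib, ha, ← hv, hμv]
    rw [add_neg_cancel_right, smul_smul, inv_mul_cancel₀ hc0.ne', one_smul]
  · rintro (k | k)
    · have := (abs_le.1 (haβ k)).1
      exact mul_nonneg (inv_nonneg.2 hc0.le) (by simp only [Sum.elim_inl]; linarith)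
    · exact mul_nonneg (inv_nonneg.2 hc0.le) (hμ k)
  · rw [← Finset.mul_sum, inv_mul_le_iff₀ hc0]
    simp only [Fintype.sum_sum_type, Sum.elim_inl, Sum.elim_inr, Finset.sum_add_distrib]
    have : ∑ k, a k ≤ ∑ k, β k :=
      Finset.sum_le_sum fun k _ => (le_abs_self _).trans (haβ k)
    linarith
  · rintro (k | k)
    exacts [hβ k, hμ k]
  · simp only [Fintype.sum_sum_type, Sum.elim_inl, Sum.elim_inr]
    linarith
  · simp only [Fintype.sum_sum_type, Sum.elim_inl, Sum.elim_inr, ← hv, hμv, add_neg_cancel]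

end Steinitz

section QuantitativeSteinitz

theorem pi_div_exp_sq_lt : Real.pi / Real.exp 1 ^ 2 < 0.4253 := by
  have h1 := Real.pi_lt_d4
  have h2 := Real.exp_one_gt_d9
  rw [div_lt_iff₀ (by positivity)]
  nlinarith

/-- Colorful quantitative Steinitz theorem around the origin. -/
theorem colorful_steinitz_zero {d : ℕ} (hd : 0 < d)
    (S : Fin d ⊕ Fin d → Set (EuclideanSpace ℝ (Fin d)))
    (hS : ∀ k, Metric.closedBall 0 1 ⊆ convexHull ℝ (S k)) :
    ∃ s : Fin d ⊕ Fin d → EuclideanSpace ℝ (Fin d), (∀ k, s k ∈ S k) ∧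
      Metric.closedBall 0 ((Real.pi / Real.exp 1 ^ 2) * (d : ℝ) ^ (-(2 * (d : ℤ)) - 2)) ⊆
        convexHull ℝ (Set.range s) := by
  have hκ := pi_div_exp_sq_lt
  set κ := Real.pi / Real.exp 1 ^ 2
  have hκ0 : 0 < κ := by positivity
  obtain rfl | hd2 : d = 1 ∨ 2 ≤ d := by omega
  · have hend : ∀ (k : Fin 1 ⊕ Fin 1) (ε : ℝ), |ε| = 1 → ∃ t ∈ S k, 1 ≤ ε * t 0 := fun k ε hε => by
      have hmem : EuclideanSpace.single (0 : Fin 1) ε ∈ convexHull ℝ (S k) := hS k (by simp [hε])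
      obtain ⟨t, ht, hle⟩ := exists_inner_ge_of_mem_convexHull hmem (EuclideanSpace.single 0 ε)
      refine ⟨t, ht, ?_⟩
      simpa [← sq, ← sq_abs ε, hε, PiLp.inner_apply, mul_comm] using hle
    obtain ⟨t, ht, ht1⟩ := hend (Sum.inl 0) 1 (by simp)
    obtain ⟨t', ht', ht1'⟩ := hend (Sum.inr 0) (-1) (by simp)
    refine ⟨Sum.elim (fun _ => t) fun _ => t', ?_, fun x hx => ?_⟩
    · rintro (k | k) <;> simpa [Subsingleton.elim k 0]
    have hx1 : |x 0| ≤ 1 := by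
      have : ‖x‖ ≤ 1 := by
        rw [mem_closedBall_zero_iff] at hx
        norm_num at hx
        linarith
      simpa [EuclideanSpace.norm_eq, Real.sqrt_sq_eq_abs] using this
    obtain ⟨hx2, hx3⟩ := abs_le.1 hx1
    have hpos : 0 < t 0 - t' 0 := by linarith
    have hseg : x ∈ segment ℝ t t' := by
      refine ⟨(x 0 - t' 0) / (t 0 - t' 0), (t 0 - x 0) / (t 0 - t' 0),
        div_nonneg (by linarith) hpos.le, div_nonneg (by linarith) hpos.le, ?_, ?_⟩
      · field_simp
        ring
      · ext i
        rw [Subsingleton.elim i 0]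
        simp only [PiLp.add_apply, PiLp.smul_apply, smul_eq_mul]
        field_simp
        ring
    exact segment_subset_convexHull (Set.mem_range.2 ⟨Sum.inl 0, rfl⟩)
      (Set.mem_range.2 ⟨Sum.inr 0, rfl⟩) hseg
  · have hd0 : (0 : ℝ) < d := Nat.cast_pos.2 hd
    set ρ := κ * (d : ℝ) ^ (-(2 * (d : ℤ)) - 2) with hρ
    have hρ0 : 0 < ρ := by positivity
    obtain ⟨s, hs, hsub⟩ := colorful_steinitz_of_lt hd S hS (r := 3 * (21 / 20) * ρ) (c := 21 / 20)
      (by positivity) (by norm_num) (by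
        have hpow : (d * (d ^ 2) ^ (d - 1) : ℝ) * ((d : ℝ) ^ (-(2 * (d : ℤ)) - 2)) * d ^ 3 = 1 := by
          obtain ⟨e, rfl⟩ : ∃ e, d = e + 1 := ⟨d - 1, by omega⟩
          rw [Nat.add_sub_cancel, ← pow_mul, ← zpow_natCast, ← zpow_natCast, ← zpow_one_add₀ hd0.ne',
            ← zpow_add₀ hd0.ne', ← zpow_add₀ hd0.ne']
          convert zpow_zero _ using 2
          push_cast
          ring
        have hsqrt : 1.414 ≤ √(d : ℝ) := by
          refine Real.le_sqrt_of_sq_le ?_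
          have : (2 : ℝ) ≤ d := by exact_mod_cast hd2
          norm_num
          linarith
        have hsq : √(d : ℝ) * √d = d := Real.mul_self_sqrt hd0.le
        rw [lt_div_iff₀ hd0]
        have hd3 : 0 < (d : ℝ) ^ 2 := by positivity
        refine lt_of_mul_lt_mul_right ?_ hd3.le
        calc (d * (d ^ 2) ^ (d - 1) : ℝ) * (2 * (3 * (21 / 20) * ρ) * √d) * d * d ^ 2
            = ((d * (d ^ 2) ^ (d - 1) : ℝ) * ((d : ℝ) ^ (-(2 * (d : ℤ)) - 2)) * d ^ 3) *
                (6.3 * κ * √d) := by rw [hρ]; ring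
          _ = 6.3 * κ * √d := by rw [hpow, one_mul]
          _ < 2.8 * √d := mul_lt_mul_of_pos_right (by linarith) (by positivity)
          _ ≤ √d ^ 3 * √d := mul_le_mul_of_nonneg_right
              (le_trans (by norm_num) (pow_le_pow_left₀ (by norm_num) hsqrt 3)) (by positivity)
          _ = 1 * d ^ 2 := by
            rw [one_mul, sq]
            linear_combination (√(d : ℝ) * √d + d) * hsq)
    refine ⟨s, hs, ?_⟩
    rwa [mul_div_cancel_left₀ _ (by norm_num)] at hsub

open scoped Pointwise in
/-- Colorful quantitative Steinitz theorem. -/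
theorem colorful_steinitz {d : ℕ} (hd : 0 < d)
    (S : Fin d ⊕ Fin d → Set (EuclideanSpace ℝ (Fin d))) (p : EuclideanSpace ℝ (Fin d))
    (hS : ∀ k, Metric.closedBall p 1 ⊆ convexHull ℝ (S k)) :
    ∃ s : Fin d ⊕ Fin d → EuclideanSpace ℝ (Fin d), (∀ k, s k ∈ S k) ∧
      Metric.closedBall p ((Real.pi / Real.exp 1 ^ 2) * (d : ℝ) ^ (-(2 * (d : ℤ)) - 2)) ⊆
        convexHull ℝ (Set.range s) := by
  obtain ⟨s, hs, hsub⟩ := colorful_steinitz_zero hd (fun k => -p +ᵥ S k) fun k => by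
    rw [convexHull_vadd, Set.subset_vadd_set_iff, neg_neg, Metric.vadd_closedBall]
    simpa using hS k
  refine ⟨fun k => p +ᵥ s k, fun k => ?_, ?_⟩
  · simpa [Set.mem_vadd_set_iff_neg_vadd_mem] using hs k
  · have hrange : Set.range (fun k => p +ᵥ s k) = p +ᵥ Set.range s := by
      rw [← Set.image_vadd, ← Set.range_comp]
      rfl
    rw [hrange, convexHull_vadd, Set.subset_vadd_set_iff, Metric.vadd_closedBall]
    simpa using hsub

end QuantitativeSteinitz

theorem le_nextPrime (q : ℕ) : q ≤ nextPrime q := by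
  obtain ⟨p, hqp, hp⟩ := Nat.exists_infinite_primes q
  exact (Nat.sInf_mem (s := {p : ℕ | p.Prime ∧ q ≤ p}) ⟨p, hp, hqp⟩).2

/-- If the convex hulls of enough sets contain unit balls, then one can pick a point from each set
and find `m` disjoint groups of at most `2d` of these points, all of whose convex hulls contain a
common ball. -/
theorem continuous_quantitative_tverberg {d m : ℕ} (hd : 0 < d) (hm : 0 < m) {Q : Type*} [Fintype Q]
    (hQ : 2 * m * d * (d + 1) ≤ Fintype.card Q + d) (T : Q → Set (EuclideanSpace ℝ (Fin d)))
    (hT : ∀ q, ∃ c, Metric.closedBall c 1 ⊆ convexHull ℝ (T q)) :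
    ∃ t : Q → EuclideanSpace ℝ (Fin d), (∀ q, t q ∈ T q) ∧ ∃ A : Fin m → Finset Q,
      (∀ k l, k ≠ l → Disjoint (A k) (A l)) ∧ (∀ k, (A k).card ≤ 2 * d) ∧
      ∃ p : EuclideanSpace ℝ (Fin d),
        Metric.closedBall p ((Real.pi / Real.exp 1 ^ 2) * (d : ℝ) ^ (-(2 * (d : ℤ)) - 2)) ⊆
          ⋂ k, convexHull ℝ (t '' (A k : Set Q)) := by
  classical
  choose c hc using hT
  have : Nonempty (Fin m × (Fin d ⊕ Fin d)) := ⟨⟨0, hm⟩, Sum.inl ⟨0, hd⟩⟩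
  obtain ⟨part, μ, p, hμ, hpart⟩ := tverberg (R := Fin m × (Fin d ⊕ Fin d)) (by
    simp only [Fintype.card_prod, Fintype.card_sum, Fintype.card_fin]
    calc m * (d + d) * (d + 1) = 2 * m * d * (d + 1) := by ring
      _ ≤ _ := hQ) c
  have hball : ∀ r, Metric.closedBall p 1 ⊆ convexHull ℝ (⋃ q ∈ {q | part q = r}, T q) :=
    fun r y hy => by
      have hy' : y = ∑ q with part q = r, μ q • (c q + (y - p)) := by
        simp only [smul_add, Finset.sum_add_distrib, ← Finset.sum_smul, hpart r]
        simp
      rw [hy']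
      refine (convex_convexHull ℝ _).sum_mem (fun q _ => hμ q) (hpart r).1 fun q hq => ?_
      have hsub : T q ⊆ ⋃ q ∈ {q | part q = r}, T q :=
        Set.subset_biUnion_of_mem (u := T) (show part q = r by simpa using hq)
      refine convexHull_mono hsub (hc q ?_)
      simpa [dist_eq_norm] using hy
  have hpick : ∀ k, ∃ s : Fin d ⊕ Fin d → EuclideanSpace ℝ (Fin d),
      (∀ a, s a ∈ ⋃ q ∈ {q | part q = (k, a)}, T q) ∧
      Metric.closedBall p ((Real.pi / Real.exp 1 ^ 2) * (d : ℝ) ^ (-(2 * (d : ℤ)) - 2)) ⊆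
        convexHull ℝ (Set.range s) := fun k =>
    colorful_steinitz hd _ p fun a => hball (k, a)
  choose s hs hsub using hpick
  simp only [Set.mem_iUnion, Set.mem_ofPred_eq, exists_prop] at hs
  choose g hg hgT using hs
  have hne : ∀ q, (T q).Nonempty := fun q =>
    convexHull_nonempty_iff.1 ⟨c q, hc q (Metric.mem_closedBall_self zero_le_one)⟩
  refine ⟨fun q => if q = g (part q).1 (part q).2 then s (part q).1 (part q).2 else (hne q).some,
    fun q => ?_, fun k => Finset.univ.image (g k), fun k l hkl => ?_, fun k => ?_, p, ?_⟩
  · dsimp only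
    split_ifs with h
    · have := hgT (part q).1 (part q).2
      rwa [← h] at this
    · exact (hne q).some_mem
  · refine Finset.disjoint_left.2 fun q hk hl => hkl ?_
    simp only [Finset.mem_image, Finset.mem_univ, true_and] at hk hl
    obtain ⟨a, rfl⟩ := hk
    obtain ⟨b, hb⟩ := hl
    have := hg l b
    rw [hb, hg k a] at this
    exact congrArg Prod.fst this
  · refine Finset.card_image_le.trans ?_
    simp [two_mul]
  · refine Set.subset_iInter fun k => (hsub k).trans (convexHull_mono ?_)
    rintro _ ⟨a, rfl⟩
    refine ⟨g k a, by simp, ?_⟩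
    simp [hg k a]

/-- Colorful continuous quantitative Tverberg theorem (first part of Theorem 4.2):
with `n = ⌈2md + 1⌉_p − 1` sets in each of `d + 1` color classes, all of whose convex
hulls contain a unit ball, there are choices `t_{i,j} ∈ T_{i,j}` and pairwise disjoint
sets `A_1, …, A_m` of chosen points, each containing at most `2d` points of each color,
whose convex hulls have a common ball of radius `(π/e²)·d^(−2d−2)`. -/
theorem colorful_continuous_quantitative_tverberg
    (d m : ℕ) (hd : 0 < d) (hm : 0 < m)
    (T : Fin (d + 1) → Fin (nextPrime (2 * m * d + 1) - 1) → Set (EuclideanSpace ℝ (Fin d)))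
    (hT : ∀ i j, ∃ c : EuclideanSpace ℝ (Fin d),
      Metric.closedBall c 1 ⊆ convexHull ℝ (T i j)) :
    ∃ t : Fin (d + 1) → Fin (nextPrime (2 * m * d + 1) - 1) → EuclideanSpace ℝ (Fin d),
      (∀ i j, t i j ∈ T i j) ∧
      ∃ A : Fin m → Finset (Fin (d + 1) × Fin (nextPrime (2 * m * d + 1) - 1)),
        (∀ k l, k ≠ l → Disjoint (A k) (A l)) ∧
        (∀ k, ∀ i : Fin (d + 1), ((A k).filter (fun q => q.1 = i)).card ≤ 2 * d) ∧
        ∃ p : EuclideanSpace ℝ (Fin d),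
          Metric.closedBall p ((Real.pi / Real.exp 1 ^ 2) * (d : ℝ) ^ (-(2 * (d : ℤ)) - 2)) ⊆
            ⋂ k, convexHull ℝ ((fun q : Fin (d + 1) × Fin (nextPrime (2 * m * d + 1) - 1) =>
              t q.1 q.2) '' (A k : Set (Fin (d + 1) × Fin (nextPrime (2 * m * d + 1) - 1)))) := by
  obtain ⟨t, ht, A, hA, hcard, p, hp⟩ := continuous_quantitative_tverberg hd hm
    (Q := Fin (d + 1) × Fin (nextPrime (2 * m * d + 1) - 1)) (by
      have := Nat.le_sub_one_of_lt (Nat.lt_of_succ_le (le_nextPrime (2 * m * d + 1)))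
      simp only [Fintype.card_prod, Fintype.card_fin]
      nlinarith) (fun q => T q.1 q.2) fun q => hT q.1 q.2
  exact ⟨fun i j => t (i, j), fun i j => ht (i, j), A, hA,
    fun k i => (Finset.card_filter_le _ _).trans (hcard k), p, hp⟩
end

section
/- Let m and d be positive integers, let ε > 0, and let n' be a positive integer with the ball-approximation property for (d, ε). Set n = ⌈m·((n' − 1)d + 1) + 1⌉_p − 1, where ⌈q⌉_p denotes the smallest prime number greater than or equal to q. For i = 1, …, d+1 and j = 1, …, n, let T_{i,j} ⊆ ℝ^d be sets such that each conv(T_{i,j}) contains a Euclidean ball of radius 1. Then there exist points t_{i,j} ∈ T_{i,j} for all i, j, and pairwise disjoint sets A_1, …, A_m, each a subset of {t_{i,j} : 1 ≤ i ≤ d+1, 1 ≤ j ≤ n}, such that for every k and every color i the set A_k contains at most (n' − 1)d + 1 of the points t_{i,1}, …, t_{i,n}, and such that there exists p ∈ ℝ^d with B_{1/(1+ε)}(p) ⊆ ⋂_{k=1}^m conv(A_k). -/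
open Pointwise

section Auxiliary

open scoped Matrix

/-- A circuit argument: for a family of vectors with a one-dimensional space of linear relations
spanned by `l`, the sum over facets, weighted by the signs of `l`, of the indicator that
the facet cone contains `y` depends only on `l` for generic `y`. -/
lemma sum_sign_facets_eq {κ E : Type*} [Fintype κ] [DecidableEq κ] [AddCommGroup E] [Module ℝ E]
    (V : κ → E) (l : κ → ℝ) (hl : l ≠ 0) (hdep : ∑ o, l o • V o = 0)
    (huniq : ∀ δ : κ → ℝ, ∑ o, δ o • V o = 0 → ∃ t : ℝ, δ = t • l)
    (hpos : ∀ δ : κ → ℝ, 0 ≤ δ → ∑ o, δ o • V o = 0 → (∃ o, δ o = 0) → δ = 0)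
    (y : E) (hy : ∃ μ : κ → ℝ, ∑ o, μ o • V o = y)
    (hgen : ∀ μ : κ → ℝ, ∑ o, μ o • V o = y → ∀ a b, a ≠ b → μ a = 0 → μ b ≠ 0)
    (F : κ → Prop) [DecidablePred F]
    (hF : ∀ o, l o ≠ 0 → (F o ↔ ∃ μ : κ → ℝ, 0 ≤ μ ∧ μ o = 0 ∧ ∑ o, μ o • V o = y)) :
    ∑ o, (SignType.sign (l o) : ℤ) * (if F o then 1 else 0) =
      if ∀ o, 0 < l o then 1 else if ∀ o, l o < 0 then -1 else 0 := by
  classical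
  have key : ∀ l' : κ → ℝ, ∑ o, l' o • V o = 0 →
      (∀ δ : κ → ℝ, ∑ o, δ o • V o = 0 → ∃ t : ℝ, δ = t • l') →
      (∀ o, 0 < l' o → (F o ↔ ∃ μ : κ → ℝ, 0 ≤ μ ∧ μ o = 0 ∧ ∑ o, μ o • V o = y)) →
      (∃ o, 0 < l' o) →
      ∑ o, (if 0 < l' o ∧ F o then (1 : ℤ) else 0) =
        if ∃ μ : κ → ℝ, 0 ≤ μ ∧ ∑ o, μ o • V o = y then 1 else 0 := by
    intro l' hdep huniq hF hex
    split_ifs with hc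
    · obtain ⟨μ, hμ0, hμ⟩ := hc
      have hne : (Finset.univ.filter fun o => 0 < l' o).Nonempty := by
        obtain ⟨o, ho⟩ := hex
        exact ⟨o, by simpa using ho⟩
      obtain ⟨o, ho, hmin⟩ := Finset.exists_min_image _ (fun o => μ o / l' o) hne
      simp only [Finset.mem_filter, Finset.mem_univ, true_and] at ho hmin
      have hF1 : F o := by
        refine (hF o ho).2 ⟨fun p => μ p - μ o / l' o * l' p, ?_, ?_, ?_⟩
        · intro p
          simp only [Pi.zero_apply, sub_nonneg]
          have h0 : 0 ≤ μ o / l' o := div_nonneg (hμ0 o) ho.le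
          rcases lt_or_ge 0 (l' p) with hp | hp
          · have := hmin p hp
            rwa [le_div_iff₀ hp] at this
          · exact (mul_nonpos_of_nonneg_of_nonpos h0 hp).trans (hμ0 p)
        · field_simp
          ring
        · simp only [sub_smul, mul_smul, Finset.sum_sub_distrib, ← Finset.smul_sum, hdep, hμ,
            smul_zero, sub_zero]
      rw [Finset.sum_eq_single o]
      · simp [ho, hF1]
      · intro p _ hpo
        rw [if_neg]
        rintro ⟨hp, hFp⟩
        obtain ⟨μ1, h10, h1o, h1⟩ := (hF o ho).1 hF1
        obtain ⟨μ2, h20, h2p, h2⟩ := (hF p hp).1 hFp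
        obtain ⟨t, ht⟩ := huniq (μ2 - μ1) (by simp [sub_smul, h1, h2])
        have e1 := congrFun ht o
        have e2 := congrFun ht p
        simp only [Pi.sub_apply, h1o, Pi.smul_apply, smul_eq_mul, h2p] at e1 e2
        have a1 := h20 o
        have a2 := h10 p
        simp only [Pi.zero_apply] at a1 a2
        have t1 : 0 ≤ t := by
          by_contra! h
          nlinarith
        have t2 : t ≤ 0 := by
          by_contra! h
          nlinarith
        have t0 : t = 0 := le_antisymm t2 t1
        have : μ1 p = 0 := by rw [t0] at e2; linarith
        exact hgen μ1 h1 o p (Ne.symm hpo) h1o this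
      · simp
    · refine Finset.sum_eq_zero fun o _ => if_neg ?_
      rintro ⟨ho, hFo⟩
      obtain ⟨μ, h0, -, h⟩ := (hF o ho).1 hFo
      exact hc ⟨μ, h0, h⟩
  have hsplit : ∑ o, (SignType.sign (l o) : ℤ) * (if F o then 1 else 0) =
      ∑ o, (if 0 < l o ∧ F o then (1 : ℤ) else 0) -
        ∑ o, (if 0 < (-l) o ∧ F o then (1 : ℤ) else 0) := by
    rw [← Finset.sum_sub_distrib]
    refine Finset.sum_congr rfl fun o _ => ?_
    rcases lt_trichotomy (l o) 0 with h | h | h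
    · by_cases hf : F o <;> simp [h, hf, not_lt.2 h.le]
    · by_cases hf : F o <;> simp [h, hf]
    · by_cases hf : F o <;> simp [h, hf, not_lt.2 h.le]
  have hkp := key l hdep huniq fun o ho => hF o ho.ne'
  have hkn := key (-l) (by simp [neg_smul, hdep])
    (fun δ h => by
      obtain ⟨t, ht⟩ := huniq δ h
      exact ⟨-t, by simp [ht]⟩) fun o ho => hF o (by simp at ho; exact ho.ne)
  have hcone : (∃ t : κ → ℝ, ∑ o, t o • V o = 0 ∧ ∀ o, 0 < t o) →
      ∃ μ : κ → ℝ, 0 ≤ μ ∧ ∑ o, μ o • V o = y := by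
    rintro ⟨t, ht, htp⟩
    obtain ⟨μ, hμ⟩ := hy
    have hb : ∃ B : ℝ, ∀ o, -μ o / t o ≤ B := by
      obtain ⟨B, hB⟩ := (Set.finite_range fun o => -μ o / t o).bddAbove
      exact ⟨B, fun o => hB ⟨o, rfl⟩⟩
    obtain ⟨B, hB⟩ := hb
    refine ⟨fun o => μ o + B * t o, fun o => ?_, ?_⟩
    · have := hB o
      rw [div_le_iff₀ (htp o)] at this
      simp only [Pi.zero_apply]
      linarith
    · simp only [add_smul, mul_smul, Finset.sum_add_distrib, ← Finset.smul_sum, ht, hμ,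
        smul_zero, add_zero]
  obtain ⟨o₀, ho₀⟩ := Function.ne_iff.1 hl
  rw [hsplit]
  by_cases hp : ∃ o, 0 < l o
  · by_cases hn : ∃ o, l o < 0
    · rw [hkp hp, hkn (by simpa using hn), sub_self, if_neg, if_neg]
      · intro h
        obtain ⟨o, ho⟩ := hp
        exact (h o).not_gt ho
      · intro h
        obtain ⟨o, ho⟩ := hn
        exact (h o).not_gt ho
    · push Not at hn
      have hall : ∀ o, 0 < l o := by
        intro o
        refine lt_of_le_of_ne (hn o) fun h => hl ?_
        exact hpos l hn hdep ⟨o, h.symm⟩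
      rw [hkp hp, if_pos hall, if_pos (hcone ⟨l, hdep, hall⟩)]
      simp [fun o => not_lt.2 (hall o).le]
  · push Not at hp
    have hall : ∀ o, l o < 0 := by
      intro o
      refine lt_of_le_of_ne (hp o) fun h => hl ?_
      have := hpos (-l) (fun o => by simpa using hp o) (by simp [neg_smul, hdep]) ⟨o, by simp [h]⟩
      simpa using this
    have hn : ∃ o, 0 < (-l) o := ⟨o₀, by simpa using hall o₀⟩
    rw [hkn hn, if_neg (fun h : ∀ o, 0 < l o => (h o₀).not_gt (hall o₀)), if_pos hall,
      if_pos (hcone ⟨-l, by simp [neg_smul, hdep],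
        fun o => by simpa using hall o⟩)]
    simp [fun o => not_lt.2 (hall o).le]

/-- The sign of the determinant of `M` if `y` lies in the cone generated by the rows of `M`,
and `0` otherwise. -/
noncomputable def coneSign {ι : Type*} [Fintype ι] [DecidableEq ι] (M : Matrix ι ι ℝ)
    (y : ι → ℝ) : ℤ :=
  open Classical in if ∃ μ : ι → ℝ, 0 ≤ μ ∧ μ ᵥ* M = y then (SignType.sign M.det : ℤ) else 0

/-- `y` is not a combination of the vectors `V` in which two coefficients vanish. -/
def IsGenericFor {κ E : Type*} [Fintype κ] [AddCommGroup E] [Module ℝ E] (V : κ → E) (y : E) :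
    Prop :=
  ∀ μ : κ → ℝ, ∑ o, μ o • V o = y → ∀ a b, a ≠ b → μ a = 0 → μ b ≠ 0

/-- There is no nontrivial nonnegative linear relation among a proper subfamily of `V`. -/
def ProperlyPointed {κ E : Type*} [Fintype κ] [AddCommGroup E] [Module ℝ E] (V : κ → E) : Prop :=
  ∀ δ : κ → ℝ, 0 ≤ δ → ∑ o, δ o • V o = 0 → (∃ o, δ o = 0) → δ = 0

/-- The rows of `M` together with one additional vector. -/
def extendRows {ι : Type*} (M : Matrix ι ι ℝ) (v : ι → ℝ) (o : Option ι) : ι → ℝ := o.elim v M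

lemma sum_extendRows {ι : Type*} [Fintype ι] (M : Matrix ι ι ℝ) (v : ι → ℝ) (μ : Option ι → ℝ) :
    ∑ o, μ o • extendRows M v o = μ none • v + (fun p => μ (some p)) ᵥ* M := by
  rw [Fintype.sum_option, Matrix.vecMul_eq_sum]
  rfl

section Circuit

variable {ι : Type*} [Fintype ι] [DecidableEq ι]

lemma vecMul_updateRow (M : Matrix ι ι ℝ) (q : ι) (v μ : ι → ℝ) :
    μ ᵥ* M.updateRow q v = μ q • v + (Function.update μ q 0) ᵥ* M := by
  rw [Matrix.vecMul_eq_sum, Matrix.vecMul_eq_sum,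
    Finset.sum_eq_add_sum_sdiff_singleton_of_mem (Finset.mem_univ q),
    Finset.sum_eq_add_sum_sdiff_singleton_of_mem (Finset.mem_univ q)]
  simp only [Matrix.updateRow_self, Function.update_self, zero_smul, zero_add]
  congr 1
  refine Finset.sum_congr rfl fun p hp => ?_
  have hpq : p ≠ q := by simpa using hp
  simp [hpq]

lemma sum_extendRows_of_some_eq_zero (M : Matrix ι ι ℝ) (v : ι → ℝ) (μ : Option ι → ℝ) (q : ι)
    (h : μ (some q) = 0) :
    ∑ o, μ o • extendRows M v o =
      (Function.update (fun p => μ (some p)) q (μ none)) ᵥ* M.updateRow q v := by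
  rw [sum_extendRows, vecMul_updateRow, Function.update_self, Function.update_idem]
  congr 2
  rw [← h]
  exact (Function.update_eq_self q (fun p => μ (some p))).symm

lemma eq_zero_of_vecMul_eq_zero_of_det_ne_zero (M : Matrix ι ι ℝ) (h : M.det ≠ 0) (μ : ι → ℝ)
    (hμ : μ ᵥ* M = 0) : μ = 0 := by
  by_contra h0
  exact h (Matrix.exists_vecMul_eq_zero_iff.1 ⟨μ, h0, hμ⟩)

theorem sum_coneSign_eq (M : Matrix ι ι ℝ) (v y y' : ι → ℝ)
    (hpos : ProperlyPointed (extendRows M v))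
    (hy : IsGenericFor (extendRows M v) y) (hy' : IsGenericFor (extendRows M v) y') :
    (∑ q, coneSign (M.updateRow q v) y) - coneSign M y =
      (∑ q, coneSign (M.updateRow q v) y') - coneSign M y' := by
  classical
  set l : Option ι → ℝ := fun o => o.elim (-M.det) fun q => (M.updateRow q v).det with hl
  by_cases h0 : l = 0
  · have h1 : M.det = 0 := by simpa [hl] using congrFun h0 none
    have h2 : ∀ q, (M.updateRow q v).det = 0 := fun q => by simpa [hl] using congrFun h0 (some q)
    simp [coneSign, h1, h2]
  have hdep : ∑ o, l o • extendRows M v o = 0 := by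
    have := Matrix.mulVec_cramer Mᵀ v
    rw [Matrix.mulVec_transpose, Matrix.det_transpose] at this
    rw [sum_extendRows, hl]
    have e : (fun p => (M.updateRow p v).det) = Matrix.cramer Mᵀ v := by
      ext p
      rw [Matrix.cramer_transpose_apply]
    simp only [Option.elim_none, Option.elim_some]
    rw [e, this]
    simp
  have hindep : ∀ o, l o ≠ 0 → ∀ μ : Option ι → ℝ, μ o = 0 →
      ∑ o, μ o • extendRows M v o = 0 → μ = 0 := by
    intro o ho μ hμ hs
    cases o with
    | none =>
      rw [sum_extendRows, hμ, zero_smul, zero_add] at hs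
      have := eq_zero_of_vecMul_eq_zero_of_det_ne_zero M (by simpa [hl] using ho) _ hs
      ext o
      cases o with
      | none => exact hμ
      | some p => exact congrFun this p
    | some q =>
      rw [sum_extendRows_of_some_eq_zero _ _ _ _ hμ] at hs
      have := eq_zero_of_vecMul_eq_zero_of_det_ne_zero _ (by simpa [hl] using ho) _ hs
      ext o
      cases o with
      | none => simpa using congrFun this q
      | some p =>
        by_cases hpq : p = q
        · rw [hpq]; exact hμ
        · simpa [hpq] using congrFun this p
  have huniq : ∀ δ : Option ι → ℝ, ∑ o, δ o • extendRows M v o = 0 → ∃ t : ℝ, δ = t • l := by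
    intro δ hδ
    obtain ⟨o, ho⟩ := Function.ne_iff.1 h0
    refine ⟨δ o / l o, ?_⟩
    have := hindep o ho (δ - (δ o / l o) • l) (by simp at ho; simp [ho]) (by
      simp only [Pi.sub_apply, Pi.smul_apply, smul_eq_mul, sub_smul, mul_smul,
        Finset.sum_sub_distrib, ← Finset.smul_sum, hdep, hδ, smul_zero, sub_zero])
    exact sub_eq_zero.1 this
  have hspan : ∀ y : ι → ℝ, ∃ μ : Option ι → ℝ, ∑ o, μ o • extendRows M v o = y := by
    intro y
    obtain ⟨o, ho⟩ := Function.ne_iff.1 h0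
    cases o with
    | none =>
      have hu : IsUnit M.det := by simpa [hl] using ho
      refine ⟨fun o => o.elim 0 fun p => (y ᵥ* M⁻¹) p, ?_⟩
      rw [sum_extendRows]
      simp only [Option.elim_none, Option.elim_some, zero_smul, zero_add]
      change (y ᵥ* M⁻¹) ᵥ* M = y
      rw [Matrix.vecMul_vecMul, Matrix.nonsing_inv_mul _ hu, Matrix.vecMul_one]
    | some q =>
      have hu : IsUnit (M.updateRow q v).det := by simpa [hl] using ho
      set c := y ᵥ* (M.updateRow q v)⁻¹ with hc
      refine ⟨fun o => o.elim (c q) fun p => Function.update c q 0 p, ?_⟩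
      rw [sum_extendRows]
      simp only [Option.elim_none, Option.elim_some]
      rw [← vecMul_updateRow, hc, Matrix.vecMul_vecMul, Matrix.nonsing_inv_mul _ hu,
        Matrix.vecMul_one]
  have main : ∀ y : ι → ℝ, IsGenericFor (extendRows M v) y →
      (∑ q, coneSign (M.updateRow q v) y) - coneSign M y =
        if ∀ o, 0 < l o then 1 else if ∀ o, l o < 0 then -1 else 0 := by
    intro y hy
    rw [← sum_sign_facets_eq (extendRows M v) l h0 hdep huniq hpos y (hspan y) hy
      (fun o => ∃ μ : Option ι → ℝ, 0 ≤ μ ∧ μ o = 0 ∧ ∑ o, μ o • extendRows M v o = y)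
      (fun o _ => Iff.rfl), Fintype.sum_option]
    have e1 : coneSign M y = -((SignType.sign (l none) : ℤ) * if (∃ μ : Option ι → ℝ,
        0 ≤ μ ∧ μ none = 0 ∧ ∑ o, μ o • extendRows M v o = y) then 1 else 0) := by
      have : (∃ μ : Option ι → ℝ, 0 ≤ μ ∧ μ none = 0 ∧ ∑ o, μ o • extendRows M v o = y) ↔
          ∃ μ : ι → ℝ, 0 ≤ μ ∧ μ ᵥ* M = y := by
        constructor
        · rintro ⟨μ, h1, h2, h3⟩
          refine ⟨fun p => μ (some p), fun p => h1 _, ?_⟩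
          rw [sum_extendRows, h2, zero_smul, zero_add] at h3
          exact h3
        · rintro ⟨μ, h1, h2⟩
          refine ⟨fun o => o.elim 0 μ, ?_, rfl, ?_⟩
          · rintro (_ | p)
            exacts [le_rfl, h1 p]
          · rw [sum_extendRows]
            simpa using h2
      simp only [this, coneSign, hl, Option.elim_none, Left.sign_neg]
      split_ifs <;> simp
    have e2 : ∀ q, coneSign (M.updateRow q v) y =
        (SignType.sign (l (some q)) : ℤ) * if (∃ μ : Option ι → ℝ,
        0 ≤ μ ∧ μ (some q) = 0 ∧ ∑ o, μ o • extendRows M v o = y) then 1 else 0 := by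
      intro q
      have : (∃ μ : Option ι → ℝ, 0 ≤ μ ∧ μ (some q) = 0 ∧ ∑ o, μ o • extendRows M v o = y) ↔
          ∃ μ : ι → ℝ, 0 ≤ μ ∧ μ ᵥ* M.updateRow q v = y := by
        constructor
        · rintro ⟨μ, h1, h2, h3⟩
          refine ⟨Function.update (fun p => μ (some p)) q (μ none), fun p => ?_, ?_⟩
          · by_cases hpq : p = q
            · subst hpq; simpa using h1 none
            · simpa [hpq] using h1 (some p)
          · rwa [sum_extendRows_of_some_eq_zero _ _ _ _ h2] at h3
        · rintro ⟨μ, h1, h2⟩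
          refine ⟨fun o => o.elim (μ q) (Function.update μ q 0), ?_, by simp, ?_⟩
          · rintro (_ | p)
            · exact h1 q
            · by_cases hpq : p = q
              · subst hpq; simp
              · simpa [hpq] using h1 p
          · rw [sum_extendRows, ← h2, vecMul_updateRow]
            rfl
      simp only [this, coneSign, hl, Option.elim_some]
      split_ifs <;> simp
    rw [e1, Finset.sum_congr rfl fun q _ => e2 q]
    ring
  rw [main y hy, main y' hy']

lemma coneSign_mul (M Q : Matrix ι ι ℝ) (hQ : Q.det ≠ 0) (y : ι → ℝ) :
    coneSign (M * Q) y = (SignType.sign Q.det : ℤ) * coneSign M (y ᵥ* Q⁻¹) := by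
  have hu : IsUnit Q.det := hQ.isUnit
  have : ∀ μ : ι → ℝ, μ ᵥ* (M * Q) = y ↔ μ ᵥ* M = y ᵥ* Q⁻¹ := by
    intro μ
    rw [← Matrix.vecMul_vecMul]
    constructor
    · rintro rfl
      rw [Matrix.vecMul_vecMul, Matrix.mul_nonsing_inv _ hu, Matrix.vecMul_one]
    · intro h
      rw [h, Matrix.vecMul_vecMul, Matrix.nonsing_inv_mul _ hu, Matrix.vecMul_one]
  unfold coneSign
  by_cases h : ∃ μ : ι → ℝ, 0 ≤ μ ∧ μ ᵥ* M = y ᵥ* Q⁻¹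
  · have h' : ∃ μ : ι → ℝ, 0 ≤ μ ∧ μ ᵥ* (M * Q) = y := by simpa only [this] using h
    rw [if_pos h, if_pos h', Matrix.det_mul, sign_mul, SignType.coe_mul, mul_comm]
  · have h' : ¬∃ μ : ι → ℝ, 0 ≤ μ ∧ μ ᵥ* (M * Q) = y := by simpa only [this] using h
    rw [if_neg h, if_neg h', mul_zero]

end Circuit

section Parts

variable {n : ℕ}

/-- The vertices of a simplex in `ℝⁿ` indexed by `Fin (n + 1)`, summing to zero. -/
def partVec (c : Fin (n + 1)) (b : Fin n) : ℝ :=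
  (if c = b.castSucc then 1 else 0) - if c = Fin.last n then 1 else 0

/-- The matrix permuting the vectors `partVec` according to `g`. -/
def permMat (g : Equiv.Perm (Fin (n + 1))) : Matrix (Fin n) (Fin n) ℝ :=
  Matrix.of fun b => partVec (g b.castSucc)

lemma partVec_castSucc (b : Fin n) : partVec b.castSucc = Pi.single b 1 := by
  ext b'
  simp [partVec, Pi.single_apply, eq_comm]

lemma partVec_last (b : Fin n) : partVec (Fin.last n) b = -1 := by
  simp [partVec, (Fin.castSucc_ne_last b).symm]

lemma sum_partVec : ∑ c : Fin (n + 1), partVec c = 0 := by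
  ext b
  simp [partVec]

lemma sum_partVec_castSucc (g : Equiv.Perm (Fin (n + 1))) :
    ∑ b : Fin n, partVec (g b.castSucc) = -partVec (g (Fin.last n)) := by
  have := Equiv.sum_comp g (partVec (n := n))
  rw [sum_partVec, Fin.sum_univ_castSucc] at this
  exact eq_neg_of_add_eq_zero_left this

lemma partVec_vecMul_permMat (g : Equiv.Perm (Fin (n + 1))) (c : Fin (n + 1)) :
    partVec c ᵥ* permMat g = partVec (g c) := by
  refine Fin.lastCases ?_ (fun b => ?_) c
  · rw [Matrix.vecMul_eq_sum]
    simp only [partVec_last, neg_smul, one_smul]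
    change ∑ b : Fin n, -partVec (g b.castSucc) = _
    rw [Finset.sum_neg_distrib]
    exact neg_eq_iff_eq_neg.2 (sum_partVec_castSucc g)
  · rw [partVec_castSucc, Matrix.single_one_vecMul]
    rfl

lemma permMat_mul (g h : Equiv.Perm (Fin (n + 1))) :
    permMat (g * h) = permMat h * permMat g := by
  ext b b'
  rw [Matrix.mul_apply_eq_vecMul]
  change partVec (g (h b.castSucc)) b' = (partVec (h b.castSucc) ᵥ* permMat g) b'
  rw [partVec_vecMul_permMat]

lemma permMat_one : permMat (1 : Equiv.Perm (Fin (n + 1))) = 1 := by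
  ext b b'
  change partVec b.castSucc b' = _
  rw [partVec_castSucc, Matrix.one_apply, Pi.single_apply]
  simp [eq_comm]

lemma det_permMat_swap_last (b : Fin n) :
    (permMat (Equiv.swap b.castSucc (Fin.last n))).det = -1 := by
  have : permMat (Equiv.swap b.castSucc (Fin.last n)) =
      Matrix.updateRow 1 b (partVec (Fin.last n)) := by
    ext a a'
    by_cases h : a = b
    · subst h
      simp [permMat]
    · rw [Matrix.updateRow_ne h]
      have : Equiv.swap b.castSucc (Fin.last n) a.castSucc = a.castSucc :=
        Equiv.swap_apply_of_ne_of_ne (by simpa using h) (Fin.castSucc_ne_last a)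
      simp only [permMat, Matrix.of_apply, this, partVec_castSucc, Matrix.one_apply,
        Pi.single_apply]
      simp [eq_comm]
  rw [this, ← Matrix.cramer_transpose_apply, Matrix.transpose_one, Matrix.cramer_one]
  simp [partVec_last]

lemma det_permMat (g : Equiv.Perm (Fin (n + 1))) :
    (permMat g).det = ((Equiv.Perm.sign g : ℤ) : ℝ) := by
  have hswap : ∀ x y : Fin (n + 1), x ≠ y → (permMat (Equiv.swap x y)).det = -1 := by
    intro x y hxy
    induction x using Fin.lastCases with
    | last =>
      induction y using Fin.lastCases with
      | last => exact absurd rfl hxy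
      | cast b => rw [Equiv.swap_comm]; exact det_permMat_swap_last b
    | cast a =>
      induction y using Fin.lastCases with
      | last => exact det_permMat_swap_last a
      | cast b =>
        have h := Equiv.swap_mul_swap_mul_swap (x := b.castSucc) (y := Fin.last n)
          (z := a.castSucc) (Fin.castSucc_ne_last _) hxy.symm
        rw [← h, permMat_mul, permMat_mul, Matrix.det_mul, Matrix.det_mul,
          Equiv.swap_comm (Fin.last n), det_permMat_swap_last, det_permMat_swap_last]
        norm_num
  induction g using Equiv.Perm.swap_induction_on with
  | one => simp [permMat_one]
  | swap_mul f x y hxy ih =>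
    rw [permMat_mul, Matrix.det_mul, ih, hswap x y hxy, Equiv.Perm.sign_mul,
      Equiv.Perm.sign_swap hxy]
    simp

end Parts

section ColorMatrix

variable {n : ℕ} {K : Type*} [Fintype K] [DecidableEq K]

/-- The tensor product of `x` with the vector of the part `c`. -/
def tensorVec {n : ℕ} {K : Type*} (x : K → ℝ) (c : Fin (n + 1)) (p : K × Fin n) : ℝ :=
  x p.1 * partVec c p.2

/-- The matrix of tensors encoding that the `j`-th point of color `i` is put in part `σ i j`. -/
def colorMatrix {n : ℕ} {K : Type*} (σ : K → Equiv.Perm (Fin (n + 1)))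
    (X : K × Fin n → K → ℝ) : Matrix (K × Fin n) (K × Fin n) ℝ :=
  Matrix.of fun q => tensorVec (X q) (σ q.1 q.2.castSucc)

/-- The product of the signs of the permutations. -/
def colorSign {n : ℕ} {K : Type*} [Fintype K] (σ : K → Equiv.Perm (Fin (n + 1))) : ℤ :=
  ∏ i, (Equiv.Perm.sign (σ i) : ℤ)

/-- The signed number of rainbow assignments whose cone contains `y`. -/
noncomputable def colorDegree (X : K × Fin n → K → ℝ) (y : K × Fin n → ℝ) : ℤ :=
  ∑ σ : K → Equiv.Perm (Fin (n + 1)), colorSign σ * coneSign (colorMatrix σ X) y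

lemma colorMatrix_update {n : ℕ} {K : Type*} [DecidableEq K]
    (σ : K → Equiv.Perm (Fin (n + 1))) (X : K × Fin n → K → ℝ)
    (q : K × Fin n) (x : K → ℝ) :
    colorMatrix σ (Function.update X q x) =
      (colorMatrix σ X).updateRow q (tensorVec x (σ q.1 q.2.castSucc)) := by
  ext a b
  by_cases h : a = q
  · subst h
    simp [colorMatrix]
  · simp [colorMatrix, h]

lemma det_colorMatrix_single (σ : K → Equiv.Perm (Fin (n + 1))) :
    (colorMatrix σ fun q => Pi.single q.1 1).det = (colorSign σ : ℝ) := by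
  have : colorMatrix σ (fun q => Pi.single q.1 1) =
      (Matrix.blockDiagonal fun i => permMat (σ i)).submatrix
        (Equiv.prodComm K (Fin n)) (Equiv.prodComm K (Fin n)) := by
    ext ⟨i, j⟩ ⟨i', j'⟩
    by_cases h : i = i'
    · subst h
      simp [colorMatrix, tensorVec, permMat, Matrix.blockDiagonal_apply]
    · simp [colorMatrix, tensorVec, Matrix.blockDiagonal_apply, h, Ne.symm h]
  rw [this, Matrix.det_submatrix_equiv_self, Matrix.det_blockDiagonal]
  simp [det_permMat, colorSign]

/-- The linear map permuting the parts. -/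
def partsMat (K : Type*) [DecidableEq K] (g : Equiv.Perm (Fin (n + 1))) :
    Matrix (K × Fin n) (K × Fin n) ℝ :=
  (Matrix.blockDiagonal fun _ : K => permMat g).submatrix
    (Equiv.prodComm K (Fin n)) (Equiv.prodComm K (Fin n))

lemma det_partsMat (g : Equiv.Perm (Fin (n + 1))) :
    (partsMat K g).det = ∏ _i : K, ((Equiv.Perm.sign g : ℤ) : ℝ) := by
  rw [partsMat, Matrix.det_submatrix_equiv_self, Matrix.det_blockDiagonal]
  simp [det_permMat]

lemma tensorVec_vecMul_partsMat (x : K → ℝ) (c : Fin (n + 1)) (g : Equiv.Perm (Fin (n + 1))) :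
    tensorVec x c ᵥ* partsMat K g = tensorVec x (g c) := by
  ext ⟨i, b⟩
  have := congrFun (partVec_vecMul_permMat g c) b
  simp only [Matrix.vecMul, dotProduct] at this
  simp only [tensorVec, ← this, Matrix.vecMul, dotProduct, partsMat, Fintype.sum_prod_type,
    Matrix.submatrix_apply, Equiv.prodComm_apply, Prod.swap_prod_mk, Matrix.blockDiagonal_apply]
  rw [Finset.sum_eq_single i]
  · simp [Finset.mul_sum, mul_assoc]
  · intro k _ hk
    simp [hk]
  · simp

lemma colorMatrix_mul_partsMat (σ : K → Equiv.Perm (Fin (n + 1))) (X : K × Fin n → K → ℝ)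
    (g : Equiv.Perm (Fin (n + 1))) :
    colorMatrix (fun i => g * σ i) X = colorMatrix σ X * partsMat K g := by
  ext q p
  rw [Matrix.mul_apply_eq_vecMul]
  exact (congrFun (tensorVec_vecMul_partsMat (X q) (σ q.1 q.2.castSucc) g) p).symm

/-- The boundary of the assignments cancels at every vertex other than the replaced one. -/
lemma sum_coneSign_updateRow_eq_zero (X : K × Fin n → K → ℝ) (x : K → ℝ) (q₀ q : K × Fin n)
    (hq : q ≠ q₀) (y : K × Fin n → ℝ) :
    ∑ σ : K → Equiv.Perm (Fin (n + 1)), colorSign σ * coneSign ((colorMatrix σ X).updateRow q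
      (tensorVec x (σ q₀.1 q₀.2.castSucc))) y = 0 := by
  set e : (K → Equiv.Perm (Fin (n + 1))) → (K → Equiv.Perm (Fin (n + 1))) := fun σ =>
    Function.update σ q.1 (σ q.1 * Equiv.swap q.2.castSucc (Fin.last n)) with he
  have hee : ∀ σ, e (e σ) = σ := by
    intro σ
    simp [he, mul_assoc]
  have hsign : ∀ σ, colorSign (e σ) = -colorSign σ := by
    intro σ
    rw [colorSign, colorSign, ← Finset.mul_prod_erase _ _ (Finset.mem_univ q.1),
      ← Finset.mul_prod_erase _ _ (Finset.mem_univ q.1), ← neg_mul]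
    congr 1
    · simp [he, Equiv.Perm.sign_mul, Equiv.Perm.sign_swap (Fin.castSucc_ne_last q.2)]
    · refine Finset.prod_congr rfl fun i hi => ?_
      simp [he, Finset.ne_of_mem_erase hi]
  have hval : ∀ σ, ∀ p : K × Fin n, p ≠ q → e σ p.1 p.2.castSucc = σ p.1 p.2.castSucc := by
    rintro σ ⟨i, j⟩ hp
    by_cases hi : i = q.1
    · subst hi
      have hj : j ≠ q.2 := fun h => hp (by simp [h])
      simp only [he, Function.update_self, Equiv.Perm.mul_apply]
      rw [Equiv.swap_apply_of_ne_of_ne (by simpa using hj) (Fin.castSucc_ne_last j)]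
    · simp [he, hi]
  have hmat : ∀ σ, (colorMatrix (e σ) X).updateRow q
      (tensorVec x (e σ q₀.1 q₀.2.castSucc)) =
      (colorMatrix σ X).updateRow q (tensorVec x (σ q₀.1 q₀.2.castSucc)) := by
    intro σ
    rw [hval σ q₀ hq.symm]
    ext a b
    by_cases ha : a = q
    · subst ha; simp
    · rw [Matrix.updateRow_ne ha, Matrix.updateRow_ne ha]
      simp only [colorMatrix, Matrix.of_apply, hval σ a ha]
  refine Finset.sum_involution (fun σ _ => e σ) (fun σ _ => ?_) (fun σ _ h0 h => ?_)
    (fun _ _ => Finset.mem_univ _) (fun σ _ => hee σ)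
  · rw [hmat, hsign]; ring
  · have h1 := hsign σ
    rw [h] at h1
    have h2 : colorSign σ = 0 := by omega
    simp [h2] at h0

/-- A function on tuples of permutations invariant under simultaneous left translation has sum
divisible by the order of the symmetric group. -/
lemma dvd_sum_of_left_invariant [Nonempty K] {G : Type*} [Group G] [Fintype G]
    (f : (K → G) → ℤ) (hf : ∀ g σ, f (fun i => g * σ i) = f σ) :
    (Fintype.card G : ℤ) ∣ ∑ σ, f σ := by
  classical
  obtain ⟨i₀⟩ := ‹Nonempty K›
  have h : ∀ g : G, ∑ σ : K → G, (if σ i₀ = g then f σ else 0) =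
      ∑ σ : K → G, if σ i₀ = 1 then f σ else 0 := by
    intro g
    refine (Fintype.sum_equiv (Equiv.piCongrRight fun _ : K => Equiv.mulLeft g) _ _ ?_).symm
    intro σ
    have : (Equiv.piCongrRight fun _ : K => Equiv.mulLeft g) σ = fun i => g * σ i := rfl
    rw [this, hf]
    simp
  have h2 : ∑ σ, f σ = ∑ g : G, ∑ σ : K → G, (if σ i₀ = g then f σ else 0) := by
    rw [Finset.sum_comm]
    simp
  rw [h2, Finset.sum_congr rfl fun g _ => h g]
  simp

lemma isGenericFor_mul (σ : K → Equiv.Perm (Fin (n + 1))) (X : K × Fin n → K → ℝ)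
    (q : K × Fin n) (x : K → ℝ) (g : Equiv.Perm (Fin (n + 1))) (y : K × Fin n → ℝ)
    (hy : IsGenericFor (extendRows (colorMatrix (fun i => g * σ i) X)
      (tensorVec x (g (σ q.1 q.2.castSucc)))) y) :
    IsGenericFor (extendRows (colorMatrix σ X) (tensorVec x (σ q.1 q.2.castSucc)))
      (y ᵥ* (partsMat K g)⁻¹) := by
  have hu : IsUnit (partsMat K g).det := by
    rw [det_partsMat]
    refine isUnit_iff_ne_zero.2 (Finset.prod_ne_zero_iff.2 fun _ _ => by simp)
  intro μ hμ
  refine hy μ ?_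
  rw [sum_extendRows] at hμ ⊢
  rw [← tensorVec_vecMul_partsMat, colorMatrix_mul_partsMat, ← Matrix.vecMul_vecMul,
    ← Matrix.smul_vecMul, ← Matrix.add_vecMul, hμ, Matrix.vecMul_vecMul,
    Matrix.nonsing_inv_mul _ hu, Matrix.vecMul_one]

lemma sign_prod_perm (g : Equiv.Perm (Fin (n + 1))) :
    ((SignType.sign (partsMat K g).det : SignType) : ℤ) = ∏ _i : K, (Equiv.Perm.sign g : ℤ) := by
  rw [det_partsMat]
  rcases Int.units_eq_one_or (Equiv.Perm.sign g) with h | h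
  · simp [h]
  · rcases neg_one_pow_eq_or ℝ (Fintype.card K) with hk | hk
    · rcases neg_one_pow_eq_or ℤ (Fintype.card K) with hk' | hk'
      · simp [h, hk, hk']
      · have : ((-1 : ℤ) : ℝ) ^ Fintype.card K = ((-1 : ℤ) : ℝ) := by exact_mod_cast hk'
        norm_num [hk] at this
    · rcases neg_one_pow_eq_or ℤ (Fintype.card K) with hk' | hk'
      · have : ((-1 : ℤ) : ℝ) ^ Fintype.card K = ((1 : ℤ) : ℝ) := by exact_mod_cast hk'
        norm_num [hk] at this
      · simp [h, hk, hk']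

theorem colorDegree_update_modEq [Nonempty K] (X : K × Fin n → K → ℝ) (q : K × Fin n)
    (x : K → ℝ) (y : K × Fin n → ℝ)
    (hpos : ∀ σ : K → Equiv.Perm (Fin (n + 1)), ProperlyPointed
      (extendRows (colorMatrix σ X) (tensorVec x (σ q.1 q.2.castSucc))))
    (hy : ∀ σ : K → Equiv.Perm (Fin (n + 1)), IsGenericFor
      (extendRows (colorMatrix σ X) (tensorVec x (σ q.1 q.2.castSucc))) y) :
    colorDegree X y ≡ colorDegree (Function.update X q x) y [ZMOD (n + 1)] := by
  set ψ : (K → Equiv.Perm (Fin (n + 1))) → (K × Fin n → ℝ) → ℤ := fun σ y =>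
    (∑ p, coneSign ((colorMatrix σ X).updateRow p (tensorVec x (σ q.1 q.2.castSucc))) y) -
      coneSign (colorMatrix σ X) y with hψ
  have hdiff : colorDegree (Function.update X q x) y - colorDegree X y =
      ∑ σ, colorSign σ * ψ σ y := by
    simp only [hψ, mul_sub, Finset.sum_sub_distrib, Finset.mul_sum]
    rw [Finset.sum_comm, Finset.sum_eq_single q]
    · simp only [colorDegree, colorMatrix_update]
    · intro p _ hp
      exact sum_coneSign_updateRow_eq_zero X x q p hp y
    · simp
  have hinv : ∀ (g : Equiv.Perm (Fin (n + 1))) σ,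
      colorSign (fun i => g * σ i) * ψ (fun i => g * σ i) y = colorSign σ * ψ σ y := by
    intro g σ
    have hd : (partsMat K g).det ≠ 0 := by
      rw [det_partsMat]
      exact Finset.prod_ne_zero_iff.2 fun _ _ => by simp
    have hup : ∀ p, (colorMatrix (fun i => g * σ i) X).updateRow p
        (tensorVec x (g (σ q.1 q.2.castSucc))) =
        (colorMatrix σ X).updateRow p (tensorVec x (σ q.1 q.2.castSucc)) * partsMat K g := by
      intro p
      ext a b
      by_cases ha : a = p
      · subst ha
        rw [Matrix.mul_apply_eq_vecMul]
        simp [tensorVec_vecMul_partsMat]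
      · rw [Matrix.mul_apply_eq_vecMul]
        simp only [Matrix.updateRow_ne ha, colorMatrix_mul_partsMat]
        rw [Matrix.mul_apply_eq_vecMul]
    have h1 : ψ (fun i => g * σ i) y =
        (SignType.sign (partsMat K g).det : ℤ) * ψ σ (y ᵥ* (partsMat K g)⁻¹) := by
      simp only [hψ, Equiv.Perm.mul_apply]
      rw [Finset.sum_congr rfl (fun p _ => by rw [hup p, coneSign_mul _ _ hd]),
        colorMatrix_mul_partsMat, coneSign_mul _ _ hd, mul_sub, Finset.mul_sum]
    have h2 : ψ σ (y ᵥ* (partsMat K g)⁻¹) = ψ σ y :=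
      sum_coneSign_eq _ _ _ _ (hpos σ)
        (isGenericFor_mul σ X q x g y (hy fun i => g * σ i)) (hy σ)
    have h3 : colorSign (fun i => g * σ i) =
        (∏ _i : K, (Equiv.Perm.sign g : ℤ)) * colorSign σ := by
      simp [colorSign, Equiv.Perm.sign_mul, Finset.prod_mul_distrib]
    have h4 : (∏ _i : K, (Equiv.Perm.sign g : ℤ)) * ∏ _i : K, (Equiv.Perm.sign g : ℤ) = 1 := by
      rw [← Finset.prod_mul_distrib]
      refine Finset.prod_eq_one fun _ _ => ?_
      rw [← Units.val_mul, Int.units_mul_self, Units.val_one]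
    rw [h1, h2, h3, sign_prod_perm]
    linear_combination (colorSign σ * ψ σ y) * h4
  rw [Int.modEq_iff_dvd, hdiff]
  refine dvd_trans ?_ (dvd_sum_of_left_invariant _ hinv)
  rw [Fintype.card_perm, Fintype.card_fin]
  exact_mod_cast Nat.dvd_factorial n.succ_pos le_rfl

end ColorMatrix

section Genericity

/-- The determinant of the rows of `M` and `v` with the row `o` left out. -/
noncomputable def facetDet {ι : Type*} [Fintype ι] [DecidableEq ι] (M : Matrix ι ι ℝ)
    (v : ι → ℝ) (o : Option ι) : ℝ := (o.elim M fun q => M.updateRow q v).det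

lemma eq_zero_of_facetDet_ne_zero {ι : Type*} [Fintype ι] [DecidableEq ι] (M : Matrix ι ι ℝ)
    (v : ι → ℝ) (o : Option ι) (ho : facetDet M v o ≠ 0) (μ : Option ι → ℝ) (hμ : μ o = 0)
    (hs : ∑ o, μ o • extendRows M v o = 0) : μ = 0 := by
  cases o with
  | none =>
    rw [sum_extendRows, hμ, zero_smul, zero_add] at hs
    have := eq_zero_of_vecMul_eq_zero_of_det_ne_zero M ho _ hs
    ext o
    cases o with
    | none => exact hμ
    | some p => exact congrFun this p
  | some q =>
    rw [sum_extendRows_of_some_eq_zero _ _ _ _ hμ] at hs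
    have := eq_zero_of_vecMul_eq_zero_of_det_ne_zero _ ho _ hs
    ext o
    cases o with
    | none => simpa using congrFun this q
    | some p =>
      by_cases hpq : p = q
      · rw [hpq]; exact hμ
      · simpa [hpq] using congrFun this p

lemma facetDet_ne_zero {ι : Type*} [Fintype ι] [DecidableEq ι] (M : Matrix ι ι ℝ)
    (v : ι → ℝ) (o : Option ι) (h : ∀ μ : Option ι → ℝ, μ o = 0 →
      ∑ o, μ o • extendRows M v o = 0 → μ = 0) : facetDet M v o ≠ 0 := by
  intro h0
  cases o with
  | none =>
    obtain ⟨μ, hμ, hs⟩ := Matrix.exists_vecMul_eq_zero_iff.2 h0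
    refine hμ ?_
    have := h (fun o => o.elim 0 μ) rfl (by rw [sum_extendRows]; simpa using hs)
    ext p
    exact congrFun this (some p)
  | some q =>
    obtain ⟨μ, hμ, hs⟩ := Matrix.exists_vecMul_eq_zero_iff.2 h0
    refine hμ ?_
    have := h (fun o => o.elim (μ q) (Function.update μ q 0)) (by simp) (by
      rw [sum_extendRows]
      simp only [Option.elim_none, Option.elim_some]
      change μ q • v + Function.update μ q 0 ᵥ* M = 0
      rw [← vecMul_updateRow]
      exact hs)
    ext p
    by_cases hpq : p = q
    · subst hpq; exact congrFun this none
    · simpa [hpq] using congrFun this (some p)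

lemma sum_tensorVec_apply {O K : Type*} [Fintype O] {n : ℕ} (Y : O → K → ℝ)
    (β : O → Fin (n + 1)) (μ : O → ℝ) (k : K) (b : Fin n) :
    (∑ o, μ o • tensorVec (Y o) (β o)) (k, b) =
      (∑ o, if β o = b.castSucc then μ o * Y o k else 0) -
        ∑ o, if β o = Fin.last n then μ o * Y o k else 0 := by
  rw [Finset.sum_apply, ← Finset.sum_sub_distrib]
  refine Finset.sum_congr rfl fun o _ => ?_
  simp only [tensorVec, partVec, Pi.smul_apply, smul_eq_mul]
  split_ifs <;> ring

lemma properlyPointed_of_independent {O K : Type*} [Fintype O] [Fintype K] {n : ℕ}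
    (Y : O → K → ℝ) (hY : ∀ o, 0 < ∑ k, Y o k) (β : O → Fin (n + 1)) (a : Fin (n + 1))
    (H : ∀ o₁, (β o₁ = a ∨ (Finset.univ.filter fun o => β o = a).card ≤ Fintype.card K) →
      ∀ δ : O → ℝ, δ o₁ = 0 → ∑ o, δ o • tensorVec (Y o) (β o) = 0 → δ = 0) :
    ProperlyPointed fun o => tensorVec (Y o) (β o) := by
  classical
  rintro δ hδ hs ⟨o₁, ho₁⟩
  by_cases hc : (Finset.univ.filter fun o => β o = a).card ≤ Fintype.card K
  · exact H o₁ (Or.inr hc) δ ho₁ hs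
  have hnl : ¬LinearIndependent ℝ (fun o : {o // β o = a} => Y o) := by
    intro hl
    have := hl.fintype_card_le_finrank
    rw [Module.finrank_fintype_fun_eq_card, Fintype.card_subtype] at this
    exact hc this
  obtain ⟨g, hg, ⟨o₂, ho₂⟩, hne⟩ := Fintype.not_linearIndependent_iff.1 hnl
  set κ : O → ℝ := fun o => if h : β o = a then g ⟨o, h⟩ else 0 with hκ
  have hκY : ∀ f : O → ℝ, ∑ o, κ o * f o = ∑ o : {o // β o = a}, g o * f o := by
    intro f
    rw [← Finset.sum_filter_of_ne (p := fun o => β o = a), Finset.sum_subtype _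
      (p := fun o => β o = a) (by simp)]
    · refine Finset.sum_congr rfl fun o _ => ?_
      simp only [hκ, o.2, dite_true]
    · intro o _ h
      by_contra h'
      simp [hκ, h'] at h
  have hκ0 : ∀ k, ∑ o, κ o * Y o k = 0 := by
    intro k
    rw [hκY fun o => Y o k]
    simpa using congrFun hg k
  have hκs : ∑ o, κ o • tensorVec (Y o) (β o) = 0 := by
    ext ⟨k, b⟩
    have h1 : ∀ o, κ o * (Y o k * partVec (β o) b) = κ o * Y o k * partVec a b := by
      intro o
      by_cases h : β o = a
      · rw [h]; ring
      · simp [hκ, h]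
    simp only [Finset.sum_apply, Pi.smul_apply, smul_eq_mul, tensorVec, h1, Pi.zero_apply]
    rw [← Finset.sum_mul, hκ0, zero_mul]
  have hκ2 : κ o₂ ≠ 0 := by simpa [hκ, ho₂] using hne
  have hδκ := H o₂ (Or.inl ho₂) (δ - (δ o₂ / κ o₂) • κ) (by simp [hκ2]) (by
    simp only [Pi.sub_apply, Pi.smul_apply, smul_eq_mul, sub_smul, mul_smul,
      Finset.sum_sub_distrib, ← Finset.smul_sum, hκs, hs, smul_zero, sub_zero])
  rw [sub_eq_zero] at hδκ
  have hsum : ∑ o, δ o * ∑ k, Y o k = 0 := by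
    simp only [Finset.mul_sum]
    rw [Finset.sum_comm]
    refine Finset.sum_eq_zero fun k _ => ?_
    rw [hδκ]
    simp only [Pi.smul_apply, smul_eq_mul, mul_assoc]
    rw [← Finset.mul_sum, hκ0, mul_zero]
  ext o
  have := (Finset.sum_eq_zero_iff_of_nonneg fun o _ => mul_nonneg (hδ o) (hY o).le).1 hsum o
    (Finset.mem_univ o)
  exact (mul_eq_zero.1 this).resolve_right (hY o).ne'

/-- Elements distributed among boxes can be colored so that colors in a box are distinct and
every color is missing in some box. -/
lemma exists_coloring_missing {O C K : Type*} [Fintype O] [Fintype C] [Fintype K]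
    [DecidableEq C] (β : O → C)
    (hβ : ∀ c, (Finset.univ.filter fun o => β o = c).card ≤ Fintype.card K)
    (hO : Fintype.card O + Fintype.card K = Fintype.card K * Fintype.card C) :
    ∃ col : O → K, (∀ o o', β o = β o' → col o = col o' → o = o') ∧
      ∀ k, ∃ c, ∀ o, β o = c → col o ≠ k := by
  classical
  set f : C → ℕ := fun c => Fintype.card K - (Finset.univ.filter fun o => β o = c).card with hf
  have hfsum : ∑ c, f c = Fintype.card K := by
    have h1 : ∑ c, (f c + (Finset.univ.filter fun o => β o = c).card) =
        ∑ _c : C, Fintype.card K :=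
      Finset.sum_congr rfl fun c _ => Nat.sub_add_cancel (hβ c)
    have h2 : ∑ c, (Finset.univ.filter fun o => β o = c).card = Fintype.card O :=
      (Finset.card_eq_sum_card_fiberwise (f := β) (s := Finset.univ) (t := Finset.univ)
        (fun _ _ => Finset.mem_univ _)).symm
    rw [Finset.sum_add_distrib, h2, Finset.sum_const, smul_eq_mul, Finset.card_univ,
      mul_comm] at h1
    omega
  have e : K ≃ Σ c, Fin (f c) := Fintype.equivOfCardEq (by simp [hfsum])
  have hm : ∀ c, Fintype.card {k // (e k).1 ≠ c} = Fintype.card {o // β o = c} := by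
    intro c
    have h1 : Fintype.card {k // (e k).1 = c} = f c := by
      rw [Fintype.card_congr ((e.subtypeEquiv (q := fun s => s.1 = c) fun _ => Iff.rfl).trans
        (Equiv.sigmaSubtype c))]
      simp
    rw [Fintype.card_subtype_compl, h1, Fintype.card_subtype]
    exact Nat.sub_sub_self (hβ c)
  have E : ∀ c, {o // β o = c} ≃ {k // (e k).1 ≠ c} := fun c =>
    Fintype.equivOfCardEq (hm c).symm
  refine ⟨fun o => E (β o) ⟨o, rfl⟩, fun o o' h h' => ?_, fun k => ⟨(e k).1, fun o ho hk => ?_⟩⟩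
  · have : ∀ c (h1 : β o = c), ((E (β o) ⟨o, rfl⟩ : {k // (e k).1 ≠ β o}) : K) = E c ⟨o, h1⟩ := by
      rintro c rfl; rfl
    simp only [this _ h] at h'
    have := (E (β o')).injective (Subtype.ext h')
    simpa using this
  · exact (E (β o) ⟨o, rfl⟩).2 ((congrArg (fun k => (e k).1) hk).trans ho.symm)

lemma eq_zero_of_coloring_missing {O K : Type*} [Fintype O] [DecidableEq K] {n : ℕ}
    (β : O → Fin (n + 1)) (o₁ : O) (col : O → K)
    (hinj : ∀ o o', o ≠ o₁ → o' ≠ o₁ → β o = β o' → col o = col o' → o = o')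
    (hmiss : ∀ k, ∃ c, ∀ o, o ≠ o₁ → β o = c → col o ≠ k) (μ : O → ℝ) (hμ : μ o₁ = 0)
    (hs : ∑ o, μ o • tensorVec (Pi.single (col o) (1 : ℝ)) (β o) = 0) : μ = 0 := by
  classical
  set S : Fin (n + 1) → K → ℝ := fun c k =>
    ∑ o, if β o = c then μ o * (Pi.single (col o) (1 : ℝ) : K → ℝ) k else 0 with hS
  have h1 : ∀ c k, S c k = S (Fin.last n) k := by
    intro c k
    refine Fin.lastCases rfl (fun b => ?_) c
    have := sum_tensorVec_apply (fun o => Pi.single (col o) (1 : ℝ)) β μ k b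
    rw [hs] at this
    exact sub_eq_zero.1 this.symm
  have h2 : ∀ c k, S c k = 0 := by
    intro c k
    obtain ⟨c', hc'⟩ := hmiss k
    rw [h1, ← h1 c']
    refine Finset.sum_eq_zero fun o _ => ?_
    by_cases ho : o = o₁
    · simp [ho, hμ]
    · by_cases hc : β o = c'
      · simp [(hc' o ho hc).symm]
      · simp [hc]
  ext o
  by_cases ho : o = o₁
  · rw [ho, hμ]; rfl
  · have := h2 (β o) (col o)
    rw [hS] at this
    simp only at this
    rw [Finset.sum_eq_single o] at this
    · simpa using this
    · intro o' _ hne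
      by_cases ho' : o' = o₁
      · simp [ho', hμ]
      · by_cases hc : β o' = β o
        · have hcol : col o ≠ col o' := fun h => hne (hinj _ _ ho' ho hc h.symm)
          simp [hcol]
        · simp [hc]
    · simp

lemma exists_facetDet_ne_zero {n : ℕ} {K : Type*} [Fintype K] [DecidableEq K]
    (σ : K → Equiv.Perm (Fin (n + 1))) (q₀ : K × Fin n) (o₁ : Option (K × Fin n))
    (a : Fin (n + 1)) (β : Option (K × Fin n) → Fin (n + 1))
    (hβ : ∀ o, β o = o.elim a fun q => σ q.1 q.2.castSucc)
    (ho₁ : β o₁ = a ∨ (Finset.univ.filter fun o => β o = a).card ≤ Fintype.card K) :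
    ∃ (X : K × Fin n → K → ℝ) (x : K → ℝ),
      facetDet (colorMatrix σ X) (tensorVec x a) o₁ ≠ 0 := by
  classical
  have hsome : ∀ c, (Finset.univ.filter fun q : K × Fin n => σ q.1 q.2.castSucc = c).card ≤
      Fintype.card K := by
    intro c
    refine Finset.card_le_card_of_injOn Prod.fst (fun _ _ => Finset.mem_univ _) ?_
    rintro ⟨i, j⟩ hq ⟨i', j'⟩ hq' (h : i = i')
    subst h
    simp only [Finset.coe_filter, Finset.mem_univ, true_and, Set.mem_ofPred_eq] at hq hq'
    have := (σ i).injective (hq.trans hq'.symm)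
    simpa using this
  have hall : ∀ c, (Finset.univ.filter fun o => β o = c).card =
      (if a = c then 1 else 0) +
        (Finset.univ.filter fun q : K × Fin n => σ q.1 q.2.castSucc = c).card := by
    intro c
    rw [Finset.card_filter, Fintype.sum_option, Finset.card_filter]
    simp [hβ]
  obtain ⟨col, hinj, hmiss⟩ := exists_coloring_missing (K := K)
    (fun o : {o // o ≠ o₁} => β o) (fun c => by
      have h1 : (Finset.univ.filter fun o : {o // o ≠ o₁} => β o = c).card =
          ((Finset.univ.filter fun o => β o = c).erase o₁).card := by
        refine Finset.card_bij (fun o _ => o.1) ?_ ?_ ?_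
        · rintro ⟨o, ho⟩ h
          simpa [ho] using h
        · intro _ _ _ _ h
          exact Subtype.ext h
        · intro o h
          simp only [Finset.mem_erase, Finset.mem_filter, Finset.mem_univ, true_and] at h
          exact ⟨⟨o, h.1⟩, by simpa using h.2, rfl⟩
      rw [h1]
      by_cases hc : a = c
      · subst hc
        rcases ho₁ with h | h
        · rw [Finset.card_erase_of_mem (by simpa using h), hall]
          have := hsome a
          simp only [if_true]
          omega
        · exact (Finset.card_le_card (Finset.erase_subset _ _)).trans h
      · refine (Finset.card_le_card (Finset.erase_subset _ _)).trans ?_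
        rw [hall, if_neg hc, zero_add]
        exact hsome c)
    (by
      rw [Fintype.card_subtype_compl]
      simp [mul_add])
  have : Nonempty K := ⟨q₀.1⟩
  set col' : Option (K × Fin n) → K := fun o =>
    if h : o ≠ o₁ then col ⟨o, h⟩ else q₀.1 with hcol'
  have hc : ∀ o (h : o ≠ o₁), col' o = col ⟨o, h⟩ := fun o h => by simp only [hcol', dif_pos h]
  refine ⟨fun q => Pi.single (col' (some q)) 1, Pi.single (col' none) 1,
    facetDet_ne_zero _ _ _ fun μ hμ hs => ?_⟩
  refine eq_zero_of_coloring_missing β o₁ col' ?_ ?_ μ hμ ?_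
  · intro o o' ho ho' h h'
    rw [hc _ ho, hc _ ho'] at h'
    simpa using hinj ⟨o, ho⟩ ⟨o', ho'⟩ h h'
  · intro k
    obtain ⟨c, hcm⟩ := hmiss k
    exact ⟨c, fun o ho h => by rw [hc _ ho]; exact hcm ⟨o, ho⟩ h⟩
  · rw [← hs]
    refine Finset.sum_congr rfl fun o _ => ?_
    rw [hβ]
    cases o <;> rfl

lemma dense_det_ne_zero {ι E : Type*} [Fintype ι] [DecidableEq ι] [NormedAddCommGroup E]
    [NormedSpace ℝ E] (F : E →ₗ[ℝ] Matrix ι ι ℝ) (z : E) (hz : (F z).det ≠ 0) :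
    Dense {x | (F x).det ≠ 0} := by
  intro x
  set p : Polynomial ℝ := ((Polynomial.X : Polynomial ℝ) • (F (z - x)).map Polynomial.C +
    (F x).map Polynomial.C).det with hp
  have hp_eval : ∀ t : ℝ, p.eval t = (F (x + t • (z - x))).det := by
    intro t
    rw [hp, ← Polynomial.coe_evalRingHom, RingHom.map_det]
    congr 1
    ext i j
    simp [add_comm]
  have hp0 : p ≠ 0 := by
    intro h
    have := hp_eval 1
    rw [h] at this
    simp at this
    exact hz this.symm
  have hd : Dense {t : ℝ | p.eval t ≠ 0} := by
    have : {t : ℝ | p.eval t ≠ 0} = ((p.roots.toFinset : Set ℝ))ᶜ := by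
      ext t; simp [hp0]
    rw [this]
    exact (Finset.finite_toSet _).countable.dense_compl ℝ
  have hcont : Continuous fun t : ℝ => x + t • (z - x) := by fun_prop
  have := hcont.range_subset_closure_image_dense hd
  have hx : x ∈ Set.range fun t : ℝ => x + t • (z - x) := ⟨0, by simp⟩
  refine closure_mono ?_ (this hx)
  rintro _ ⟨t, ht, rfl⟩
  simpa [hp_eval] using ht

lemma isOpen_det_ne_zero {ι E : Type*} [Fintype ι] [DecidableEq ι] [NormedAddCommGroup E]
    [NormedSpace ℝ E] [FiniteDimensional ℝ E] (F : E →ₗ[ℝ] Matrix ι ι ℝ) :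
    IsOpen {x | (F x).det ≠ 0} :=
  isOpen_ne_fun (Continuous.matrix_det F.continuous_of_finiteDimensional) continuous_const

lemma dense_isGenericFor {J κ ι : Type*} [Finite J] [Fintype κ] [Fintype ι]
    (V : J → κ → ι → ℝ) (hκ : Fintype.card κ = Fintype.card ι + 1) :
    Dense {y : ι → ℝ | ∀ j, IsGenericFor (V j) y} := by
  classical
  let P := {p : κ × κ // p.1 ≠ p.2}
  let W : J × P → Submodule ℝ (ι → ℝ) := fun r => Submodule.span ℝ
    (Set.range fun o : {o // o ≠ r.2.1.1 ∧ o ≠ r.2.1.2} => V r.1 o)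
  have hW : ∀ r, W r ≠ ⊤ := by
    rintro ⟨j, ⟨a, b⟩, hab⟩ h
    have h1 := finrank_range_le_card (R := ℝ) (fun o : {o // o ≠ a ∧ o ≠ b} => V j o)
    have h2 : Fintype.card {o // o ≠ a ∧ o ≠ b} < Fintype.card ι := by
      rw [Fintype.card_subtype]
      have : (Finset.univ.filter fun o => o ≠ a ∧ o ≠ b) = (Finset.univ.erase a).erase b := by
        ext o; simp [and_comm]
      rw [this, Finset.card_erase_of_mem (by simpa using hab.symm),
        Finset.card_erase_of_mem (Finset.mem_univ _), Finset.card_univ, hκ]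
      have : 1 < Fintype.card κ := Fintype.one_lt_card_iff.2 ⟨a, b, hab⟩
      omega
    have h3 : Set.finrank ℝ (Set.range fun o : {o // o ≠ a ∧ o ≠ b} => V j o) =
        Fintype.card ι := by
      change Module.finrank ℝ (W (j, ⟨(a, b), hab⟩)) = _
      rw [h, finrank_top, Module.finrank_fintype_fun_eq_card]
    omega
  have hdense : Dense (⋂ r, ((W r : Set (ι → ℝ))ᶜ)) := by
    refine dense_iInter_of_isOpen (fun r => ?_) (fun r => ?_)
    · exact (Submodule.closed_of_finiteDimensional _).isOpen_compl
    · rw [← interior_eq_empty_iff_dense_compl]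
      by_contra h
      exact hW r (Submodule.eq_top_of_nonempty_interior' _ (Set.nonempty_iff_ne_empty.2 h))
  refine hdense.mono fun y hy j μ hμ a b hab ha hb => ?_
  refine Set.mem_iInter.1 hy (j, ⟨(a, b), hab⟩) ?_
  rw [← hμ]
  refine Submodule.sum_mem _ fun o _ => ?_
  by_cases h : o ≠ a ∧ o ≠ b
  · exact Submodule.smul_mem _ _ (Submodule.subset_span ⟨⟨o, h⟩, rfl⟩)
  · have : μ o = 0 := by
      by_cases h' : o = a
      · rw [h', ha]
      · rw [not_and_not_right] at h
        rw [h h', hb]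
    rw [this, zero_smul]
    exact Submodule.zero_mem _

lemma dense_properlyPointed {n : ℕ} {K : Type*} [Fintype K] [DecidableEq K] :
    Dense {w : (K × Fin n → K → ℝ) × (K × Fin n → K → ℝ) |
      (∀ q, 0 < ∑ k, w.1 q k) → (∀ q, 0 < ∑ k, w.2 q k) →
      ∀ (s : Finset (K × Fin n)) (q₀ : K × Fin n), q₀ ∉ s →
      ∀ σ : K → Equiv.Perm (Fin (n + 1)), ProperlyPointed
        (extendRows (colorMatrix σ (s.piecewise w.2 w.1))
          (tensorVec (w.2 q₀) (σ q₀.1 q₀.2.castSucc)))} := by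
  classical
  let J := Finset (K × Fin n) × (K × Fin n) × (K → Equiv.Perm (Fin (n + 1))) × Option (K × Fin n)
  let β : J → Option (K × Fin n) → Fin (n + 1) := fun r o =>
    o.elim (r.2.2.1 r.2.1.1 r.2.1.2.castSucc) fun q => r.2.2.1 q.1 q.2.castSucc
  let good : J → Prop := fun r => r.2.1 ∉ r.1 ∧ (β r r.2.2.2 = β r none ∨
    (Finset.univ.filter fun o => β r o = β r none).card ≤ Fintype.card K)
  let F : J → ((K × Fin n → K → ℝ) × (K × Fin n → K → ℝ)) →
      Matrix (K × Fin n) (K × Fin n) ℝ := fun r w =>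
    r.2.2.2.elim (colorMatrix r.2.2.1 (r.1.piecewise w.2 w.1)) fun q =>
      (colorMatrix r.2.2.1 (r.1.piecewise w.2 w.1)).updateRow q (tensorVec (w.2 r.2.1) (β r none))
  have hF : ∀ r, ∃ L : ((K × Fin n → K → ℝ) × (K × Fin n → K → ℝ)) →ₗ[ℝ]
      Matrix (K × Fin n) (K × Fin n) ℝ, ∀ w, L w = F r w := by
    rintro ⟨s, q₀, σ, o₁⟩
    have h1 : ∀ (u w : ((K × Fin n → K → ℝ) × (K × Fin n → K → ℝ))) p p',
        F ⟨s, q₀, σ, o₁⟩ (u + w) p p' =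
        F ⟨s, q₀, σ, o₁⟩ u p p' + F ⟨s, q₀, σ, o₁⟩ w p p' := by
      intro u w p p'
      cases o₁ with
      | none =>
        by_cases hp : p ∈ s <;> simp [F, colorMatrix, tensorVec, hp, add_mul]
      | some q =>
        by_cases hq : p = q
        · subst hq; simp [F, tensorVec, add_mul]
        · by_cases hp : p ∈ s <;> simp [F, colorMatrix, tensorVec, hp, hq, add_mul]
    have h2 : ∀ (c : ℝ) (w : ((K × Fin n → K → ℝ) × (K × Fin n → K → ℝ))) p p',
        F ⟨s, q₀, σ, o₁⟩ (c • w) p p' =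
        c * F ⟨s, q₀, σ, o₁⟩ w p p' := by
      intro c w p p'
      cases o₁ with
      | none =>
        by_cases hp : p ∈ s <;> simp [F, colorMatrix, tensorVec, hp, mul_assoc]
      | some q =>
        by_cases hq : p = q
        · subst hq; simp [F, tensorVec, mul_assoc]
        · by_cases hp : p ∈ s <;> simp [F, colorMatrix, tensorVec, hp, hq, mul_assoc]
    exact ⟨{ toFun := F ⟨s, q₀, σ, o₁⟩
             map_add' := fun u w => by ext p p'; exact h1 u w p p'
             map_smul' := fun c w => by ext p p'; exact h2 c w p p' }, fun _ => rfl⟩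
  choose L hL using hF
  have hdense : Dense (⋂ r,
      {w : ((K × Fin n → K → ℝ) × (K × Fin n → K → ℝ)) | good r → (L r w).det ≠ 0}) := by
    refine dense_iInter_of_isOpen (fun r => ?_) (fun r => ?_)
    · by_cases hr : good r
      · simpa [hr] using isOpen_det_ne_zero (L r)
      · simp [hr]
    · by_cases hr : good r
      · obtain ⟨X, x, hXx⟩ := exists_facetDet_ne_zero r.2.2.1 r.2.1 r.2.2.2 (β r none) (β r)
          (fun _ => rfl) hr.2
        have := dense_det_ne_zero (L r) (X, Function.update X r.2.1 x) (by
          rw [hL]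
          have hp : r.1.piecewise (Function.update X r.2.1 x) X = X := by
            ext q k
            by_cases hq : q ∈ r.1
            · have : q ≠ r.2.1 := fun h => hr.1 (h ▸ hq)
              simp [hq, this]
            · simp [hq]
          simpa [F, hp, facetDet] using hXx)
        simpa [hr] using this
      · simp [hr]
  refine hdense.mono fun w hw hw1 hw2 s q₀ hq₀ σ => ?_
  have key : ∀ o, extendRows (colorMatrix σ (s.piecewise w.2 w.1))
      (tensorVec (w.2 q₀) (σ q₀.1 q₀.2.castSucc)) o =
      tensorVec ((o.elim (w.2 q₀) (s.piecewise w.2 w.1) : K → ℝ)) (β ⟨s, q₀, σ, none⟩ o) := by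
    rintro (_ | o) <;> rfl
  rw [funext key]
  refine properlyPointed_of_independent
    (fun o : Option (K × Fin n) => (o.elim (w.2 q₀) (s.piecewise w.2 w.1) : K → ℝ))
    ?_ _ (σ q₀.1 q₀.2.castSucc) ?_
  · rintro (_ | q)
    · exact hw2 q₀
    · by_cases hq : q ∈ s
      · simpa [hq] using hw2 q
      · simpa [hq] using hw1 q
  · intro o₁ ho₁ δ hδ hs
    simp only [← key] at hs
    refine eq_zero_of_facetDet_ne_zero _ _ o₁ ?_ δ hδ hs
    have := Set.mem_iInter.1 hw ⟨s, q₀, σ, o₁⟩ ⟨hq₀, ho₁⟩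
    rw [hL] at this
    exact this

end Genericity

section Degree

open Filter Topology

lemma coneSign_of_det_ne_zero {ι : Type*} [Fintype ι] [DecidableEq ι] (M : Matrix ι ι ℝ)
    (y : ι → ℝ) (h : M.det ≠ 0) [Decidable (0 ≤ y ᵥ* M⁻¹)] :
    coneSign M y = if 0 ≤ y ᵥ* M⁻¹ then (SignType.sign M.det : ℤ) else 0 := by
  have hu : IsUnit M.det := h.isUnit
  have : (∃ μ : ι → ℝ, 0 ≤ μ ∧ μ ᵥ* M = y) ↔ 0 ≤ y ᵥ* M⁻¹ := by
    constructor
    · rintro ⟨μ, h0, rfl⟩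
      rwa [Matrix.vecMul_vecMul, Matrix.mul_nonsing_inv _ hu, Matrix.vecMul_one]
    · intro h0
      exact ⟨_, h0, by rw [Matrix.vecMul_vecMul, Matrix.nonsing_inv_mul _ hu, Matrix.vecMul_one]⟩
  rw [coneSign]
  simp only [this]

section Eventually

variable {ι Z : Type*} [Fintype ι] [DecidableEq ι] [TopologicalSpace Z]
  {M : Z → Matrix ι ι ℝ} {y : Z → ι → ℝ} {z₀ : Z}

lemma tendsto_vecMul_inv (hM : Continuous M) (hy : Continuous y) (hdet : (M z₀).det ≠ 0)
    {μ : ι → ℝ} (hμ : μ ᵥ* M z₀ = y z₀) (q : ι) :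
    Tendsto (fun z => (y z ᵥ* (M z)⁻¹) q) (𝓝 z₀) (𝓝 (μ q)) := by
  have hu : IsUnit (M z₀).det := hdet.isUnit
  have h0 : y z₀ ᵥ* (M z₀)⁻¹ = μ := by
    rw [← hμ, Matrix.vecMul_vecMul, Matrix.mul_nonsing_inv _ hu, Matrix.vecMul_one]
  have h1 : ContinuousAt (fun z => (M z)⁻¹) z₀ := by
    have h2 : (fun z => (M z)⁻¹) = fun z => ((M z).det)⁻¹ • (M z).adjugate := by
      ext z; rw [Matrix.inv_def, Ring.inverse_eq_inv']
    rw [h2]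
    exact (hM.matrix_det.continuousAt.inv₀ hdet).smul hM.matrix_adjugate.continuousAt
  rw [← h0]
  simp only [Matrix.vecMul, dotProduct]
  refine tendsto_finsetSum _ fun p _ => ?_
  refine Tendsto.mul ((continuous_apply p).tendsto _ |>.comp hy.continuousAt) ?_
  exact ((continuous_apply q).tendsto _).comp (((continuous_apply p).tendsto _).comp h1)

lemma eventually_coneSign_of_pos (hM : Continuous M) (hy : Continuous y)
    (hdet : (M z₀).det ≠ 0) {μ : ι → ℝ} (hμ : μ ᵥ* M z₀ = y z₀) (hpos : ∀ q, 0 < μ q) :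
    ∀ᶠ z in 𝓝 z₀, coneSign (M z) (y z) = (SignType.sign (M z₀).det : ℤ) := by
  classical
  have h1 : ∀ᶠ z in 𝓝 z₀, ∀ q, 0 < (y z ᵥ* (M z)⁻¹) q :=
    eventually_all.2 fun q => (tendsto_vecMul_inv hM hy hdet hμ q).eventually_const_lt (hpos q)
  have h2 : ∀ᶠ z in 𝓝 z₀, SignType.sign (M z).det = SignType.sign (M z₀).det := by
    rcases lt_or_gt_of_ne hdet with h | h
    · filter_upwards [hM.matrix_det.continuousAt.eventually_lt_const h] with z hz
      rw [sign_neg hz, sign_neg h]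
    · filter_upwards [hM.matrix_det.continuousAt.eventually_const_lt h] with z hz
      rw [sign_pos hz, sign_pos h]
  filter_upwards [h1, h2, hM.matrix_det.continuousAt.eventually_ne hdet] with z hz1 hz2 hz3
  rw [coneSign_of_det_ne_zero _ _ hz3, if_pos (show 0 ≤ y z ᵥ* (M z)⁻¹ from fun q => (hz1 q).le),
    hz2]

lemma eventually_coneSign_of_neg (hM : Continuous M) (hy : Continuous y)
    (hdet : (M z₀).det ≠ 0) {μ : ι → ℝ} (hμ : μ ᵥ* M z₀ = y z₀) {q : ι} (hneg : μ q < 0) :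
    ∀ᶠ z in 𝓝 z₀, coneSign (M z) (y z) = 0 := by
  classical
  filter_upwards [(tendsto_vecMul_inv hM hy hdet hμ q).eventually_lt_const hneg,
    hM.matrix_det.continuousAt.eventually_ne hdet] with z hz hz3
  rw [coneSign_of_det_ne_zero _ _ hz3, if_neg fun h : 0 ≤ y z ᵥ* (M z)⁻¹ => (h q).not_gt hz]

end Eventually

variable {n : ℕ} {K : Type*} [Fintype K] [DecidableEq K]

lemma continuous_colorMatrix {n : ℕ} {K : Type*} (σ : K → Equiv.Perm (Fin (n + 1))) :
    Continuous (colorMatrix σ) := by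
  refine continuous_matrix fun q p => ?_
  simp only [colorMatrix, tensorVec, Matrix.of_apply]
  fun_prop

lemma colorSign_mul_sign {n : ℕ} {K : Type*} [Fintype K] (σ : K → Equiv.Perm (Fin (n + 1))) :
    colorSign σ * (SignType.sign (colorSign σ : ℝ) : ℤ) = 1 := by
  have : colorSign σ = 1 ∨ colorSign σ = -1 := by
    refine Int.isUnit_iff.1 ?_
    unfold colorSign
    exact IsUnit.prod_univ_iff.2 fun i => Units.isUnit _
  rcases this with h | h <;> simp [h]

lemma eventually_colorDegree :
    ∀ᶠ z : (K × Fin n → K → ℝ) × (K × Fin n → ℝ) in 𝓝 (fun q => Pi.single q.1 1, 1),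
      colorDegree z.1 z.2 =
        ∑ σ : K → Equiv.Perm (Fin (n + 1)), if ∀ i, σ i (Fin.last n) = Fin.last n then 1 else 0 := by
  have key : ∀ σ : K → Equiv.Perm (Fin (n + 1)),
      ∀ᶠ z : (K × Fin n → K → ℝ) × (K × Fin n → ℝ) in 𝓝 (fun q => Pi.single q.1 1, 1),
      colorSign σ * coneSign (colorMatrix σ z.1) z.2 =
        if ∀ i, σ i (Fin.last n) = Fin.last n then 1 else 0 := by
    intro σ
    have hM : Continuous fun z : (K × Fin n → K → ℝ) × (K × Fin n → ℝ) => colorMatrix σ z.1 :=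
      (continuous_colorMatrix σ).comp continuous_fst
    set z₀ : (K × Fin n → K → ℝ) × (K × Fin n → ℝ) := (fun q => Pi.single q.1 1, 1) with hz₀
    have hdet : (colorMatrix σ z₀.1).det = (colorSign σ : ℝ) := det_colorMatrix_single σ
    have hsg := colorSign_mul_sign σ
    have hdet0 : (colorMatrix σ z₀.1).det ≠ 0 := by
      rw [hdet]
      intro h
      simp [h] at hsg
    set μ : K × Fin n → ℝ := fun q => if σ q.1 (Fin.last n) = Fin.last n then 1 else
      if σ q.1 q.2.castSucc = Fin.last n then -1 else 0 with hμ
    have hlast : (-partVec (Fin.last n) : Fin n → ℝ) = 1 := by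
      ext b; simp [partVec_last]
    have hμs : μ ᵥ* colorMatrix σ z₀.1 = z₀.2 := by
      have hrow : ∀ i, ∑ j : Fin n, μ (i, j) • partVec (σ i j.castSucc) = (1 : Fin n → ℝ) := by
        intro i
        by_cases h : σ i (Fin.last n) = Fin.last n
        · simp only [hμ, if_pos h, one_smul]
          rw [sum_partVec_castSucc, h, hlast]
        · obtain ⟨c, hc⟩ := (σ i).surjective (Fin.last n)
          have hcl : c ≠ Fin.last n := by rintro rfl; exact h hc
          obtain ⟨j, rfl⟩ := Fin.exists_castSucc_eq.2 hcl
          rw [Finset.sum_eq_single j]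
          · simp only [hμ, if_neg h, hc, if_true, neg_smul, one_smul]
            exact hlast
          · intro j' _ hj'
            have : σ i j'.castSucc ≠ Fin.last n := by
              rw [← hc]
              exact fun h' => hj' (by simpa using (σ i).injective h')
            simp [hμ, h, this]
          · simp
      ext ⟨i, b⟩
      have := congrFun (hrow i) b
      simp only [Finset.sum_apply, Pi.smul_apply, smul_eq_mul, Pi.one_apply] at this
      simp only [Matrix.vecMul, dotProduct, Fintype.sum_prod_type, colorMatrix, tensorVec,
        Matrix.of_apply, hz₀]
      rw [Finset.sum_eq_single i]
      · simpa using this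
      · intro k _ hk
        simp [hk.symm]
      · simp
    by_cases h : ∀ i, σ i (Fin.last n) = Fin.last n
    · filter_upwards [eventually_coneSign_of_pos hM continuous_snd hdet0 hμs
        (fun q => by simp [hμ, h])] with z hz
      rw [hz, hdet, hsg, if_pos h]
    · obtain ⟨i, hi⟩ := not_forall.1 h
      obtain ⟨c, hc⟩ := (σ i).surjective (Fin.last n)
      have hcl : c ≠ Fin.last n := by rintro rfl; exact hi hc
      obtain ⟨j, rfl⟩ := Fin.exists_castSucc_eq.2 hcl
      filter_upwards [eventually_coneSign_of_neg hM continuous_snd hdet0 hμs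
        (q := (i, j)) (by simp [hμ, hi, hc])] with z hz
      rw [hz, mul_zero, if_neg h]
  filter_upwards [eventually_all.2 key] with z hz
  exact Finset.sum_congr rfl fun σ _ => hz σ

lemma not_dvd_card_fixing_last (hn : (n + 1).Prime) :
    ¬((n + 1 : ℤ) ∣ ∑ σ : K → Equiv.Perm (Fin (n + 1)),
      if ∀ i, σ i (Fin.last n) = Fin.last n then 1 else 0) := by
  have h1 : (∑ σ : K → Equiv.Perm (Fin (n + 1)),
      if ∀ i, σ i (Fin.last n) = Fin.last n then (1 : ℤ) else 0) =
      ∏ _i : K, ∑ g : Equiv.Perm (Fin (n + 1)), if g (Fin.last n) = Fin.last n then (1 : ℤ) else 0 := by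
    rw [Finset.prod_univ_sum, Fintype.piFinset_univ]
    refine Finset.sum_congr rfl fun σ _ => ?_
    rw [Finset.prod_ite_zero]
    simp
  have h2 : Nat.card (MulAction.stabilizer (Equiv.Perm (Fin (n + 1))) (Fin.last n)) = n.factorial := by
    have := (MulAction.stabilizer (Equiv.Perm (Fin (n + 1))) (Fin.last n)).card_mul_index
    rw [MulAction.index_stabilizer_of_transitive, Nat.card_eq_fintype_card (α := Equiv.Perm _),
      Fintype.card_perm, Nat.card_eq_fintype_card (α := Fin _), Fintype.card_fin,
      Nat.factorial_succ, mul_comm] at this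
    exact Nat.eq_of_mul_eq_mul_left n.succ_pos this
  have h3 : (∑ g : Equiv.Perm (Fin (n + 1)), if g (Fin.last n) = Fin.last n then (1 : ℤ) else 0) =
      (n.factorial : ℤ) := by
    rw [← h2, Finset.sum_boole, Nat.card_eq_fintype_card, Fintype.card_subtype]
    simp [MulAction.mem_stabilizer_iff]
  rw [h1, h3, Finset.prod_const]
  intro h
  have h4 : n + 1 ∣ n.factorial ^ (Finset.univ : Finset K).card := by exact_mod_cast h
  have := (hn.dvd_factorial).1 (hn.dvd_of_dvd_pow h4)
  omega

end Degree

section Tverberg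

open Filter Topology

variable {n : ℕ} {K : Type*} [Fintype K] [DecidableEq K]

lemma isClosed_cone_condition {n : ℕ} {K : Type*} [Fintype K] :
    IsClosed {z : (K × Fin n → K → ℝ) × (K × Fin n → ℝ) | ∃ σ : K → Equiv.Perm (Fin (n + 1)),
      ∃ ν ∈ stdSimplex ℝ (Option (K × Fin n)),
        (fun q => ν (some q)) ᵥ* colorMatrix σ z.1 = ν none • z.2} := by
  rw [Set.ofPred_exists]
  refine isClosed_iUnion_of_finite fun σ => ?_
  have hν : ∀ o, Continuous fun r : stdSimplex ℝ (Option (K × Fin n)) ×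
      ((K × Fin n → K → ℝ) × (K × Fin n → ℝ)) => r.1.1 o := fun o =>
    (continuous_apply o).comp (continuous_subtype_val.comp continuous_fst)
  have hc : IsClosed {r : stdSimplex ℝ (Option (K × Fin n)) ×
      ((K × Fin n → K → ℝ) × (K × Fin n → ℝ)) |
      (fun q => r.1.1 (some q)) ᵥ* colorMatrix σ r.2.1 = r.1.1 none • r.2.2} := by
    refine isClosed_eq (Continuous.matrix_vecMul ?_ ?_) ?_
    · exact continuous_pi fun q => hν (some q)
    · exact (continuous_colorMatrix σ).comp (by fun_prop)
    · exact (hν none).smul (continuous_snd.comp continuous_snd)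
  convert isClosedMap_snd_of_compactSpace _ hc using 1
  ext z
  constructor
  · rintro ⟨ν, hν, h⟩
    exact ⟨(⟨ν, hν⟩, z), h, rfl⟩
  · rintro ⟨⟨⟨ν, hν⟩, z'⟩, h, rfl⟩
    exact ⟨ν, hν, h⟩

lemma exists_cone_of_colorDegree_ne_zero (X : K × Fin n → K → ℝ) (y : K × Fin n → ℝ)
    (h : colorDegree X y ≠ 0) : ∃ σ : K → Equiv.Perm (Fin (n + 1)),
      ∃ ν ∈ stdSimplex ℝ (Option (K × Fin n)),
        (fun q => ν (some q)) ᵥ* colorMatrix σ X = ν none • y := by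
  obtain ⟨σ, -, hσ⟩ := Finset.exists_ne_zero_of_sum_ne_zero h
  have h1 : ∃ μ : K × Fin n → ℝ, 0 ≤ μ ∧ μ ᵥ* colorMatrix σ X = y := by
    by_contra h'
    simp [coneSign, h'] at hσ
  obtain ⟨μ, hμ, hs⟩ := h1
  have hpos : 0 < 1 + ∑ q, μ q := by
    have := Finset.sum_nonneg fun q (_ : q ∈ Finset.univ) => hμ q
    linarith
  refine ⟨σ, fun o => (1 + ∑ q, μ q)⁻¹ * o.elim 1 μ, ⟨?_, ?_⟩, ?_⟩
  · rintro (_ | q)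
    · simpa using hpos.le
    · exact mul_nonneg (inv_nonneg.2 hpos.le) (hμ q)
  · rw [← Finset.mul_sum, Fintype.sum_option]
    exact inv_mul_cancel₀ hpos.ne'
  · change ((1 + ∑ q, μ q)⁻¹ • μ) ᵥ* colorMatrix σ X = _
    rw [Matrix.smul_vecMul, hs]
    simp

theorem exists_cone [Nonempty K] (hn : (n + 1).Prime) (X : K × Fin n → K → ℝ)
    (hX : ∀ q, 0 < ∑ k, X q k) : ∃ σ : K → Equiv.Perm (Fin (n + 1)),
      ∃ ν ∈ stdSimplex ℝ (Option (K × Fin n)),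
        (fun q => ν (some q)) ᵥ* colorMatrix σ X = ν none • 1 := by
  classical
  set C := {z : (K × Fin n → K → ℝ) × (K × Fin n → ℝ) |
    ∃ σ : K → Equiv.Perm (Fin (n + 1)), ∃ ν ∈ stdSimplex ℝ (Option (K × Fin n)),
        (fun q => ν (some q)) ᵥ* colorMatrix σ z.1 = ν none • z.2} with hC
  by_contra hcon
  have hXC : (X, (1 : K × Fin n → ℝ)) ∈ Cᶜ := hcon
  set e : K × Fin n → K → ℝ := fun q => Pi.single q.1 1 with he
  have hopen : ∀ᶠ z in 𝓝 (X, (1 : K × Fin n → ℝ)), z ∈ Cᶜ :=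
    isClosed_cone_condition.isOpen_compl.mem_nhds hXC
  have hpos : ∀ X₀ : K × Fin n → K → ℝ, (∀ q, 0 < ∑ k, X₀ q k) →
      ∀ᶠ X in 𝓝 X₀, ∀ q, 0 < ∑ k, X q k := by
    intro X₀ h0
    refine eventually_all.2 fun q => ?_
    have : Continuous fun X : K × Fin n → K → ℝ => ∑ k, X q k := by fun_prop
    exact this.continuousAt.eventually_const_lt (h0 q)
  have hall : ∀ᶠ z : ((K × Fin n → K → ℝ) × (K × Fin n → K → ℝ)) × (K × Fin n → ℝ) in
      𝓝 ((X, e), 1), (z.1.1, z.2) ∈ Cᶜ ∧ (∀ q, 0 < ∑ k, z.1.1 q k) ∧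
        (∀ q, 0 < ∑ k, z.1.2 q k) ∧ colorDegree z.1.2 z.2 =
        ∑ σ : K → Equiv.Perm (Fin (n + 1)),
          if ∀ i, σ i (Fin.last n) = Fin.last n then 1 else 0 := by
    have c1 : Tendsto (fun z : ((K × Fin n → K → ℝ) × (K × Fin n → K → ℝ)) × (K × Fin n → ℝ) =>
        (z.1.1, z.2)) (𝓝 ((X, e), 1)) (𝓝 (X, 1)) := Continuous.tendsto' (by fun_prop) _ _ rfl
    have c2 : Tendsto (fun z : ((K × Fin n → K → ℝ) × (K × Fin n → K → ℝ)) × (K × Fin n → ℝ) =>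
        (z.1.2, z.2)) (𝓝 ((X, e), 1)) (𝓝 (e, 1)) := Continuous.tendsto' (by fun_prop) _ _ rfl
    have c3 := (continuous_fst (X := K × Fin n → K → ℝ) (Y := K × Fin n → ℝ)).tendsto
    filter_upwards [c1.eventually hopen, c1.eventually ((c3 _).eventually (hpos X hX)),
      c2.eventually ((c3 _).eventually (hpos e fun q => by simp [he])),
      c2.eventually eventually_colorDegree] with z h1 h2 h3 h4
    exact ⟨h1, h2, h3, h4⟩
  rw [nhds_prod_eq] at hall
  obtain ⟨A, hA, B, hB, hAB⟩ := Filter.eventually_prod_iff.1 hall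
  obtain ⟨w, hw, hwA⟩ := dense_properlyPointed.inter_nhds_nonempty
    (show {w | A w} ∈ 𝓝 (X, e) from hA)
  obtain ⟨y, hy, hyB⟩ := (dense_isGenericFor
    (J := Finset (K × Fin n) × (K × Fin n) × (K → Equiv.Perm (Fin (n + 1))))
    (fun r => extendRows (colorMatrix r.2.2 (r.1.piecewise w.2 w.1))
      (tensorVec (w.2 r.2.1) (r.2.2 r.2.1.1 r.2.1.2.castSucc)))
    (by simp)).inter_nhds_nonempty (show {y | B y} ∈ 𝓝 1 from hB)
  obtain ⟨h1, h2, h3, h4⟩ := hAB hwA hyB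
  simp only at h1 h2 h3 h4
  have hmod : ∀ s : Finset (K × Fin n),
      colorDegree w.1 y ≡ colorDegree (s.piecewise w.2 w.1) y [ZMOD (n + 1)] := by
    intro s
    induction s using Finset.induction_on with
    | empty => rw [Finset.piecewise_empty]
    | insert q s hq ih =>
      rw [Finset.piecewise_insert]
      exact ih.trans (colorDegree_update_modEq _ q _ y (hw h2 h3 s q hq)
        fun σ => hy ⟨s, q, σ⟩)
  have hmod' := hmod Finset.univ
  rw [Finset.piecewise_univ, h4] at hmod'
  refine h1 (exists_cone_of_colorDegree_ne_zero _ _ fun h0 => ?_)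
  rw [h0] at hmod'
  exact not_dvd_card_fixing_last hn (by simpa using hmod'.dvd)

/-- The colored Tverberg theorem, in the form of a balanced convex combination. -/
theorem exists_colored_tverberg (d n : ℕ) (hn : (n + 1).Prime)
    (x : Fin (d + 1) × Fin n → EuclideanSpace ℝ (Fin d)) :
    ∃ (σ : Fin (d + 1) → Equiv.Perm (Fin (n + 1))) (μ : Fin (d + 1) × Fin n → ℝ)
      (p : EuclideanSpace ℝ (Fin d)), 0 ≤ μ ∧ ∀ b : Fin n,
      ∑ q with σ q.1 q.2.castSucc = b.castSucc, μ q = 1 ∧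
      ∑ q with σ q.1 q.2.castSucc = b.castSucc, μ q • x q = p := by
  set X : Fin (d + 1) × Fin n → Fin (d + 1) → ℝ := fun q =>
    Fin.cons (1 - ∑ a, x q a) (x q) with hX
  have hsum : ∀ q, ∑ k, X q k = 1 := by
    intro q
    rw [Fin.sum_univ_succ]
    simp [hX]
  obtain ⟨σ, ν, ⟨hν0, hν1⟩, hs⟩ := exists_cone hn X fun q => by rw [hsum]; exact one_pos
  set S : Fin (n + 1) → Fin (d + 1) → ℝ := fun c k =>
    ∑ q, if σ q.1 q.2.castSucc = c then ν (some q) * X q k else 0 with hS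
  set m : Fin (n + 1) → ℝ := fun c =>
    ∑ q, if σ q.1 q.2.castSucc = c then ν (some q) else 0 with hm
  have hSb : ∀ (b : Fin n) k, S b.castSucc k = S (Fin.last n) k + ν none := by
    intro b k
    have h1 := sum_tensorVec_apply X (fun q => σ q.1 q.2.castSucc) (fun q => ν (some q)) k b
    have h2 := congrFun hs (k, b)
    rw [Matrix.vecMul_eq_sum] at h2
    have h3 : (ν none • (1 : Fin (d + 1) × Fin n → ℝ)) (k, b) = ν none := by simp
    rw [h3] at h2
    have h4 : ν none = S b.castSucc k - S (Fin.last n) k := h2.symm.trans h1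
    linarith
  have hmS : ∀ c, m c = ∑ k, S c k := by
    intro c
    simp only [hS, hm]
    rw [Finset.sum_comm]
    refine Finset.sum_congr rfl fun q _ => ?_
    split_ifs
    · rw [← Finset.mul_sum, hsum, mul_one]
    · simp
  set m₀ := m (Fin.last n) + (d + 1) * ν none with hm₀
  have hmb : ∀ b : Fin n, m b.castSucc = m₀ := by
    intro b
    rw [hmS, hm₀, hmS]
    simp [hSb, Finset.sum_add_distrib]
  have hm0 : ∀ c, 0 ≤ m c := fun c => Finset.sum_nonneg fun q _ => by
    split_ifs
    exacts [hν0 _, le_rfl]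
  have hd1 : (0 : ℝ) < d + 1 := by positivity
  have hm₀pos : 0 < m₀ := by
    have h1 : ν none + ∑ c, m c = 1 := by
      rw [← hν1, Fintype.sum_option]
      simp only [hm]
      rw [Finset.sum_comm]
      simp
    rw [Fin.sum_univ_castSucc] at h1
    simp only [hmb] at h1
    by_contra hle
    have h2 : 0 ≤ (d + 1) * ν none := mul_nonneg hd1.le (hν0 none)
    have h3 := hm0 (Fin.last n)
    have h4 : m (Fin.last n) = 0 := by linarith
    have h5 : (d + 1 : ℝ) * ν none = 0 := by linarith
    have h6 : ν none = 0 := (mul_eq_zero.1 h5).resolve_left hd1.ne'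
    have h7 : m₀ = 0 := by linarith
    simp [h4, h6, h7] at h1
  refine ⟨σ, fun q => ν (some q) / m₀,
    WithLp.toLp 2 fun a => (S (Fin.last n) a.succ + ν none) / m₀,
    fun q => div_nonneg (hν0 _) hm₀pos.le, fun b => ⟨?_, ?_⟩⟩
  · rw [← Finset.sum_div, Finset.sum_filter]
    change m b.castSucc / m₀ = 1
    rw [hmb, div_self hm₀pos.ne']
  · ext a
    change _ = (S (Fin.last n) a.succ + ν none) / m₀
    rw [← hSb b, WithLp.ofLp_sum, Finset.sum_apply, Finset.sum_filter]
    simp only [hS, Finset.sum_div]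
    refine Finset.sum_congr rfl fun q _ => ?_
    split_ifs
    · simp [hX]; ring
    · simp

end Tverberg

section Cone

/-- The convex cone generated by a family of vectors. -/
def coneHull {I E : Type*} [Fintype I] [AddCommGroup E] [Module ℝ E] (v : I → E) : Set E :=
  {x | ∃ c : I → ℝ, 0 ≤ c ∧ ∑ i, c i • v i = x}

variable {I E : Type*} [Fintype I]

lemma convex_coneHull [AddCommGroup E] [Module ℝ E] (v : I → E) : Convex ℝ (coneHull v) := by
  rintro _ ⟨c, hc, rfl⟩ _ ⟨c', hc', rfl⟩ a b ha hb -
  refine ⟨a • c + b • c', add_nonneg (smul_nonneg ha hc) (smul_nonneg hb hc'), ?_⟩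
  simp [add_smul, mul_smul, Finset.sum_add_distrib, Finset.smul_sum]

/-- The conic form of Carathéodory's theorem. -/
lemma exists_linearIndependent_of_mem_coneHull [AddCommGroup E] [Module ℝ E] (v : I → E) (x : E)
    (hx : x ∈ coneHull v) : ∃ (J : Finset I) (c : I → ℝ), 0 ≤ c ∧ (∀ i ∉ J, c i = 0) ∧
      ∑ i, c i • v i = x ∧ LinearIndependent ℝ fun i : J => v i := by
  classical
  obtain ⟨c, hc, hcx⟩ := hx
  induction h : (Finset.univ.filter fun i => c i ≠ 0).card using Nat.strong_induction_on
    generalizing c with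
  | _ N ih =>
    set J := Finset.univ.filter fun i => c i ≠ 0 with hJ
    by_cases hl : LinearIndependent ℝ fun i : J => v i
    · exact ⟨J, c, hc, fun i hi => by simpa [hJ] using hi, hcx, hl⟩
    obtain ⟨g', hg', i', hi'⟩ := Fintype.not_linearIndependent_iff.1 hl
    have hexg : ∃ g : I → ℝ, ∑ i, g i • v i = 0 ∧ (∀ i ∉ J, g i = 0) ∧ ∃ i, 0 < g i := by
      have : ∀ g' : J → ℝ, ∑ i, g' i • v i = 0 → (∃ i, 0 < g' i) →
          ∃ g : I → ℝ, ∑ i, g i • v i = 0 ∧ (∀ i ∉ J, g i = 0) ∧ ∃ i, 0 < g i := by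
        rintro g' hg' ⟨i', hi'⟩
        refine ⟨fun i => if hi : i ∈ J then g' ⟨i, hi⟩ else 0, ?_, fun i hi => dif_neg hi, i', ?_⟩
        · rw [← hg', ← Finset.sum_subset (Finset.subset_univ J), ← Finset.sum_coe_sort J]
          · exact Finset.sum_congr rfl fun i _ => by simp
          · intro i _ hi
            simp [hi]
        · simpa using hi'
      rcases lt_or_gt_of_ne hi' with h0 | h0
      · refine this (-g') (by simpa using hg') ⟨i', by simpa using h0⟩
      · exact this g' hg' ⟨i', h0⟩
    obtain ⟨g, hg, hgJ, i₀, hi₀⟩ := hexg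
    obtain ⟨i₁, hi₁, hmin⟩ := (Finset.univ.filter fun i => 0 < g i).exists_min_image
      (fun i => c i / g i) ⟨i₀, by simpa using hi₀⟩
    simp only [Finset.mem_filter, Finset.mem_univ, true_and] at hi₁ hmin
    set t := c i₁ / g i₁ with ht
    have ht0 : 0 ≤ t := div_nonneg (hc _) hi₁.le
    have hi₁J : i₁ ∈ J := by
      by_contra h'
      exact hi₁.ne' (hgJ _ h')
    refine ih (Finset.univ.filter fun i => (c - t • g) i ≠ 0).card ?_ (c - t • g) ?_ ?_ rfl
    · rw [← h]
      refine Finset.card_lt_card ((Finset.ssubset_iff_of_subset ?_).2 ⟨i₁, hi₁J, ?_⟩)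
      · intro i hi
        by_contra hiJ
        have h1 : c i = 0 := by simpa [hJ] using hiJ
        simp [hgJ i hiJ, h1] at hi
      · simp [ht, hi₁.ne']
    · intro i
      simp only [Pi.zero_apply, Pi.sub_apply, Pi.smul_apply, smul_eq_mul, sub_nonneg]
      rcases lt_or_ge 0 (g i) with hgi | hgi
      · exact (le_div_iff₀ hgi).1 (hmin i hgi)
      · exact (mul_nonpos_of_nonneg_of_nonpos ht0 hgi).trans (hc i)
    · simp [sub_smul, mul_smul, Finset.sum_sub_distrib, ← Finset.smul_sum, hg, hcx]

variable [NormedAddCommGroup E] [InnerProductSpace ℝ E]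

lemma isClosed_coneHull (v : I → E) : IsClosed (coneHull v) := by
  classical
  have : coneHull v = ⋃ J : {J : Finset I // LinearIndependent ℝ fun i : J => v i},
      (Fintype.linearCombination ℝ fun i : J.1 => v i) '' {c | 0 ≤ c} := by
    ext x
    rw [Set.mem_iUnion]
    constructor
    · intro hx
      obtain ⟨J, c, hc, hcJ, hcx, hl⟩ := exists_linearIndependent_of_mem_coneHull v x hx
      refine ⟨⟨J, hl⟩, fun i => c i, fun i => hc i, ?_⟩
      rw [Fintype.linearCombination_apply, ← hcx, ← Finset.sum_subset (Finset.subset_univ J),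
        ← Finset.sum_coe_sort J]
      intro i _ hi
      simp [hcJ i hi]
    · rintro ⟨⟨J, hl⟩, c, hc, rfl⟩
      refine ⟨fun i => if hi : i ∈ J then c ⟨i, hi⟩ else 0, fun i => ?_, ?_⟩
      · simp only [Pi.zero_apply]
        split_ifs
        exacts [hc _, le_rfl]
      · rw [Fintype.linearCombination_apply, ← Finset.sum_subset (Finset.subset_univ J),
          ← Finset.sum_coe_sort J]
        · exact Finset.sum_congr rfl fun i _ => by simp
        · intro i _ hi
          simp [hi]
  rw [this]
  refine isClosed_iUnion_of_finite fun J => ?_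
  refine (LinearMap.isClosedEmbedding_of_injective
    (f := Fintype.linearCombination ℝ fun i : J.1 => v i) ?_).isClosedMap _
    (isClosed_le continuous_const continuous_id)
  exact LinearMap.ker_eq_bot.2 (LinearIndependent.fintypeLinearCombination_injective J.2)

lemma inner_sub_le_zero_of_forall_norm_le {P : Set E} (hP : Convex ℝ P) {a z : E} (hz : z ∈ P)
    (hmin : ∀ w ∈ P, ‖a - z‖ ≤ ‖a - w‖) (w : E) (hw : w ∈ P) : inner ℝ (a - z) (w - z) ≤ 0 := by
  refine (norm_eq_iInf_iff_real_inner_le_zero hP hz).1 ?_ w hw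
  have : Nonempty P := ⟨⟨z, hz⟩⟩
  refine le_antisymm (le_ciInf fun w => hmin w w.2) ?_
  exact ciInf_le (f := fun w : P => ‖a - w‖) ⟨0, by rintro _ ⟨w, rfl⟩; positivity⟩ ⟨z, hz⟩

variable [FiniteDimensional ℝ E]

/-- The conic form of the colorful Carathéodory theorem. -/
theorem exists_mem_coneHull_of_colors (hcard : Fintype.card I = Module.finrank ℝ E)
    (S : I → Finset E) (hS : ∀ i, (S i).Nonempty) (a : E)
    (ha : ∀ i, ∃ w : E → ℝ, (∀ s ∈ S i, 0 ≤ w s) ∧ ∑ s ∈ S i, w s • s = a) :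
    ∃ s : I → E, (∀ i, s i ∈ S i) ∧ a ∈ coneHull s := by
  classical
  obtain ⟨s, hs, hmin⟩ := (Fintype.piFinset S).exists_min_image
    (fun s => Metric.infDist a (coneHull s)) (Fintype.piFinset_nonempty.2 hS)
  have hs' : ∀ i, s i ∈ S i := Fintype.mem_piFinset.1 hs
  refine ⟨s, hs', ?_⟩
  have hne : ∀ v : I → E, (coneHull v).Nonempty := fun v => ⟨0, 0, le_rfl, by simp⟩
  obtain ⟨z, hz, hzd⟩ := (isClosed_coneHull s).exists_infDist_eq_dist (hne s) a
  have hkkt : ∀ s' ∈ Fintype.piFinset S, z ∈ coneHull s' → ∀ w ∈ coneHull s',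
      inner ℝ (a - z) (w - z) ≤ 0 := by
    intro s' hs' hzs' w hw
    refine inner_sub_le_zero_of_forall_norm_le (convex_coneHull s') hzs' (fun w hw => ?_) w hw
    rw [← dist_eq_norm, ← dist_eq_norm, ← hzd]
    exact (hmin s' hs').trans (Metric.infDist_le_dist_of_mem hw)
  have hadd : ∀ s' : I → E, z ∈ coneHull s' → ∀ i, z + s' i ∈ coneHull s' := by
    rintro s' ⟨c, hc, hcz⟩ i
    refine ⟨c + Pi.single i 1, add_nonneg hc (Pi.single_nonneg.2 zero_le_one), ?_⟩
    simp only [Pi.add_apply, add_smul, Finset.sum_add_distrib, hcz]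
    congr 1
    rw [Finset.sum_eq_single i] <;> simp +contextual
  have hle : ∀ s' ∈ Fintype.piFinset S, z ∈ coneHull s' → ∀ i, inner ℝ (a - z) (s' i) ≤ 0 := by
    intro s' hs' hzs' i
    simpa using hkkt s' hs' hzs' _ (hadd s' hzs' i)
  by_cases haz : a - z = 0
  · rw [sub_eq_zero.1 haz]; exact hz
  exfalso
  obtain ⟨J, c, hc, hcJ, hcz, hl⟩ := exists_linearIndependent_of_mem_coneHull s z hz
  have hz0 : inner ℝ (a - z) z = 0 := by
    have h1 := hkkt s hs hz 0 ⟨0, le_rfl, by simp⟩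
    have h2 : inner ℝ (a - z) z ≤ 0 := by
      have h3 := hkkt s hs hz (z + z) ⟨c + c, add_nonneg hc hc, by
        simp [add_smul, Finset.sum_add_distrib, hcz]⟩
      simpa using h3
    simp only [zero_sub, inner_neg_right] at h1
    linarith
  have hterm : ∀ i, c i * inner ℝ (a - z) (s i) = 0 := by
    have h1 : ∑ i, c i * inner ℝ (a - z) (s i) = 0 := by
      calc ∑ i, c i * inner ℝ (a - z) (s i) = inner ℝ (a - z) (∑ i, c i • s i) := by
            simp only [inner_sum, inner_smul_right]
        _ = 0 := by rw [hcz, hz0]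
    intro i
    exact (Finset.sum_eq_zero_iff_of_nonpos fun i _ =>
      mul_nonpos_of_nonneg_of_nonpos (hc i) (hle s hs hz i)).1 h1 i (Finset.mem_univ i)
  have hJ : ∃ i, c i = 0 := by
    by_contra hcon
    push Not at hcon
    have hl' : LinearIndependent ℝ s := by
      have hJu : ∀ i, i ∈ J := fun i => by
        by_contra h
        exact hcon i (hcJ i h)
      exact hl.comp (fun i => (⟨i, hJu i⟩ : J)) fun i j h => by simpa using h
    have hspan := hl'.span_eq_top_of_card_eq_finrank' hcard
    have : ∀ x ∈ Submodule.span ℝ (Set.range s), inner ℝ (a - z) x = 0 := by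
      intro x hx
      induction hx using Submodule.span_induction with
      | mem x hx =>
        obtain ⟨i, rfl⟩ := hx
        exact (mul_eq_zero.1 (hterm i)).resolve_left (hcon i)
      | zero => simp
      | add x y _ _ hx hy => rw [inner_add_right, hx, hy, add_zero]
      | smul r x _ hx => rw [inner_smul_right, hx, mul_zero]
    exact haz (inner_self_eq_zero.1 (this (a - z) (hspan ▸ Submodule.mem_top)))
  obtain ⟨i, hi⟩ := hJ
  have hpos : 0 < inner ℝ (a - z) a := by
    have h1 : inner ℝ (a - z) a = inner ℝ (a - z) (a - z) := by
      rw [inner_sub_right _ a z, hz0, sub_zero]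
    rw [h1]
    exact real_inner_self_pos.2 haz
  obtain ⟨w, hw, hwa⟩ := ha i
  have hex : ∃ x ∈ S i, 0 < inner ℝ (a - z) x := by
    by_contra hcon
    push Not at hcon
    have h1 : inner ℝ (a - z) a ≤ 0 := by
      have h2 : inner ℝ (a - z) a = inner ℝ (a - z) (∑ s ∈ S i, w s • s) := by rw [hwa]
      rw [h2, inner_sum]
      refine Finset.sum_nonpos fun x hx => ?_
      rw [inner_smul_right]
      exact mul_nonpos_of_nonneg_of_nonpos (hw x hx) (hcon x hx)
    linarith
  obtain ⟨x, hx, hxpos⟩ := hex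
  have h1 := hle (Function.update s i x) (Fintype.mem_piFinset.2 fun j => by
    by_cases hj : j = i
    · subst hj; simpa using hx
    · simpa [hj] using hs' j) ⟨c, hc, by
      rw [← hcz]
      refine Finset.sum_congr rfl fun j _ => ?_
      by_cases hj : j = i
      · subst hj; simp [hi]
      · simp [hj]⟩ i
  simp only [Function.update_self] at h1
  linarith

end Cone

section Steinitz

lemma convexHull_neg_vadd {E : Type*} [AddCommGroup E] [Module ℝ E] (v : E) (S : Set E) :
    v ∈ convexHull ℝ S ↔ 0 ∈ convexHull ℝ ((-v) +ᵥ S) := by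
  rw [convexHull_vadd, Set.mem_vadd_set_iff_neg_vadd_mem]
  simp

variable {I E : Type*} [Fintype I] [NormedAddCommGroup E] [InnerProductSpace ℝ E]

lemma exists_one_le_norm_of_closedBall_subset [Nontrivial E] {S : Set E}
    (hS : Metric.closedBall 0 1 ⊆ convexHull ℝ S) : ∃ x ∈ S, 1 ≤ ‖x‖ := by
  by_contra! hcon
  obtain ⟨u, hu⟩ := exists_norm_eq E zero_le_one
  have h1 : convexHull ℝ S ⊆ Metric.ball 0 1 :=
    convexHull_min (fun x hx => by simpa using hcon x hx) (convex_ball _ _)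
  have h2 := h1 (hS (show u ∈ Metric.closedBall 0 1 by simp [hu]))
  simp [hu] at h2

lemma exists_linearIsometryEquiv_smul {v x : E} (hx : x ≠ 0) :
    ∃ Φ : E ≃ₗᵢ[ℝ] E, Φ v = (‖v‖ / ‖x‖) • x := by
  refine ⟨(ℝ ∙ (v - (‖v‖ / ‖x‖) • x))ᗮ.reflection, Submodule.reflection_sub ?_⟩
  rw [norm_smul, norm_div, norm_norm, norm_norm, div_mul_cancel₀ _ (norm_ne_zero_iff.2 hx)]

variable [FiniteDimensional ℝ E]

/-- The colorful Carathéodory theorem with one prescribed point. -/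
theorem exists_zero_mem_convexHull_insert (hcard : Fintype.card I = Module.finrank ℝ E)
    (S : I → Set E) (hS : ∀ i, 0 ∈ convexHull ℝ (S i)) (x₀ : E) :
    ∃ s : I → E, (∀ i, s i ∈ S i) ∧ 0 ∈ convexHull ℝ (insert x₀ (Set.range s)) := by
  classical
  have hfin : ∀ i, ∃ F : Finset E, (F : Set E) ⊆ S i ∧ 0 ∈ convexHull ℝ (F : Set E) := by
    intro i
    have h := hS i
    rw [convexHull_eq_union_convexHull_finite_subsets] at h
    simpa using h
  choose F hFS hF using hfin
  have hFne : ∀ i, (F i).Nonempty := fun i =>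
    Finset.coe_nonempty.1 (convexHull_nonempty_iff.1 ⟨0, hF i⟩)
  obtain ⟨s, hs, hmin⟩ := (Fintype.piFinset F).exists_min_image
    (fun s => Metric.infDist 0 (convexHull ℝ (insert x₀ (Set.range s))))
    (Fintype.piFinset_nonempty.2 hFne)
  refine ⟨s, fun i => hFS i (Fintype.mem_piFinset.1 hs i), ?_⟩
  have hne : ∀ s : I → E, (convexHull ℝ (insert x₀ (Set.range s))).Nonempty := fun s =>
    (Set.insert_nonempty _ _).convexHull
  have hclosed : IsClosed (convexHull ℝ (insert x₀ (Set.range s))) :=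
    Set.Finite.isClosed_convexHull ℝ ((Set.finite_range s).insert x₀)
  refine (hclosed.mem_iff_infDist_zero (hne s)).2 (le_antisymm ?_ Metric.infDist_nonneg)
  have key : ∀ δ : ℝ, 0 < δ →
      Metric.infDist 0 (convexHull ℝ (insert x₀ (Set.range s))) ≤ δ * ‖x₀‖ := by
    intro δ hδ
    obtain ⟨s', hs', c, hc, hca⟩ := exists_mem_coneHull_of_colors hcard
      (fun i => (F i).image (· + δ • (-x₀))) (fun i => (hFne i).image _) (-x₀) (by
        intro i
        obtain ⟨w, hw, hw1, hw0⟩ := Finset.mem_convexHull'.1 (hF i)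
        refine ⟨fun y => δ⁻¹ * w (y - δ • (-x₀)), ?_, ?_⟩
        · intro y hy
          obtain ⟨x, hx, rfl⟩ := Finset.mem_image.1 hy
          simpa using mul_nonneg (inv_nonneg.2 hδ.le) (hw x hx)
        · rw [Finset.sum_image fun x _ y _ h => add_right_cancel h]
          simp only [add_sub_cancel_right, mul_smul, ← Finset.smul_sum, smul_add,
            Finset.sum_add_distrib, hw0, ← Finset.sum_smul, hw1]
          simp [hδ.ne'])
    choose r hr hrs using fun i => Finset.mem_image.1 (hs' i)
    refine (hmin r (Fintype.mem_piFinset.2 hr)).trans ?_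
    set Λ := ∑ i, c i with hΛ
    have hΛ0 : 0 ≤ Λ := Finset.sum_nonneg fun i _ => hc i
    have hsum : x₀ + ∑ i, c i • r i = (Λ * δ) • x₀ := by
      have h1 : ∑ i, c i • s' i = ∑ i, c i • r i - (Λ * δ) • x₀ := by
        simp only [← hrs, smul_add, Finset.sum_add_distrib, ← Finset.sum_smul, ← hΛ]
        rw [smul_neg, smul_neg, mul_smul, sub_eq_add_neg]
      rw [h1] at hca
      rw [← sub_eq_zero, add_sub_assoc, hca, add_neg_cancel]
    have hmem : (1 + Λ)⁻¹ • (x₀ + ∑ i, c i • r i) ∈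
        convexHull ℝ (insert x₀ (Set.range r)) := by
      have h1 := (convex_convexHull ℝ (insert x₀ (Set.range r))).sum_mem
        (t := Finset.univ) (w := fun o : Option I => (1 + Λ)⁻¹ * o.elim 1 c)
        (z := fun o => o.elim x₀ r) ?_ ?_ ?_
      · simpa [Fintype.sum_option, mul_smul, ← Finset.smul_sum] using h1
      · rintro (_ | i) -
        · simp only [Option.elim]; positivity
        · exact mul_nonneg (by positivity) (hc i)
      · rw [← Finset.mul_sum, Fintype.sum_option]
        exact inv_mul_cancel₀ (by positivity)
      · rintro (_ | i) -
        · exact subset_convexHull _ _ (Set.mem_insert _ _)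
        · exact subset_convexHull _ _ (Set.mem_insert_of_mem _ ⟨i, rfl⟩)
    refine (Metric.infDist_le_dist_of_mem hmem).trans ?_
    rw [dist_zero_left, hsum, ← mul_smul, norm_smul, Real.norm_of_nonneg (by positivity)]
    refine mul_le_mul_of_nonneg_right ?_ (norm_nonneg _)
    rw [inv_mul_le_iff₀ (by positivity)]
    nlinarith
  refine le_of_forall_pos_le_add fun η hη => ?_
  refine (key (η / (‖x₀‖ + 1)) (by positivity)).trans ?_
  rw [zero_add, div_mul_eq_mul_div, div_le_iff₀ (by positivity)]
  nlinarith

theorem exists_mem_convexHull_insert (hcard : Fintype.card I = Module.finrank ℝ E)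
    (S : I → Set E) (v : E) (hS : ∀ i, v ∈ convexHull ℝ (S i)) (x₀ : E) :
    ∃ s : I → E, (∀ i, s i ∈ S i) ∧ v ∈ convexHull ℝ (insert x₀ (Set.range s)) := by
  obtain ⟨s, hs, h⟩ := exists_zero_mem_convexHull_insert hcard (fun i => (-v) +ᵥ S i)
    (fun i => (convexHull_neg_vadd v (S i)).1 (hS i)) (-v + x₀)
  refine ⟨fun i => v + s i, fun i => ?_, ?_⟩
  · simpa [Set.mem_vadd_set_iff_neg_vadd_mem] using hs i
  · rw [convexHull_neg_vadd]
    convert h using 2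
    rw [Set.vadd_set_insert]
    congr 1
    ext y
    simp [Set.mem_vadd_set]

/-- Points of `(#J) * dim E + 1` sets around the unit ball capture a rotated copy of a given
configuration of `#J + 1` points. -/
lemma exists_rotation_subset_convexHull [Nontrivial E] {J : Type*}
    (hcard : Fintype.card I = Module.finrank ℝ E) (v₁ : E) (v : J → E)
    (hv₁0 : v₁ ≠ 0) (hv₁ : ‖v₁‖ ≤ 1) (hv : ∀ j, ‖v j‖ ≤ 1)
    (h0 : 0 ∈ convexHull ℝ (insert v₁ (Set.range v))) (S : Option (J × I) → Set E)
    (hS : ∀ o, Metric.closedBall 0 1 ⊆ convexHull ℝ (S o)) :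
    ∃ (s : Option (J × I) → E) (Φ : E ≃ₗᵢ[ℝ] E), (∀ o, s o ∈ S o) ∧
      Φ '' insert v₁ (Set.range v) ⊆ convexHull ℝ (Set.range s) := by
  obtain ⟨x₀, hx₀S, hx₀⟩ := exists_one_le_norm_of_closedBall_subset (hS none)
  have hx₀0 : x₀ ≠ 0 := fun h => by norm_num [h] at hx₀
  obtain ⟨Φ, hΦ⟩ := exists_linearIsometryEquiv_smul (v := v₁) hx₀0
  choose r hr hrv using fun j => exists_mem_convexHull_insert hcard (fun i => S (some (j, i)))
    (Φ (v j)) (fun i => hS _ (by simpa using hv j)) x₀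
  let s : Option (J × I) → E := fun o => o.elim x₀ fun q => r q.1 q.2
  set C := convexHull ℝ (Set.range s) with hC
  have hCconv : Convex ℝ C := convex_convexHull ℝ _
  have hx₀C : x₀ ∈ C := subset_convexHull _ _ ⟨none, rfl⟩
  have hvC : ∀ j, Φ (v j) ∈ C := fun j => by
    refine convexHull_mono ?_ (hrv j)
    rintro _ (rfl | ⟨i, rfl⟩)
    exacts [⟨none, rfl⟩, ⟨some (j, i), rfl⟩]
  set c := ‖v₁‖ / ‖x₀‖ with hc
  have hc0 : 0 < c := div_pos (norm_pos_iff.2 hv₁0) (norm_pos_iff.2 hx₀0)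
  have hc1 : c ≤ 1 := div_le_one_of_le₀ (hv₁.trans hx₀) (norm_nonneg _)
  have h0C : (0 : E) ∈ C := by
    have h1 : (0 : E) ∈ convexHull ℝ (insert (c • x₀) C) := by
      have h2 : (Φ : E →ₗ[ℝ] E) 0 ∈ (Φ : E →ₗ[ℝ] E) '' convexHull ℝ (insert v₁ (Set.range v)) :=
        ⟨0, h0, rfl⟩
      rw [LinearMap.image_convexHull, map_zero] at h2
      refine convexHull_mono ?_ h2
      rintro _ ⟨_, (rfl | ⟨j, rfl⟩), rfl⟩
      · exact Or.inl hΦ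
      · exact Or.inr (hvC j)
    rw [convexHull_insert ⟨x₀, hx₀C⟩, hCconv.convexHull_eq] at h1
    obtain ⟨_, rfl, y, hy, a, b, ha, hb, hab, h⟩ := mem_convexJoin.1 h1
    have hpos : 0 < a * c + b := by
      rcases ha.eq_or_lt with rfl | ha
      · linarith
      · positivity
    have h3 := hCconv hx₀C hy (a := a * c / (a * c + b)) (b := b / (a * c + b)) (by positivity)
      (by positivity) (by rw [← add_div, div_self hpos.ne'])
    convert h3
    rw [div_eq_inv_mul, div_eq_inv_mul, mul_smul, mul_smul, mul_smul, ← smul_add, h, smul_zero]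
  refine ⟨s, Φ, ?_, ?_⟩
  · rintro (_ | ⟨j, i⟩)
    exacts [hx₀S, hr j i]
  · rintro _ ⟨_, (rfl | ⟨j, rfl⟩), rfl⟩
    · rw [hΦ]
      simpa using hCconv hx₀C h0C hc0.le (sub_nonneg.2 hc1) (by ring)
    · exact hvC j

lemma exists_closedBall_zero_subset_convexHull {d n : ℕ} (hd : 0 < d) {ε : ℝ} (hε : 0 < ε)
    (hprop : BallApproxProp d n ε)
    (S : Option (Fin (n - 1) × Fin d) → Set (EuclideanSpace ℝ (Fin d)))
    (hS : ∀ o, Metric.closedBall 0 1 ⊆ convexHull ℝ (S o)) :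
    ∃ s : Option (Fin (n - 1) × Fin d) → EuclideanSpace ℝ (Fin d), (∀ o, s o ∈ S o) ∧
      Metric.closedBall 0 (1 / (1 + ε)) ⊆ convexHull ℝ (Set.range s) := by
  classical
  have : Nonempty (Fin d) := ⟨⟨0, hd⟩⟩
  obtain ⟨V, hV1, hVcard, hV⟩ := hprop
  have hε1 : 0 < 1 + ε := by positivity
  have h0 : (0 : EuclideanSpace ℝ (Fin d)) ∈ convexHull ℝ (V : Set _) := by
    obtain ⟨y, hy, hy0⟩ := hV (Metric.mem_closedBall_self zero_le_one)
    have hy0' : y = 0 := (smul_eq_zero.1 hy0).resolve_left hε1.ne'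
    rwa [← hy0']
  obtain ⟨v₁, hv₁V, hv₁⟩ : ∃ v₁ ∈ V, v₁ ≠ 0 := by
    by_contra! hcon
    obtain ⟨u, hu⟩ := exists_norm_eq (EuclideanSpace ℝ (Fin d)) zero_le_one
    obtain ⟨y, hy, hyu⟩ := hV (show u ∈ Metric.closedBall 0 1 by simp [hu])
    have hy0 : y ∈ ({0} : Set (EuclideanSpace ℝ (Fin d))) :=
      convexHull_min (fun x hx => hcon x hx) (convex_singleton 0) hy
    rw [Set.mem_singleton_iff.1 hy0] at hyu
    simp [← hyu] at hu
  obtain ⟨f⟩ : Nonempty (V.erase v₁ ↪ Fin (n - 1)) := by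
    refine Function.Embedding.nonempty_of_card_le ?_
    rw [Fintype.card_coe, Fintype.card_fin, Finset.card_erase_of_mem hv₁V]
    omega
  set v : Fin (n - 1) → EuclideanSpace ℝ (Fin d) :=
    Function.extend f Subtype.val fun _ => v₁ with hv
  have hVsub : (V : Set (EuclideanSpace ℝ (Fin d))) ⊆ insert v₁ (Set.range v) := by
    intro x hx
    by_cases hxv : x = v₁
    · exact Or.inl hxv
    · exact Or.inr ⟨f ⟨x, Finset.mem_erase.2 ⟨hxv, hx⟩⟩, f.injective.extend_apply _ _ _⟩
  have hvV : ∀ j, v j ∈ V := by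
    intro j
    by_cases h : ∃ a, f a = j
    · obtain ⟨a, rfl⟩ := h
      rw [hv, f.injective.extend_apply]
      exact Finset.mem_of_mem_erase a.2
    · rw [hv, Function.extend_apply' _ _ _ h]
      exact hv₁V
  have hnorm : ∀ x ∈ V, ‖x‖ ≤ 1 := fun x hx => by simpa using hV1 hx
  obtain ⟨s, Φ, hs, hΦ⟩ := exists_rotation_subset_convexHull (I := Fin d) (by simp) v₁ v hv₁
    (hnorm _ hv₁V) (fun j => hnorm _ (hvV j)) (convexHull_mono hVsub h0) S hS
  refine ⟨s, hs, fun x hx => ?_⟩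
  have hx' : (1 + ε) • Φ.symm x ∈ Metric.closedBall (0 : EuclideanSpace ℝ (Fin d)) 1 := by
    rw [mem_closedBall_zero_iff] at hx ⊢
    rw [norm_smul, Real.norm_of_nonneg hε1.le, LinearIsometryEquiv.norm_map]
    rwa [le_div_iff₀' hε1] at hx
  have hy := (Set.smul_mem_smul_set_iff₀ hε1.ne' _ _).1 (hV hx')
  have h2 : (Φ : EuclideanSpace ℝ (Fin d) →ₗ[ℝ] EuclideanSpace ℝ (Fin d)) (Φ.symm x) ∈
      (Φ : EuclideanSpace ℝ (Fin d) →ₗ[ℝ] EuclideanSpace ℝ (Fin d)) '' convexHull ℝ (V : Set _) :=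
    ⟨_, hy, rfl⟩
  rw [LinearMap.image_convexHull] at h2
  have h3 := convexHull_min ((Set.image_mono hVsub).trans hΦ) (convex_convexHull ℝ _) h2
  simpa using h3

/-- A colorful quantitative Steinitz theorem. -/
theorem exists_closedBall_subset_convexHull {d n : ℕ} (hd : 0 < d) {ε : ℝ} (hε : 0 < ε)
    (hprop : BallApproxProp d n ε) (p : EuclideanSpace ℝ (Fin d))
    (S : Fin ((n - 1) * d + 1) → Set (EuclideanSpace ℝ (Fin d)))
    (hS : ∀ l, Metric.closedBall p 1 ⊆ convexHull ℝ (S l)) :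
    ∃ s : Fin ((n - 1) * d + 1) → EuclideanSpace ℝ (Fin d), (∀ l, s l ∈ S l) ∧
      Metric.closedBall p (1 / (1 + ε)) ⊆ convexHull ℝ (Set.range s) := by
  have e : Fin ((n - 1) * d + 1) ≃ Option (Fin (n - 1) × Fin d) :=
    Fintype.equivOfCardEq (by simp)
  obtain ⟨s, hs, hball⟩ := exists_closedBall_zero_subset_convexHull hd hε hprop
    (fun o => (-p) +ᵥ S (e.symm o)) fun o => by
      rw [convexHull_vadd]
      intro x hx
      rw [Set.mem_vadd_set_iff_neg_vadd_mem]
      exact hS _ (by simpa using hx)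
  refine ⟨fun l => p + s (e l), fun l => ?_, fun x hx => ?_⟩
  · have := hs (e l)
    rw [Set.mem_vadd_set_iff_neg_vadd_mem] at this
    simpa using this
  · have h1 := hball (show -p + x ∈ Metric.closedBall 0 (1 / (1 + ε)) by
      rw [mem_closedBall_zero_iff, neg_add_eq_sub, ← dist_eq_norm]
      exact hx)
    have h2 : Set.range (fun l => p + s (e l)) = p +ᵥ Set.range s := by
      rw [← e.surjective.range_comp s]
      ext y
      simp only [Set.mem_vadd_set, Set.mem_range, Function.comp, exists_exists_eq_and, vadd_eq_add]
    rw [h2, convexHull_vadd, Set.mem_vadd_set_iff_neg_vadd_mem]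
    exact h1

end Steinitz

section Assembly

lemma nextPrime_spec (q : ℕ) : (nextPrime q).Prime ∧ q ≤ nextPrime q := by
  obtain ⟨p, hp, hprime⟩ := Nat.exists_infinite_primes q
  exact Nat.sInf_mem (s := {p : ℕ | p.Prime ∧ q ≤ p}) ⟨p, hprime, hp⟩

/-- Weighted averages of transversals of sets around balls surround the averaged ball. -/
lemma closedBall_subset_convexHull_sum {ι E : Type*} [Finite ι] [NormedAddCommGroup E]
    [NormedSpace ℝ E] (Q : Finset ι) (μ : ι → ℝ) (hμ : ∑ q ∈ Q, μ q = 1) (c : ι → E) (p : E)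
    (hc : ∑ q ∈ Q, μ q • c q = p) (T : ι → Set E) (r : ℝ)
    (hT : ∀ q, Metric.closedBall (c q) r ⊆ convexHull ℝ (T q)) :
    Metric.closedBall p r ⊆
      convexHull ℝ ((fun t : ι → E => ∑ q ∈ Q, μ q • t q) '' Set.univ.pi T) := by
  intro x hx
  let f : (ι → E) →ₗ[ℝ] E := ∑ q ∈ Q, μ q • LinearMap.proj q
  have hf : ∀ t, f t = ∑ q ∈ Q, μ q • t q := fun t => by simp [f]
  have himg : (fun t : ι → E => ∑ q ∈ Q, μ q • t q) = f := by
    ext t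
    rw [hf]
  rw [himg, ← LinearMap.image_convexHull, convexHull_pi]
  refine ⟨fun q => c q + (x - p), fun q _ => hT q ?_, ?_⟩
  · rw [Metric.mem_closedBall, dist_eq_norm, add_sub_cancel_left, ← dist_eq_norm]
    exact hx
  · rw [hf]
    simp only [smul_add, Finset.sum_add_distrib, hc, ← Finset.sum_smul, hμ, one_smul]
    abel

theorem exists_disjoint_forall_closedBall_subset_convexHull (d m n' n : ℕ) (hd : 0 < d)
    (ε : ℝ) (hε : 0 < ε) (hprop : BallApproxProp d n' ε) (hn : (n + 1).Prime)
    (hmn : m * ((n' - 1) * d + 1) ≤ n)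
    (T : Fin (d + 1) → Fin n → Set (EuclideanSpace ℝ (Fin d)))
    (hT : ∀ i j, ∃ c : EuclideanSpace ℝ (Fin d),
      Metric.closedBall c 1 ⊆ convexHull ℝ (T i j)) :
    ∃ t : Fin (d + 1) → Fin n → EuclideanSpace ℝ (Fin d),
      (∀ i j, t i j ∈ T i j) ∧
      ∃ A : Fin m → Finset (Fin (d + 1) × Fin n),
        (∀ k l, k ≠ l → Disjoint (A k) (A l)) ∧
        (∀ k, ∀ i : Fin (d + 1),
          ((A k).filter (fun q => q.1 = i)).card ≤ (n' - 1) * d + 1) ∧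
        ∃ p : EuclideanSpace ℝ (Fin d),
          Metric.closedBall p (1 / (1 + ε)) ⊆
            ⋂ k, convexHull ℝ
              ((fun q : Fin (d + 1) × Fin n => t q.1 q.2) ''
                (A k : Set (Fin (d + 1) × Fin n))) := by
  classical
  set N := (n' - 1) * d + 1 with hN
  choose c hc using hT
  obtain ⟨σ, μ, p, hμ, hσ⟩ := exists_colored_tverberg d n hn fun q => c q.1 q.2
  let b : Fin m × Fin N → Fin n := fun kl => Fin.castLE hmn (finProdFinEquiv kl)
  have hb : Function.Injective b := (Fin.castLE_injective hmn).comp finProdFinEquiv.injective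
  let T' : Fin (d + 1) × Fin n → Set (EuclideanSpace ℝ (Fin d)) := fun q => T q.1 q.2
  let R : Fin m × Fin N → Fin (d + 1) × Fin n → Prop := fun kl q =>
    σ q.1 q.2.castSucc = (b kl).castSucc
  have hR : ∀ {kl kl' q}, R kl q → R kl' q → kl = kl' := fun h h' =>
    hb (Fin.castSucc_injective _ (h.symm.trans h'))
  have hblock : ∀ k, ∃ s : Fin N → EuclideanSpace ℝ (Fin d),
      (∀ l, s l ∈ (fun t : Fin (d + 1) × Fin n → EuclideanSpace ℝ (Fin d) =>
        ∑ q with R (k, l) q, μ q • t q) '' Set.univ.pi T') ∧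
      Metric.closedBall p (1 / (1 + ε)) ⊆ convexHull ℝ (Set.range s) := fun k =>
    exists_closedBall_subset_convexHull hd hε hprop p _ fun l =>
      closedBall_subset_convexHull_sum _ μ (hσ _).1 _ p (hσ _).2 T' 1 fun q => hc q.1 q.2
  choose s hs hball using hblock
  choose τ hτT hτ using hs
  have hTne : ∀ q, (T' q).Nonempty := fun q => convexHull_nonempty_iff.1
    ⟨_, hc q.1 q.2 (Metric.mem_closedBall_self zero_le_one)⟩
  choose t₀ ht₀ using hTne
  let t : Fin (d + 1) × Fin n → EuclideanSpace ℝ (Fin d) := fun q =>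
    if h : ∃ kl, R kl q then τ h.choose.1 h.choose.2 q else t₀ q
  have ht : ∀ {k l q}, R (k, l) q → t q = τ k l q := by
    intro k l q h
    have hex : ∃ kl, R kl q := ⟨_, h⟩
    simp only [t, dif_pos hex]
    rw [hR hex.choose_spec h]
  refine ⟨fun i j => t (i, j), fun i j => ?_,
    fun k => Finset.univ.filter fun q => ∃ l, R (k, l) q, ?_, ?_, p, ?_⟩
  · change t (i, j) ∈ T' (i, j)
    simp only [t]
    split_ifs with h
    · exact hτT _ _ _ (Set.mem_univ _)
    · exact ht₀ _
  · intro k l hkl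
    refine Finset.disjoint_left.2 fun q hq hq' => hkl ?_
    obtain ⟨_, h⟩ := (Finset.mem_filter.1 hq).2
    obtain ⟨_, h'⟩ := (Finset.mem_filter.1 hq').2
    exact (Prod.ext_iff.1 (hR h h')).1
  · intro k i
    refine (Finset.card_le_card_of_forall_subsingleton (t := Finset.univ)
      (fun q l => R (k, l) q) ?_ ?_).trans (Finset.card_fin N).le
    · intro q hq
      obtain ⟨l, hl⟩ := (Finset.mem_filter.1 (Finset.mem_filter.1 hq).1).2
      exact ⟨l, Finset.mem_univ _, hl⟩
    · rintro l - ⟨i₁, j₁⟩ ⟨h₁, hr₁⟩ ⟨i₂, j₂⟩ ⟨h₂, hr₂⟩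
      obtain rfl : i₁ = i := (Finset.mem_filter.1 h₁).2
      obtain rfl : i₂ = i₁ := (Finset.mem_filter.1 h₂).2
      have := (σ i₂).injective (Eq.trans hr₁ (Eq.symm hr₂))
      exact Prod.ext rfl (Fin.castSucc_injective _ this)
  · refine Set.subset_iInter fun k => (hball k).trans
      (convexHull_min ?_ (convex_convexHull ℝ _))
    rintro _ ⟨l, rfl⟩
    rw [← hτ k l]
    refine (convex_convexHull ℝ _).sum_mem (fun q _ => hμ q) (hσ _).1 fun q hq => ?_
    have hq' : R (k, l) q := (Finset.mem_filter.1 hq).2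
    rw [← ht hq']
    exact subset_convexHull _ _ ⟨q, by simpa using ⟨l, hq'⟩, rfl⟩

end Assembly

end Auxiliary

/-- Colorful continuous quantitative Tverberg theorem with near-optimal radius (second
part of Theorem 4.2): with `n = ⌈m((n'−1)d+1)+1⌉_p − 1` sets in each of `d + 1` color
classes, all of whose convex hulls contain a unit ball, there are choices
`t_{i,j} ∈ T_{i,j}` and pairwise disjoint sets `A_1, …, A_m` of chosen points, each
containing at most `(n'−1)d+1` points of each color, whose convex hulls have a common
ball of radius `1/(1+ε)`. -/
theorem colorful_continuous_quantitative_tverberg_near_optimal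
    (d m n' : ℕ) (hd : 0 < d) (hm : 0 < m) (hn' : 0 < n')
    (ε : ℝ) (hε : 0 < ε) (hprop : BallApproxProp d n' ε)
    (T : Fin (d + 1) → Fin (nextPrime (m * ((n' - 1) * d + 1) + 1) - 1) →
      Set (EuclideanSpace ℝ (Fin d)))
    (hT : ∀ i j, ∃ c : EuclideanSpace ℝ (Fin d),
      Metric.closedBall c 1 ⊆ convexHull ℝ (T i j)) :
    ∃ t : Fin (d + 1) → Fin (nextPrime (m * ((n' - 1) * d + 1) + 1) - 1) →
        EuclideanSpace ℝ (Fin d),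
      (∀ i j, t i j ∈ T i j) ∧
      ∃ A : Fin m → Finset (Fin (d + 1) × Fin (nextPrime (m * ((n' - 1) * d + 1) + 1) - 1)),
        (∀ k l, k ≠ l → Disjoint (A k) (A l)) ∧
        (∀ k, ∀ i : Fin (d + 1),
          ((A k).filter (fun q => q.1 = i)).card ≤ (n' - 1) * d + 1) ∧
        ∃ p : EuclideanSpace ℝ (Fin d),
          Metric.closedBall p (1 / (1 + ε)) ⊆
            ⋂ k, convexHull ℝ
              ((fun q : Fin (d + 1) × Fin (nextPrime (m * ((n' - 1) * d + 1) + 1) - 1) =>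
                t q.1 q.2) ''
                (A k : Set (Fin (d + 1) × Fin (nextPrime (m * ((n' - 1) * d + 1) + 1) - 1)))) := by
  obtain ⟨hprime, hle⟩ := nextPrime_spec (m * ((n' - 1) * d + 1) + 1)
  have hsub := Nat.sub_add_cancel hprime.one_le
  exact exists_disjoint_forall_closedBall_subset_convexHull d m n' _ hd ε hε hprop
    (by rwa [hsub]) (by omega) T hT
end
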